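/- arXiv:1510.04727 — 5 statements merged into one kernel-verified Lean document; each statement's English description precedes it below -/
import Mathlib

section
/- Let B be an n×n complex Hermitian positive semi-definite matrix with unit diagonal, write B = L + I + L* with L its strictly lower triangular part, and let λ₁ be its largest eigenvalue, λ_r its smallest nonzero eigenvalue, and κ̄ = λ₁/λ_r. Let b ∈ Ran(B), let ȳ satisfy Bȳ = b, fix ω ∈ (0,2), and define the SOR iterates y^{(k+1)} = y^{(k)} + ω(I + ωL)^{-1}(b − By^{(k)}) from an arbitrary y^{(0)}. Then for all k ≥ 1: |ȳ − y^{(k)}|_B² ≤ (1 − (2−ω)ω λ₁ / ((1 + ½⌊log₂(2n)⌋ ω λ₁)² κ̄))^k · |ȳ − y^{(0)}|_B². -/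
open Matrix
open scoped ComplexOrder

/-- Spectral (operator ℓ²→ℓ²) norm of a complex square matrix. -/
noncomputable def specNorm {n : ℕ} (M : Matrix (Fin n) (Fin n) ℂ) : ℝ :=
  ‖Matrix.toEuclideanCLM (𝕜 := ℂ) (n := Fin n) M‖

/-- Strictly lower triangular part of a matrix. -/
def lowerTri {n : ℕ} (M : Matrix (Fin n) (Fin n) ℂ) : Matrix (Fin n) (Fin n) ℂ :=
  Matrix.of fun i j => if j < i then M i j else 0

/-- Squared energy seminorm |y|_B² = ⟨By, y⟩. -/
noncomputable def energySq {n : ℕ} (B : Matrix (Fin n) (Fin n) ℂ) (y : Fin n → ℂ) : ℝ :=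
  (star y ⬝ᵥ (B *ᵥ y)).re

/-- Euclidean norm of a vector in ℂⁿ. -/
noncomputable def euclNorm {n : ℕ} (v : Fin n → ℂ) : ℝ :=
  ‖(WithLp.equiv 2 (Fin n → ℂ)).symm v‖

/-- The spectral theorem, for the quadratic forms `x ↦ ⟨x, x⟩, ⟨x, Bx⟩, ⟨Bx, Bx⟩` simultaneously. -/
theorem Matrix.IsHermitian.exists_spectral_weights {n : ℕ} {B : Matrix (Fin n) (Fin n) ℂ}
    (hB : B.IsHermitian) (x : Fin n → ℂ) :
    ∃ c : Fin n → ℝ, (∀ i, 0 ≤ c i) ∧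
      (star x ⬝ᵥ x).re = ∑ i, c i ∧
      (star x ⬝ᵥ (B *ᵥ x)).re = ∑ i, hB.eigenvalues i * c i ∧
      (star (B *ᵥ x) ⬝ᵥ (B *ᵥ x)).re = ∑ i, hB.eigenvalues i ^ 2 * c i := by
  set U : Matrix (Fin n) (Fin n) ℂ := (hB.eigenvectorUnitary : Matrix (Fin n) (Fin n) ℂ) with hU
  set D : Matrix (Fin n) (Fin n) ℂ := diagonal (fun i => (hB.eigenvalues i : ℂ)) with hD
  have hUU : U * Uᴴ = 1 := by
    simpa [hU, star_eq_conjTranspose] using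
      (Unitary.mul_star_self_of_mem hB.eigenvectorUnitary.2)
  have hUU' : Uᴴ * U = 1 := by
    simpa [hU, star_eq_conjTranspose] using
      (Unitary.star_mul_self_of_mem hB.eigenvectorUnitary.2)
  have hBD : B = U * D * Uᴴ := by
    have h := hB.spectral_theorem
    rw [Unitary.conjStarAlgAut_apply] at h
    exact h
  have hinner : ∀ p q : Fin n → ℂ, star (U *ᵥ p) ⬝ᵥ (U *ᵥ q) = star p ⬝ᵥ q := by
    intro p q
    rw [star_mulVec, ← dotProduct_mulVec, mulVec_mulVec, hUU', one_mulVec]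
  set w := Uᴴ *ᵥ x with hw
  have hx : x = U *ᵥ w := by rw [hw, mulVec_mulVec, hUU, one_mulVec]
  have hBx : B *ᵥ x = U *ᵥ (D *ᵥ w) := by
    rw [hw, hBD, mulVec_mulVec, mulVec_mulVec, Matrix.mul_assoc]
  refine ⟨fun i => Complex.normSq (w i), fun i => Complex.normSq_nonneg _, ?_, ?_, ?_⟩
  · rw [hx, hinner]
    simp [dotProduct, Complex.normSq_apply]
  · rw [hBx]
    nth_rewrite 1 [hx]
    rw [hinner]
    simp only [dotProduct, hD, mulVec_diagonal, Complex.re_sum]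
    refine Finset.sum_congr rfl fun i _ => ?_
    simp [Complex.normSq_apply]
    ring
  · rw [hBx, hinner]
    simp only [dotProduct, hD, mulVec_diagonal, Pi.star_apply, Complex.re_sum]
    refine Finset.sum_congr rfl fun i _ => ?_
    simp [Complex.normSq_apply]
    ring

/-- Vectors with disjoint supports are orthogonal. -/
theorem star_dotProduct_eq_zero_of_disjoint {n : ℕ} {u v : Fin n → ℂ}
    (h : ∀ i, u i = 0 ∨ v i = 0) : star u ⬝ᵥ v = 0 := by
  refine Finset.sum_eq_zero fun i _ => ?_
  rcases h i with h | h <;> simp [h]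

theorem re_star_dotProduct_self_nonneg {n : ℕ} (u : Fin n → ℂ) : 0 ≤ (star u ⬝ᵥ u).re :=
  (Complex.le_def.1 (dotProduct_star_self_nonneg u)).1.trans_eq (by rw [dotProduct_comm])

theorem re_star_dotProduct_conjTranspose_mulVec {n : ℕ} (M : Matrix (Fin n) (Fin n) ℂ)
    (u v : Fin n → ℂ) : (star u ⬝ᵥ (Mᴴ *ᵥ v)).re = (star v ⬝ᵥ (M *ᵥ u)).re := by
  have h : star (star v ⬝ᵥ (M *ᵥ u)) = star u ⬝ᵥ (Mᴴ *ᵥ v) := by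
    rw [← star_dotProduct_star, star_star, star_mulVec, ← dotProduct_mulVec]
  rw [← h]
  simp

theorem Matrix.IsHermitian.re_star_dotProduct_mulVec_comm {n : ℕ}
    {B : Matrix (Fin n) (Fin n) ℂ} (hB : B.IsHermitian) (u v : Fin n → ℂ) :
    (star u ⬝ᵥ (B *ᵥ v)).re = (star v ⬝ᵥ (B *ᵥ u)).re := by
  conv_lhs => rw [← hB.eq]
  exact re_star_dotProduct_conjTranspose_mulVec B u v

/-- If `0 ≤ B ≤ lam`, off-diagonal blocks of `B` have norm at most `lam / 2`. -/
theorem re_star_dotProduct_mulVec_le_of_disjoint {n : ℕ} {B : Matrix (Fin n) (Fin n) ℂ}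
    (hB : B.IsHermitian) {lam : ℝ} (hlo : ∀ x : Fin n → ℂ, 0 ≤ (star x ⬝ᵥ (B *ᵥ x)).re)
    (hhi : ∀ x : Fin n → ℂ, (star x ⬝ᵥ (B *ᵥ x)).re ≤ lam * (star x ⬝ᵥ x).re)
    {u v : Fin n → ℂ} (huv : ∀ i, u i = 0 ∨ v i = 0) :
    (star u ⬝ᵥ (B *ᵥ v)).re ≤ lam / 4 * ((star u ⬝ᵥ u).re + (star v ⬝ᵥ v).re) := by
  have h1 := hhi (u + v)
  have h2 := hlo (u - v)
  have h3 := hB.re_star_dotProduct_mulVec_comm u v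
  have h4 := star_dotProduct_eq_zero_of_disjoint huv
  have h5 := star_dotProduct_eq_zero_of_disjoint fun i => (huv i).symm
  simp only [star_add, star_sub, mulVec_add, mulVec_sub, add_dotProduct, dotProduct_add,
    sub_dotProduct, dotProduct_sub, Complex.add_re, Complex.sub_re, h4, h5, Complex.zero_re]
    at h1 h2
  linarith

/-- If `0 ≤ B ≤ lam`, the strictly lower triangular part of `B`, restricted to an interval of
`2 ^ m` indices, has norm at most `m * lam / 2`: halve the interval recursively. -/
theorem re_star_dotProduct_lowerTri_mulVec_le {n : ℕ} {B : Matrix (Fin n) (Fin n) ℂ}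
    (hB : B.IsHermitian) {lam : ℝ} (hlam : 0 ≤ lam)
    (hlo : ∀ x : Fin n → ℂ, 0 ≤ (star x ⬝ᵥ (B *ᵥ x)).re)
    (hhi : ∀ x : Fin n → ℂ, (star x ⬝ᵥ (B *ᵥ x)).re ≤ lam * (star x ⬝ᵥ x).re)
    (m a : ℕ) (x y : Fin n → ℂ)
    (hx : ∀ i : Fin n, ¬(a ≤ i ∧ (i : ℕ) < a + 2 ^ m) → x i = 0)
    (hy : ∀ i : Fin n, ¬(a ≤ i ∧ (i : ℕ) < a + 2 ^ m) → y i = 0) :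
    (star x ⬝ᵥ (lowerTri B *ᵥ y)).re ≤
      m * lam / 4 * ((star x ⬝ᵥ x).re + (star y ⬝ᵥ y).re) := by
  induction m generalizing a x y with
  | zero =>
    have h : star x ⬝ᵥ (lowerTri B *ᵥ y) = 0 := by
      refine Finset.sum_eq_zero fun i _ => ?_
      simp only [mulVec, dotProduct, Finset.mul_sum]
      refine Finset.sum_eq_zero fun j _ => ?_
      by_cases hij : j < i
      · have hij' : (j : ℕ) < i := hij
        by_cases hi : a ≤ i ∧ (i : ℕ) < a + 2 ^ 0
        · rw [hy j (by simp only [pow_zero] at hi ⊢; omega)]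
          simp
        · simp [hx i hi]
      · simp [lowerTri, hij]
    simp [h]
  | succ m ih =>
    have hpow : 2 ^ (m + 1) = 2 ^ m + 2 ^ m := by ring
    set lo : (Fin n → ℂ) → Fin n → ℂ := fun z i => if (i : ℕ) < a + 2 ^ m then z i else 0
      with hlodef
    set hi : (Fin n → ℂ) → Fin n → ℂ := fun z i => if (i : ℕ) < a + 2 ^ m then 0 else z i
      with hhidef
    have split : ∀ z, z = lo z + hi z := by
      intro z; ext i; simp only [hlodef, hhidef, Pi.add_apply]; split_ifs <;> simp
    have disj : ∀ z z' i, hi z i = 0 ∨ lo z' i = 0 := by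
      intro z z' i; simp only [hlodef, hhidef]; split_ifs <;> simp
    have nsq : ∀ z, (star z ⬝ᵥ z).re = (star (lo z) ⬝ᵥ lo z).re + (star (hi z) ⬝ᵥ hi z).re := by
      intro z
      have h1 := star_dotProduct_eq_zero_of_disjoint (disj z z)
      have h2 := star_dotProduct_eq_zero_of_disjoint fun i => (disj z z i).symm
      conv_lhs => rw [split z]
      simp [add_dotProduct, dotProduct_add, h1, h2]
    have slo : ∀ z : Fin n → ℂ, (∀ i : Fin n, ¬(a ≤ i ∧ (i : ℕ) < a + 2 ^ (m + 1)) → z i = 0) →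
        ∀ i : Fin n, ¬(a ≤ i ∧ (i : ℕ) < a + 2 ^ m) → lo z i = 0 := by
      intro z hz i hi
      simp only [hlodef]
      split_ifs with h
      · exact hz i (by omega)
      · rfl
    have shi : ∀ z : Fin n → ℂ, (∀ i : Fin n, ¬(a ≤ i ∧ (i : ℕ) < a + 2 ^ (m + 1)) → z i = 0) →
        ∀ i : Fin n, ¬(a + 2 ^ m ≤ i ∧ (i : ℕ) < a + 2 ^ m + 2 ^ m) → hi z i = 0 := by
      intro z hz i hi
      simp only [hhidef]
      split_ifs with h
      · rfl
      · exact hz i (by omega)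
    have h11 := ih a (lo x) (lo y) (slo x hx) (slo y hy)
    have h22 := ih (a + 2 ^ m) (hi x) (hi y) (shi x hx) (shi y hy)
    have h12 : star (lo x) ⬝ᵥ (lowerTri B *ᵥ hi y) = 0 := by
      refine Finset.sum_eq_zero fun i _ => ?_
      simp only [mulVec, dotProduct, Finset.mul_sum]
      refine Finset.sum_eq_zero fun j _ => ?_
      simp only [hlodef, hhidef, lowerTri, of_apply, Pi.star_apply]
      split_ifs with h1 h2 h3 <;> simp
      omega
    have h21 : star (hi x) ⬝ᵥ (lowerTri B *ᵥ lo y) = star (hi x) ⬝ᵥ (B *ᵥ lo y) := by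
      simp only [mulVec, dotProduct, Finset.mul_sum]
      refine Finset.sum_congr rfl fun i _ => Finset.sum_congr rfl fun j _ => ?_
      simp only [hlodef, hhidef, lowerTri, of_apply, Pi.star_apply]
      split_ifs with h1 h2 h3 <;> simp
      omega
    have hoff := re_star_dotProduct_mulVec_le_of_disjoint hB hlo hhi (disj x y)
    have key : (star x ⬝ᵥ (lowerTri B *ᵥ y)).re =
        (star (lo x) ⬝ᵥ (lowerTri B *ᵥ lo y)).re + (star (hi x) ⬝ᵥ (lowerTri B *ᵥ hi y)).re +
          (star (hi x) ⬝ᵥ (B *ᵥ lo y)).re := by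
      conv_lhs => rw [split x, split y]
      rw [star_add, mulVec_add, add_dotProduct, dotProduct_add, dotProduct_add, h12, h21]
      simp only [Complex.add_re, Complex.zero_re]
      ring
    rw [key, nsq x, nsq y]
    push_cast
    have p1 := mul_nonneg hlam (re_star_dotProduct_self_nonneg (lo x))
    have p2 := mul_nonneg hlam (re_star_dotProduct_self_nonneg (hi y))
    linarith

/-- A symmetric bilinear bound on `M` bounds its operator norm. -/
theorem re_star_mulVec_self_le {n : ℕ} {M : Matrix (Fin n) (Fin n) ℂ} {C : ℝ} (hC : 0 < C)
    (hM : ∀ x y : Fin n → ℂ,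
      (star x ⬝ᵥ (M *ᵥ y)).re ≤ C / 2 * ((star x ⬝ᵥ x).re + (star y ⬝ᵥ y).re))
    (v : Fin n → ℂ) :
    (star (M *ᵥ v) ⬝ᵥ (M *ᵥ v)).re ≤ C ^ 2 * (star v ⬝ᵥ v).re := by
  have h := hM (((C⁻¹ : ℝ) : ℂ) • (M *ᵥ v)) v
  simp only [star_smul, smul_dotProduct, dotProduct_smul, smul_eq_mul, Complex.star_def,
    Complex.conj_ofReal, Complex.re_ofReal_mul] at h
  set N := (star (M *ᵥ v) ⬝ᵥ (M *ᵥ v)).re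
  set V := (star v ⬝ᵥ v).re
  have h' : N ≤ C * (C / 2 * (C⁻¹ * (C⁻¹ * N) + V)) := by
    calc N = C * (C⁻¹ * N) := by field_simp
      _ ≤ _ := mul_le_mul_of_nonneg_left h hC.le
  have e : C * (C / 2 * (C⁻¹ * (C⁻¹ * N) + V)) = N / 2 + C ^ 2 * V / 2 := by field_simp
  linarith

theorem lowerTri_add_one_add_conjTranspose {n : ℕ} {B : Matrix (Fin n) (Fin n) ℂ}
    (hB : B.IsHermitian) (hdiag : ∀ i, B i i = 1) :
    lowerTri B + 1 + (lowerTri B)ᴴ = B := by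
  ext i j
  simp only [lowerTri, Matrix.add_apply, of_apply, conjTranspose_apply, one_apply]
  rcases lt_trichotomy i j with h | h | h
  · simp [h, h.not_gt, h.ne, ← hB.apply i j]
  · simp [h, hdiag]
  · simp [h, h.not_gt, h.ne']

theorem isUnit_det_one_add_smul_lowerTri {n : ℕ} (B : Matrix (Fin n) (Fin n) ℂ) (c : ℂ) :
    IsUnit (1 + c • lowerTri B).det := by
  rw [det_of_isLowerTriangular]
  · simp [lowerTri]
  · intro i j hij
    have hij' : i < j := hij
    simp [lowerTri, hij'.ne, hij'.not_gt]

/-- One SOR step decreases the energy of the error by `ω (2 - ω) ‖v‖²`, where `v` solves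
`(1 + ω L) v = B e`. -/
theorem energySq_sub_smul {n : ℕ} {B : Matrix (Fin n) (Fin n) ℂ}
    (hB : B.IsHermitian) (hdiag : ∀ i, B i i = 1) (ω : ℝ) {e v : Fin n → ℂ}
    (hv : (1 + (ω : ℂ) • lowerTri B) *ᵥ v = B *ᵥ e) :
    energySq B (e - (ω : ℂ) • v) = energySq B e - ω * (2 - ω) * (star v ⬝ᵥ v).re := by
  have hcomm := hB.re_star_dotProduct_mulVec_comm e v
  have h1 : (star v ⬝ᵥ (B *ᵥ e)).re =
      (star v ⬝ᵥ v).re + ω * (star v ⬝ᵥ (lowerTri B *ᵥ v)).re := by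
    rw [← hv, add_mulVec, one_mulVec, smul_mulVec, dotProduct_add, dotProduct_smul]
    simp
  have h2 := re_star_dotProduct_conjTranspose_mulVec (lowerTri B) v v
  have h3 : (star v ⬝ᵥ (B *ᵥ v)).re =
      2 * (star v ⬝ᵥ (lowerTri B *ᵥ v)).re + (star v ⬝ᵥ v).re := by
    conv_lhs => rw [← lowerTri_add_one_add_conjTranspose hB hdiag]
    simp only [add_mulVec, one_mulVec, dotProduct_add, Complex.add_re, h2]
    ring
  simp only [energySq, star_sub, star_smul, mulVec_sub, mulVec_smul, sub_dotProduct,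
    dotProduct_sub, smul_dotProduct, dotProduct_smul, smul_eq_mul, Complex.star_def,
    Complex.conj_ofReal, Complex.sub_re, Complex.re_ofReal_mul]
  rw [hcomm, h3, h1]
  ring

/-- A nonnegative sequence contracting by a factor `q` at each step decays geometrically; `q` is
not assumed nonnegative. -/
theorem le_pow_mul_of_le_mul {E : ℕ → ℝ} {q : ℝ} (hE : ∀ k, 0 ≤ E k)
    (hstep : ∀ k, E (k + 1) ≤ q * E k) (k : ℕ) : E k ≤ q ^ k * E 0 := by
  rcases (hE 0).eq_or_lt with h0 | h0
  · have hz : E k = 0 := by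
      induction k with
      | zero => exact h0.symm
      | succ k ih => exact le_antisymm (by simpa [ih] using hstep k) (hE _)
    simp [hz, ← h0]
  · have hq : 0 ≤ q := nonneg_of_mul_nonneg_left ((hE 1).trans (hstep 0)) h0
    induction k with
    | zero => simp
    | succ k ih =>
      calc E (k + 1) ≤ q * E k := hstep k
        _ ≤ q * (q ^ k * E 0) := mul_le_mul_of_nonneg_left ih hq
        _ = q ^ (k + 1) * E 0 := by ring

/-- Theorem 1 (SOR convergence bound with cyclic ordering). -/
theorem sor_energy_error_bound {n : ℕ} (B : Matrix (Fin n) (Fin n) ℂ)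
    (hB : B.PosSemidef) (hdiag : ∀ i, B i i = 1)
    (lam1 lamr : ℝ)
    (hlam1 : IsGreatest {μ : ℝ | ∃ i, hB.1.eigenvalues i = μ} lam1)
    (hlamr : IsLeast {μ : ℝ | (∃ i, hB.1.eigenvalues i = μ) ∧ μ ≠ 0} lamr)
    (b : Fin n → ℂ) (hb : ∃ z, B *ᵥ z = b)
    (ybar : Fin n → ℂ) (hybar : B *ᵥ ybar = b)
    (ω : ℝ) (hω0 : 0 < ω) (hω2 : ω < 2)
    (y : ℕ → Fin n → ℂ)
    (hy : ∀ k, y (k+1) = y k + (ω : ℂ) • ((1 + (ω : ℂ) • lowerTri B)⁻¹ *ᵥ (b - B *ᵥ y k)))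
    (k : ℕ) (hk : 1 ≤ k) :
    energySq B (ybar - y k) ≤
      (1 - (2 - ω) * ω * lam1 /
          ((1 + (1/2 : ℝ) * (Nat.log 2 (2*n)) * ω * lam1)^2 * (lam1 / lamr)))^k *
        energySq B (ybar - y 0) := by
  have hev : ∀ i, 0 ≤ hB.1.eigenvalues i := hB.eigenvalues_nonneg
  have hlamr_pos : 0 < lamr := by
    obtain ⟨⟨i, hi⟩, hne⟩ := hlamr.1
    exact lt_of_le_of_ne (hi ▸ hev i) (Ne.symm hne)
  have hlam1_pos : 0 < lam1 := by
    obtain ⟨hmem, _⟩ := hlamr.1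
    exact hlamr_pos.trans_le (hlam1.2 hmem)
  have hlo : ∀ x : Fin n → ℂ, 0 ≤ (star x ⬝ᵥ (B *ᵥ x)).re := by
    intro x
    obtain ⟨c, hc, -, h, -⟩ := hB.1.exists_spectral_weights x
    rw [h]
    exact Finset.sum_nonneg fun i _ => mul_nonneg (hev i) (hc i)
  have hhi : ∀ x : Fin n → ℂ, (star x ⬝ᵥ (B *ᵥ x)).re ≤ lam1 * (star x ⬝ᵥ x).re := by
    intro x
    obtain ⟨c, hc, h1, h, -⟩ := hB.1.exists_spectral_weights x
    rw [h, h1, Finset.mul_sum]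
    exact Finset.sum_le_sum fun i _ => mul_le_mul_of_nonneg_right (hlam1.2 ⟨i, rfl⟩) (hc i)
  have hres : ∀ x : Fin n → ℂ,
      lamr * (star x ⬝ᵥ (B *ᵥ x)).re ≤ (star (B *ᵥ x) ⬝ᵥ (B *ᵥ x)).re := by
    intro x
    obtain ⟨c, hc, -, h1, h2⟩ := hB.1.exists_spectral_weights x
    rw [h1, h2, Finset.mul_sum]
    refine Finset.sum_le_sum fun i _ => ?_
    by_cases h0 : hB.1.eigenvalues i = 0
    · simp [h0]
    · have hle : lamr ≤ hB.1.eigenvalues i := hlamr.2 ⟨⟨i, rfl⟩, h0⟩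
      calc lamr * (hB.1.eigenvalues i * c i)
          ≤ hB.1.eigenvalues i * (hB.1.eigenvalues i * c i) :=
            mul_le_mul_of_nonneg_right hle (mul_nonneg (hev i) (hc i))
        _ = _ := by ring
  set m := Nat.log 2 (2 * n) with hm
  have hn : n ≤ 2 ^ m := by
    have h := Nat.lt_pow_succ_log_self (b := 2) (by norm_num) (2 * n)
    rw [← hm, Nat.succ_eq_add_one, pow_succ] at h
    omega
  set C : ℝ := 1 + (1/2 : ℝ) * m * ω * lam1 with hC
  have hCpos : 0 < C := by positivity
  have hM : ∀ v : Fin n → ℂ, (star ((1 + (ω : ℂ) • lowerTri B) *ᵥ v) ⬝ᵥ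
      ((1 + (ω : ℂ) • lowerTri B) *ᵥ v)).re ≤ C ^ 2 * (star v ⬝ᵥ v).re := by
    refine re_star_mulVec_self_le hCpos fun x z => ?_
    have h1 := mul_le_mul_of_nonneg_left
      (re_star_dotProduct_lowerTri_mulVec_le hB.1 hlam1_pos.le hlo hhi m 0 x z
        (fun i hi => absurd i.2 (by omega)) (fun i hi => absurd i.2 (by omega))) hω0.le
    have h2 : (star x ⬝ᵥ z).re ≤ 1 / 2 * ((star x ⬝ᵥ x).re + (star z ⬝ᵥ z).re) := by
      have h := re_star_dotProduct_self_nonneg (x - z)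
      have hs : (star z ⬝ᵥ x).re = (star x ⬝ᵥ z).re := by
        simpa using isHermitian_one.re_star_dotProduct_mulVec_comm z x
      simp only [star_sub, sub_dotProduct, dotProduct_sub, Complex.sub_re, hs] at h
      linarith
    simp only [add_mulVec, one_mulVec, smul_mulVec, dotProduct_add, dotProduct_smul,
      smul_eq_mul, Complex.add_re, Complex.re_ofReal_mul]
    rw [hC]
    linarith
  refine le_pow_mul_of_le_mul (E := fun k => energySq B (ybar - y k)) (fun k => hlo _)
    (fun k => ?_) k
  set e := ybar - y k with he
  set v := (1 + (ω : ℂ) • lowerTri B)⁻¹ *ᵥ (B *ᵥ e) with hv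
  have hstep : ybar - y (k + 1) = e - (ω : ℂ) • v := by
    rw [hy k, hv, he, mulVec_sub B, hybar]
    abel
  have hMv : (1 + (ω : ℂ) • lowerTri B) *ᵥ v = B *ᵥ e := by
    rw [hv, mulVec_mulVec, mul_nonsing_inv _ (isUnit_det_one_add_smul_lowerTri B ω), one_mulVec]
  have h1 := hM v
  rw [hMv] at h1
  have h2 : lamr / C ^ 2 * energySq B e ≤ (star v ⬝ᵥ v).re := by
    rw [div_mul_eq_mul_div, div_le_iff₀ (by positivity), mul_comm _ (C ^ 2)]
    exact (hres e).trans h1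
  have h3 : (2 - ω) * ω * lam1 / (C ^ 2 * (lam1 / lamr)) = ω * (2 - ω) * (lamr / C ^ 2) := by
    field_simp
  show energySq B (ybar - y (k + 1)) ≤ _ * energySq B e
  rw [hstep, energySq_sub_smul hB.1 hdiag ω hMv, h3]
  have h4 := mul_le_mul_of_nonneg_left h2 (mul_nonneg hω0.le (sub_nonneg.2 hω2.le))
  linarith
end

section
/- There exists an absolute constant C₀ > 0 such that for every n and every n×n complex Hermitian positive semi-definite matrix B of rank r ≥ 2, the strictly lower triangular part L of B satisfies ‖L‖ ≤ C₀ (ln r) ‖B‖. -/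
open Matrix
open scoped ComplexOrder

/-- Square root of the sum of the squared moduli of the coordinates of `x` in `S`. -/
noncomputable def normOn {ι : Type*} (S : Finset ι) (x : ι → ℂ) : ℝ :=
  √(∑ i ∈ S, ‖x i‖ ^ 2)

/-- The sesquilinear form of `B` restricted to row indices in `P` and column indices in `R`. -/
noncomputable def formOn {ι : Type*} (B : Matrix ι ι ℂ) (P R : Finset ι) (y x : ι → ℂ) : ℂ :=
  ∑ i ∈ P, ∑ j ∈ R, star (y i) * B i j * x j

/-- The sesquilinear form of the strictly lower triangular part of `B` on indices in `S`. -/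
noncomputable def lowerFormOn {ι : Type*} [LinearOrder ι] (B : Matrix ι ι ℂ) (S : Finset ι)
    (y x : ι → ℂ) : ℂ :=
  ∑ i ∈ S, ∑ j ∈ S, if j < i then star (y i) * B i j * x j else 0

lemma normOn_nonneg {ι : Type*} (S : Finset ι) (x : ι → ℂ) : 0 ≤ normOn S x :=
  Real.sqrt_nonneg _

lemma normOn_mono {ι : Type*} {P S : Finset ι} (h : P ⊆ S) (x : ι → ℂ) :
    normOn P x ≤ normOn S x :=
  Real.sqrt_le_sqrt (Finset.sum_le_sum_of_subset_of_nonneg h fun _ _ _ => by positivity)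

lemma normOn_univ {n : ℕ} (x : Fin n → ℂ) :
    normOn Finset.univ x = ‖WithLp.toLp 2 x‖ := by
  rw [normOn, EuclideanSpace.norm_eq]

lemma normOn_mul_add_normOn_mul_le {ι : Type*} [DecidableEq ι] {P R S : Finset ι} (hP : P ⊆ S)
    (hR : R ⊆ S) (hd : Disjoint P R) (y x : ι → ℂ) :
    normOn P y * normOn P x + normOn R y * normOn R x ≤ normOn S y * normOn S x := by
  have key : ∀ z : ι → ℂ, normOn P z ^ 2 + normOn R z ^ 2 ≤ normOn S z ^ 2 := by
    intro z
    unfold normOn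
    rw [Real.sq_sqrt (by positivity), Real.sq_sqrt (by positivity), Real.sq_sqrt (by positivity),
      ← Finset.sum_union hd]
    exact Finset.sum_le_sum_of_subset_of_nonneg (Finset.union_subset hP hR)
      fun _ _ _ => by positivity
  have hy := key y
  have hx := key x
  have h1 := normOn_nonneg S y
  have h2 := normOn_nonneg S x
  refine abs_le_of_sq_le_sq' ?_ (by positivity) |>.2
  calc (normOn P y * normOn P x + normOn R y * normOn R x) ^ 2
      ≤ (normOn P y ^ 2 + normOn R y ^ 2) * (normOn P x ^ 2 + normOn R x ^ 2) := by
        nlinarith [sq_nonneg (normOn P y * normOn R x - normOn R y * normOn P x)]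
    _ ≤ normOn S y ^ 2 * normOn S x ^ 2 := by gcongr
    _ = (normOn S y * normOn S x) ^ 2 := by ring

/-- A nonempty finite family of nonnegative weights has a weighted median. -/
lemma exists_weighted_median {ι : Type*} [LinearOrder ι] {S : Finset ι} (hS : S.Nonempty)
    (w : ι → ℝ) (hw : ∀ i, 0 ≤ w i) :
    ∃ k ∈ S, ∑ i ∈ S with i < k, w i ≤ (∑ i ∈ S, w i) / 2 ∧
      ∑ i ∈ S with k < i, w i ≤ (∑ i ∈ S, w i) / 2 := by
  have hT : 0 ≤ ∑ i ∈ S, w i := Finset.sum_nonneg fun i _ => hw i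
  let G := S.filter fun k => (∑ i ∈ S, w i) / 2 ≤ ∑ i ∈ S with i ≤ k, w i
  have hG : G.Nonempty := by
    refine ⟨S.max' hS, Finset.mem_filter.2 ⟨S.max'_mem hS, ?_⟩⟩
    rw [Finset.filter_true_of_mem fun i hi => S.le_max' i hi]
    linarith
  obtain ⟨hk, hk'⟩ := Finset.mem_filter.1 (G.min'_mem hG)
  refine ⟨G.min' hG, hk, ?_, ?_⟩
  · by_contra! hlt
    have hne : (S.filter fun i => i < G.min' hG).Nonempty := by
      by_contra he
      rw [Finset.not_nonempty_iff_eq_empty.1 he, Finset.sum_empty] at hlt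
      linarith
    obtain ⟨hmS, hm⟩ := Finset.mem_filter.1 (Finset.max'_mem _ hne)
    refine (G.min'_le _ (Finset.mem_filter.2 ⟨hmS, hlt.le.trans ?_⟩)).not_gt hm
    refine Finset.sum_le_sum_of_subset_of_nonneg (fun i hi => ?_) fun i _ _ => hw i
    exact Finset.mem_filter.2 ⟨(Finset.mem_filter.1 hi).1, Finset.le_max' _ i hi⟩
  · have := Finset.sum_filter_add_sum_filter_not S (fun i => i ≤ G.min' hG) w
    simp only [not_le] at this
    linarith

lemma norm_formOn_le {ι : Type*} [Fintype ι] [DecidableEq ι] {B : Matrix ι ι ℂ} {c : ℝ}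
    (hB : ∀ y x : ι → ℂ, ‖formOn B Finset.univ Finset.univ y x‖ ≤
      c * (normOn Finset.univ y * normOn Finset.univ x))
    (P R : Finset ι) (y x : ι → ℂ) : ‖formOn B P R y x‖ ≤ c * (normOn P y * normOn R x) := by
  have hN : ∀ (P : Finset ι) (z : ι → ℂ),
      normOn Finset.univ (fun i => if i ∈ P then z i else 0) = normOn P z := by
    intro P z
    simp [normOn, apply_ite, ite_pow, Finset.sum_ite_mem]
  have h := hB (fun i => if i ∈ P then y i else 0) (fun i => if i ∈ R then x i else 0)
  rw [hN, hN] at h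
  convert h using 2
  simp [formOn, apply_ite, ite_mul, Finset.sum_ite_mem, Finset.sum_ite_irrel]

open scoped MatrixOrder Matrix.Norms.L2Operator in
lemma Matrix.PosSemidef.norm_apply_le {ι : Type*} [Fintype ι] {B : Matrix ι ι ℂ}
    (hB : B.PosSemidef) (i j : ι) : ‖B i j‖ ≤ √(B i i).re * √(B j j).re := by
  classical
  obtain ⟨A, hA⟩ := CStarAlgebra.nonneg_iff_eq_star_mul_self.1 hB.nonneg
  rw [Matrix.star_eq_conjTranspose] at hA
  subst hA
  have hin : ∀ i j, (Aᴴ * A) i j =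
      inner ℂ (WithLp.toLp 2 (fun k => A k i)) (WithLp.toLp 2 (fun k => A k j)) := by
    intro i j
    simp [Matrix.mul_apply, PiLp.inner_apply, mul_comm]
  have hd : ∀ i, √((Aᴴ * A) i i).re = ‖WithLp.toLp 2 (fun k => A k i)‖ := by
    intro i
    rw [hin]
    exact (norm_eq_sqrt_re_inner (𝕜 := ℂ) _).symm
  rw [hd, hd, hin]
  exact norm_inner_le_norm _ _

lemma sum_norm_mul_sqrt_le {ι : Type*} (S : Finset ι) (w : ι → ℝ) (hw : ∀ i, 0 ≤ w i)
    (x : ι → ℂ) : ∑ i ∈ S, ‖x i‖ * √(w i) ≤ normOn S x * √(∑ i ∈ S, w i) := by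
  have := Real.sum_mul_le_sqrt_mul_sqrt S (fun i => ‖x i‖) fun i => √(w i)
  simpa only [Real.sq_sqrt (hw _), normOn] using this

lemma norm_lowerFormOn_le_of_trace_le {ι : Type*} [Fintype ι] [LinearOrder ι]
    {B : Matrix ι ι ℂ} (hB : B.PosSemidef) (S : Finset ι) (y x : ι → ℂ) :
    ‖lowerFormOn B S y x‖ ≤ (∑ i ∈ S, (B i i).re) * (normOn S y * normOn S x) := by
  have hd : ∀ i, 0 ≤ (B i i).re := fun i => (Complex.le_def.1 hB.diag_nonneg).1
  have hT : 0 ≤ ∑ i ∈ S, (B i i).re := Finset.sum_nonneg fun i _ => hd i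
  calc ‖lowerFormOn B S y x‖
      ≤ ∑ i ∈ S, ∑ j ∈ S, (‖y i‖ * √(B i i).re) * (‖x j‖ * √(B j j).re) := by
        refine (norm_sum_le _ _).trans (Finset.sum_le_sum fun i _ => ?_)
        refine (norm_sum_le _ _).trans (Finset.sum_le_sum fun j _ => ?_)
        split_ifs
        · rw [norm_mul, norm_mul, norm_star]
          calc ‖y i‖ * ‖B i j‖ * ‖x j‖
              ≤ ‖y i‖ * (√(B i i).re * √(B j j).re) * ‖x j‖ := by
                gcongr
                exact hB.norm_apply_le i j
            _ = _ := by ring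
        · rw [norm_zero]
          positivity
    _ = (∑ i ∈ S, ‖y i‖ * √(B i i).re) * ∑ j ∈ S, ‖x j‖ * √(B j j).re := by
        rw [Finset.sum_mul_sum]
    _ ≤ (normOn S y * √(∑ i ∈ S, (B i i).re)) * (normOn S x * √(∑ i ∈ S, (B i i).re)) := by
        have := normOn_nonneg S y
        gcongr
        · exact sum_norm_mul_sqrt_le S _ hd y
        · exact sum_norm_mul_sqrt_le S _ hd x
    _ = (√(∑ i ∈ S, (B i i).re)) ^ 2 * (normOn S y * normOn S x) := by ring
    _ = _ := by rw [Real.sq_sqrt hT]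

lemma lowerFormOn_split {ι : Type*} [LinearOrder ι] (B : Matrix ι ι ℂ) {S : Finset ι} {k : ι}
    (hk : k ∈ S) (y x : ι → ℂ) :
    lowerFormOn B S y x = lowerFormOn B {i ∈ S | i < k} y x + lowerFormOn B {i ∈ S | k < i} y x +
      formOn B {k} {i ∈ S | i < k} y x + formOn B {i ∈ S | k < i} {i ∈ S | i ≤ k} y x := by
  have hs : ({k} : Finset ι) = {i ∈ S | i = k} := by
    ext i
    simp only [Finset.mem_singleton, Finset.mem_filter]
    exact ⟨fun h => ⟨h ▸ hk, h⟩, fun h => h.2⟩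
  rw [hs]
  simp only [lowerFormOn, formOn, Finset.sum_filter]
  rw [← Finset.sum_add_distrib, ← Finset.sum_add_distrib, ← Finset.sum_add_distrib]
  refine Finset.sum_congr rfl fun i _ => ?_
  rcases lt_trichotomy i k with h | rfl | h
  · simp only [h, h.ne, h.not_gt, if_true, if_false, add_zero]
    refine Finset.sum_congr rfl fun j _ => ?_
    by_cases hj : j < i
    · simp [hj, hj.trans h]
    · simp [hj]
  · simp
  · simp only [h, h.ne', h.not_gt, if_true, if_false, add_zero, zero_add]
    rw [← Finset.sum_add_distrib]
    refine Finset.sum_congr rfl fun j _ => ?_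
    by_cases hj : j ≤ k
    · simp [hj, hj.not_gt, hj.trans_lt h]
    · simp [hj, not_le.1 hj]

lemma norm_lowerFormOn_le {ι : Type*} [Fintype ι] [LinearOrder ι] {B : Matrix ι ι ℂ} {c : ℝ}
    (hpsd : B.PosSemidef) (hc : 0 ≤ c)
    (hB : ∀ y x : ι → ℂ, ‖formOn B Finset.univ Finset.univ y x‖ ≤
      c * (normOn Finset.univ y * normOn Finset.univ x)) (y x : ι → ℂ) (m : ℕ) (S : Finset ι)
    (hS : ∑ i ∈ S, (B i i).re ≤ 2 ^ m * c) :
    ‖lowerFormOn B S y x‖ ≤ (2 * m + 1) * c * (normOn S y * normOn S x) := by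
  induction m generalizing S with
  | zero =>
    have h1 := normOn_nonneg S y
    have h2 := normOn_nonneg S x
    refine (norm_lowerFormOn_le_of_trace_le hpsd S y x).trans ?_
    gcongr
    simpa using hS
  | succ m ih =>
    rcases S.eq_empty_or_nonempty with rfl | hne
    · simp [lowerFormOn, normOn]
    obtain ⟨k, hk, hlo, hhi⟩ := exists_weighted_median hne (fun i => (B i i).re)
      fun i => (Complex.le_def.1 hpsd.diag_nonneg).1
    rw [pow_succ] at hS
    have h1 := ih {i ∈ S | i < k} (by linarith)
    have h2 := ih {i ∈ S | k < i} (by linarith)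
    have hoff : ∀ P ⊆ S, ∀ R ⊆ S, ‖formOn B P R y x‖ ≤ c * (normOn S y * normOn S x) := by
      intro P hP R hR
      refine (norm_formOn_le hB P R y x).trans ?_
      have := normOn_nonneg S y
      have := normOn_nonneg R x
      gcongr
      · exact normOn_mono hP y
      · exact normOn_mono hR x
    have h3 := hoff {k} (Finset.singleton_subset_iff.2 hk) {i ∈ S | i < k}
      (Finset.filter_subset _ _)
    have h4 := hoff {i ∈ S | k < i} (Finset.filter_subset _ _) {i ∈ S | i ≤ k}
      (Finset.filter_subset _ _)
    have hd : Disjoint {i ∈ S | i < k} {i ∈ S | k < i} :=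
      Finset.disjoint_filter.2 fun i _ h => h.not_gt
    have h5 := normOn_mul_add_normOn_mul_le (Finset.filter_subset _ S) (Finset.filter_subset _ S)
      hd y x
    have h6 := mul_le_mul_of_nonneg_left h5 (by positivity : 0 ≤ (2 * (m : ℝ) + 1) * c)
    rw [lowerFormOn_split B hk]
    refine norm_add₄_le.trans ?_
    push_cast
    linarith

lemma formOn_univ_eq_inner {n : ℕ} (B : Matrix (Fin n) (Fin n) ℂ) (y x : Fin n → ℂ) :
    formOn B Finset.univ Finset.univ y x =
      inner ℂ (WithLp.toLp 2 y)
        (Matrix.toEuclideanCLM (𝕜 := ℂ) (n := Fin n) B (WithLp.toLp 2 x)) := by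
  simp only [formOn, PiLp.inner_apply, Matrix.toEuclideanCLM_toLp, Matrix.mulVec, dotProduct,
    RCLike.inner_apply, Finset.sum_mul]
  refine Finset.sum_congr rfl fun i _ => Finset.sum_congr rfl fun j _ => ?_
  simp only [starRingEnd_apply]
  ring

lemma norm_formOn_univ_le {n : ℕ} (B : Matrix (Fin n) (Fin n) ℂ) (y x : Fin n → ℂ) :
    ‖formOn B Finset.univ Finset.univ y x‖ ≤
      specNorm B * (normOn Finset.univ y * normOn Finset.univ x) := by
  rw [formOn_univ_eq_inner, normOn_univ, normOn_univ]
  refine (norm_inner_le_norm _ _).trans ?_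
  calc _ ≤ ‖WithLp.toLp 2 y‖ * (specNorm B * ‖WithLp.toLp 2 x‖) := by
        gcongr
        exact ContinuousLinearMap.le_opNorm _ _
    _ = _ := by ring

lemma specNorm_le_of_norm_formOn_le {n : ℕ} {M : Matrix (Fin n) (Fin n) ℂ} {c : ℝ} (hc : 0 ≤ c)
    (h : ∀ y x : Fin n → ℂ, ‖formOn M Finset.univ Finset.univ y x‖ ≤
      c * (normOn Finset.univ y * normOn Finset.univ x)) : specNorm M ≤ c := by
  refine ContinuousLinearMap.opNorm_le_of_re_inner_le (𝕜 := ℂ) hc fun x y hx hy => ?_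
  have h' := h (WithLp.ofLp y) (WithLp.ofLp x)
  rw [formOn_univ_eq_inner, normOn_univ, normOn_univ, WithLp.toLp_ofLp, WithLp.toLp_ofLp, hx, hy,
    norm_inner_symm, mul_one, mul_one] at h'
  exact (RCLike.re_le_norm _).trans h'

lemma Matrix.IsHermitian.eigenvalues_le_specNorm {n : ℕ} {B : Matrix (Fin n) (Fin n) ℂ}
    (hB : B.IsHermitian) (i : Fin n) : hB.eigenvalues i ≤ specNorm B := by
  have h := ContinuousLinearMap.le_opNorm (Matrix.toEuclideanCLM (𝕜 := ℂ) (n := Fin n) B)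
    (hB.eigenvectorBasis i)
  have he : Matrix.toEuclideanCLM (𝕜 := ℂ) (n := Fin n) B (hB.eigenvectorBasis i) =
      (hB.eigenvalues i) • hB.eigenvectorBasis i := by
    apply (WithLp.equiv 2 _).injective
    simpa using hB.mulVec_eigenvectorBasis i
  rw [he, norm_smul, hB.eigenvectorBasis.orthonormal.1 i, mul_one, mul_one] at h
  exact (le_abs_self _).trans h

lemma Matrix.PosSemidef.sum_diag_re_le {n : ℕ} {B : Matrix (Fin n) (Fin n) ℂ}
    (hB : B.PosSemidef) : ∑ i, (B i i).re ≤ B.rank * specNorm B := by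
  have htr : ∑ i, (B i i).re = ∑ i, hB.1.eigenvalues i := by
    have := congrArg Complex.re hB.1.trace_eq_sum_eigenvalues
    simpa [Matrix.trace] using this
  rw [htr, hB.1.rank_eq_card_non_zero_eigs, Fintype.card_subtype, ← nsmul_eq_mul,
    ← Finset.sum_filter_ne_zero]
  exact Finset.sum_le_card_nsmul _ _ _ fun i _ => hB.1.eigenvalues_le_specNorm i

/-- Triangular truncation bound in terms of the rank: ‖L‖ ≤ C₀ (ln r) ‖B‖. -/
theorem lowerTri_specNorm_le_log_rank :
    ∃ C₀ : ℝ, 0 < C₀ ∧ ∀ (n : ℕ) (B : Matrix (Fin n) (Fin n) ℂ),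
      B.PosSemidef → 2 ≤ B.rank →
        specNorm (lowerTri B) ≤ C₀ * Real.log (B.rank) * specNorm B := by
  have hlog2 : 0 < Real.log 2 := Real.log_pos one_lt_two
  refine ⟨5 / Real.log 2, by positivity, fun n B hB hr => ?_⟩
  have hc : 0 ≤ specNorm B := norm_nonneg _
  set m := Nat.log 2 B.rank + 1 with hm
  have hrm : (B.rank : ℝ) ≤ 2 ^ m := by
    exact_mod_cast (Nat.lt_pow_succ_log_self one_lt_two B.rank).le
  have hlm : (Nat.log 2 B.rank : ℝ) * Real.log 2 ≤ Real.log B.rank := by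
    rw [← Real.log_pow]
    exact Real.log_le_log (by positivity)
      (by exact_mod_cast Nat.pow_log_le_self 2 (by omega : B.rank ≠ 0))
  have hl1 : Real.log 2 ≤ Real.log B.rank :=
    Real.log_le_log two_pos (by exact_mod_cast hr)
  have hconst : (2 * (m : ℝ) + 1) ≤ 5 / Real.log 2 * Real.log B.rank := by
    rw [div_mul_eq_mul_div, le_div_iff₀ hlog2, hm]
    push_cast
    linarith
  refine le_trans (specNorm_le_of_norm_formOn_le (c := (2 * (m : ℝ) + 1) * specNorm B)
    (by positivity) fun y x => ?_) (mul_le_mul_of_nonneg_right hconst hc)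
  have h := norm_lowerFormOn_le hB hc (norm_formOn_univ_le B) y x m Finset.univ
    (hB.sum_diag_re_le.trans (mul_le_mul_of_nonneg_right hrm hc))
  convert h using 2
  simp [formOn, lowerFormOn, lowerTri]
end

section
/- Let B be an n×n complex Hermitian matrix. For each permutation σ of {1,…,n} let L_σ be the strictly lower triangular part of B_σ = P_σ B P_σ*. Then the averaged operator E[LL*] := (1/n!) Σ_σ P_σ* L_σ L_σ* P_σ (sum over all n! permutations) satisfies ‖E[LL*]‖ ≤ 4‖B‖². -/
open Matrix
open scoped ComplexOrder

open scoped Matrix.Norms.L2Operator in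
theorem specNorm_eq_l2_opNorm {n : ℕ} (M : Matrix (Fin n) (Fin n) ℂ) : specNorm M = ‖M‖ := rfl

open scoped Matrix.Norms.L2Operator in
theorem norm_diagonal_diag_le {n : ℕ} (M : Matrix (Fin n) (Fin n) ℂ) :
    ‖diagonal M.diag‖ ≤ ‖M‖ := by
  rw [l2_opNorm_diagonal, pi_norm_le_iff_of_nonneg (norm_nonneg _)]
  intro i
  have h := M.l2_opNorm_mulVec (EuclideanSpace.single i (1 : ℂ))
  rw [PiLp.norm_single, norm_one, mul_one] at h
  refine le_trans ?_ ((PiLp.norm_apply_le _ i).trans h)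
  simp

/-- The number of permutations in which `j` precedes both `i` and `k`. -/
theorem sum_precedes_both {n : ℕ} {i j k : Fin n} (hij : i ≠ j) (hkj : k ≠ j) :
    ∑ σ : Equiv.Perm (Fin n),
        (if σ.symm j < σ.symm i ∧ σ.symm j < σ.symm k then (1 : ℂ) else 0) =
      n.factorial * (if i = k then 1 / 2 else 1 / 3) := by
  rw [← Equiv.sum_comp (Equiv.inv (Equiv.Perm (Fin n)))]
  simp only [Equiv.inv_apply, Equiv.Perm.inv_def, Equiv.symm_symm]
  have hcard : ∑ _σ : Equiv.Perm (Fin n), (1 : ℂ) = n.factorial := by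
    simp [Fintype.card_perm]
  have key : ∀ a b c d : Fin n, ∑ σ : Equiv.Perm (Fin n),
        (if σ a < σ b ∧ σ a < σ c then (1 : ℂ) else 0) =
      ∑ σ : Equiv.Perm (Fin n),
        (if σ (Equiv.swap a d a) < σ (Equiv.swap a d b) ∧
          σ (Equiv.swap a d a) < σ (Equiv.swap a d c) then (1 : ℂ) else 0) := by
    intro a b c d
    rw [← Equiv.sum_comp (Equiv.mulRight (Equiv.swap a d))]
    simp
  split_ifs with hik
  · subst hik
    have h1 := key j i i i
    simp only [Equiv.swap_apply_left, Equiv.swap_apply_right, and_self] at h1 ⊢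
    have h2 : ∑ σ : Equiv.Perm (Fin n), (if σ j < σ i then (1 : ℂ) else 0) +
        ∑ σ : Equiv.Perm (Fin n), (if σ i < σ j then (1 : ℂ) else 0) = n.factorial := by
      rw [← hcard, ← Finset.sum_add_distrib]
      refine Finset.sum_congr rfl fun σ _ => ?_
      have := σ.injective.ne hij
      split_ifs <;> first | (exfalso; omega) | simp
    linear_combination (1 / 2 : ℂ) * h2 + (1 / 2 : ℂ) * h1
  · have h1 := key j i k i
    have h2 := key j i k k
    simp only [Equiv.swap_apply_left, Equiv.swap_apply_right, Equiv.swap_apply_of_ne_of_ne hij hik,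
      Equiv.swap_apply_of_ne_of_ne hkj (Ne.symm hik)] at h1 h2
    have h3 : ∑ σ : Equiv.Perm (Fin n), (if σ j < σ i ∧ σ j < σ k then (1 : ℂ) else 0) +
        ∑ σ : Equiv.Perm (Fin n), (if σ i < σ j ∧ σ i < σ k then (1 : ℂ) else 0) +
        ∑ σ : Equiv.Perm (Fin n), (if σ k < σ i ∧ σ k < σ j then (1 : ℂ) else 0)
          = n.factorial := by
      rw [← hcard, ← Finset.sum_add_distrib, ← Finset.sum_add_distrib]
      refine Finset.sum_congr rfl fun σ _ => ?_
      have e1 := σ.injective.ne hij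
      have e2 := σ.injective.ne hkj
      have e3 := σ.injective.ne hik
      split_ifs <;> first | (exfalso; omega) | simp
    linear_combination (1 / 3 : ℂ) * h3 + (1 / 3 : ℂ) * h1 + (1 / 3 : ℂ) * h2

theorem lowerTri_mul_conjTranspose_submatrix_apply {n : ℕ} (B : Matrix (Fin n) (Fin n) ℂ)
    (σ : Equiv.Perm (Fin n)) (i k : Fin n) :
    (lowerTri (B.submatrix σ σ) * (lowerTri (B.submatrix σ σ))ᴴ).submatrix σ.symm σ.symm i k =
      ∑ j, (if σ.symm j < σ.symm i ∧ σ.symm j < σ.symm k then (1 : ℂ) else 0) *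
        (B i j * star (B k j)) := by
  rw [submatrix_apply, mul_apply, ← Equiv.sum_comp σ.symm]
  refine Finset.sum_congr rfl fun j _ => ?_
  by_cases h1 : σ.symm j < σ.symm i <;> by_cases h2 : σ.symm j < σ.symm k <;>
    simp [lowerTri, h1, h2]

/-- The average of `L L*` in terms of the off-diagonal part `C` of `B`. -/
theorem average_LLstar_eq {n : ℕ} (B : Matrix (Fin n) (Fin n) ℂ) :
    ((n.factorial : ℂ))⁻¹ • ∑ σ : Equiv.Perm (Fin n),
        ((lowerTri (B.submatrix σ σ)) * (lowerTri (B.submatrix σ σ))ᴴ).submatrix σ.symm σ.symm =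
      (1 / 3 : ℂ) • ((B - diagonal B.diag) * (B - diagonal B.diag)ᴴ) +
        (1 / 6 : ℂ) • diagonal ((B - diagonal B.diag) * (B - diagonal B.diag)ᴴ).diag := by
  have hn : (n.factorial : ℂ) ≠ 0 := by exact_mod_cast n.factorial_ne_zero
  ext i k
  have hdiag : diagonal ((B - diagonal B.diag) * (B - diagonal B.diag)ᴴ).diag i k =
      if i = k then ((B - diagonal B.diag) * (B - diagonal B.diag)ᴴ) i k else 0 := by
    rw [diagonal_apply]
    split_ifs with h
    · rw [diag_apply, h]
    · rfl
  rw [Matrix.smul_apply, Matrix.add_apply, Matrix.smul_apply, Matrix.smul_apply, hdiag,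
    Matrix.sum_apply]
  simp only [lowerTri_mul_conjTranspose_submatrix_apply]
  rw [Finset.sum_comm]
  have hsum : ∀ j, ∑ σ : Equiv.Perm (Fin n),
      (if σ.symm j < σ.symm i ∧ σ.symm j < σ.symm k then (1 : ℂ) else 0) *
        (B i j * star (B k j)) = n.factorial * (if i = k then 1 / 2 else 1 / 3) *
        ((B - diagonal B.diag) i j * (B - diagonal B.diag)ᴴ j k) := by
    intro j
    rw [← Finset.sum_mul]
    by_cases hij : i = j
    · subst hij
      simp
    by_cases hkj : k = j
    · subst hkj
      simp
    · rw [sum_precedes_both hij hkj]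
      simp [hij, hkj]
  simp only [hsum]
  rw [← Finset.mul_sum, ← mul_apply]
  simp only [smul_eq_mul]
  split_ifs <;> field_simp <;> ring

/-- Theorem 2, first part: ‖E[LL*]‖ ≤ 4‖B‖² for Hermitian B. -/
theorem average_LLstar_le {n : ℕ} (B : Matrix (Fin n) (Fin n) ℂ) (hB : B.IsHermitian) :
    specNorm (((n.factorial : ℂ))⁻¹ •
        ∑ σ : Equiv.Perm (Fin n),
          ((lowerTri (B.submatrix σ σ)) * (lowerTri (B.submatrix σ σ))ᴴ).submatrix
            σ.symm σ.symm)
      ≤ 4 * (specNorm B)^2 := by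
  open scoped Matrix.Norms.L2Operator in
  rw [average_LLstar_eq, specNorm_eq_l2_opNorm, specNorm_eq_l2_opNorm]
  set C := B - diagonal B.diag with hC
  have hCB : ‖C‖ ≤ 2 * ‖B‖ := by
    have := norm_sub_le B (diagonal B.diag)
    have := norm_diagonal_diag_le B
    linarith
  have hCC : ‖C * Cᴴ‖ ≤ ‖C‖ ^ 2 := by
    have := norm_mul_le C Cᴴ
    rwa [l2_opNorm_conjTranspose, ← sq] at this
  have hD := norm_diagonal_diag_le (C * Cᴴ)
  have h := norm_add_le ((1 / 3 : ℂ) • (C * Cᴴ)) ((1 / 6 : ℂ) • diagonal (C * Cᴴ).diag)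
  rw [norm_smul, norm_smul] at h
  have h3 : ‖(1 / 3 : ℂ)‖ = 1 / 3 := by norm_num
  have h6 : ‖(1 / 6 : ℂ)‖ = 1 / 6 := by norm_num
  rw [h3, h6] at h
  have hsq : ‖C‖ ^ 2 ≤ (2 * ‖B‖) ^ 2 := pow_le_pow_left₀ (norm_nonneg C) hCB 2
  nlinarith [sq_nonneg ‖B‖]
end

section
/- Let B be an n×n complex Hermitian positive semi-definite matrix with unit diagonal. For each permutation σ of {1,…,n} let L_σ be the strictly lower triangular part of B_σ = P_σ B P_σ*. Then ‖(1/n!) Σ_σ P_σ* L_σ L_σ* P_σ‖ < ‖B‖², where the sum is over all n! permutations. -/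
open Matrix
open scoped ComplexOrder

open Equiv in
theorem sum_perm_lt_symm {n : ℕ} (i k : Fin n) (h : k ≠ i) :
    ∑ σ : Perm (Fin n), (if σ.symm k < σ.symm i then (1 : ℂ) else 0) = n.factorial / 2 := by
  have hswap : ∑ σ : Perm (Fin n), (if σ.symm k < σ.symm i then (1 : ℂ) else 0)
      = ∑ σ : Perm (Fin n), (if σ.symm i < σ.symm k then (1 : ℂ) else 0) :=
    Fintype.sum_equiv (Equiv.mulLeft (swap i k)) _ _ fun σ => by
      simp [Perm.mul_def]
  have htot : ∑ σ : Perm (Fin n), (if σ.symm k < σ.symm i then (1 : ℂ) else 0)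
      + ∑ σ : Perm (Fin n), (if σ.symm i < σ.symm k then (1 : ℂ) else 0) = n.factorial := by
    rw [← Finset.sum_add_distrib, Finset.sum_congr rfl (g := fun _ => (1 : ℂ))]
    · simp [Fintype.card_perm]
    · intro σ _
      have : σ.symm k ≠ σ.symm i := σ.symm.injective.ne h
      split_ifs <;> first | omega | simp
  rw [← hswap] at htot
  linear_combination htot / 2

open Equiv in
theorem sum_perm_lt_symm_and_lt_symm {n : ℕ} (i j k : Fin n) (hij : i ≠ j) (hki : k ≠ i)
    (hkj : k ≠ j) :
    ∑ σ : Perm (Fin n), (if σ.symm k < σ.symm i ∧ σ.symm k < σ.symm j then (1 : ℂ) else 0)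
      = n.factorial / 3 := by
  have hswap_ki : ∑ σ : Perm (Fin n),
        (if σ.symm k < σ.symm i ∧ σ.symm k < σ.symm j then (1 : ℂ) else 0)
      = ∑ σ : Perm (Fin n),
        (if σ.symm i < σ.symm k ∧ σ.symm i < σ.symm j then (1 : ℂ) else 0) :=
    Fintype.sum_equiv (Equiv.mulLeft (swap i k)) _ _ fun σ => by
      simp [Perm.mul_def, swap_apply_of_ne_of_ne hij.symm hkj.symm]
  have hswap_kj : ∑ σ : Perm (Fin n),
        (if σ.symm k < σ.symm i ∧ σ.symm k < σ.symm j then (1 : ℂ) else 0)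
      = ∑ σ : Perm (Fin n),
        (if σ.symm j < σ.symm i ∧ σ.symm j < σ.symm k then (1 : ℂ) else 0) :=
    Fintype.sum_equiv (Equiv.mulLeft (swap j k)) _ _ fun σ => by
      simp [Perm.mul_def, swap_apply_of_ne_of_ne hij hki.symm]
  have htot : ∑ σ : Perm (Fin n),
        (if σ.symm k < σ.symm i ∧ σ.symm k < σ.symm j then (1 : ℂ) else 0)
      + ∑ σ : Perm (Fin n),
        (if σ.symm i < σ.symm k ∧ σ.symm i < σ.symm j then (1 : ℂ) else 0)
      + ∑ σ : Perm (Fin n),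
        (if σ.symm j < σ.symm i ∧ σ.symm j < σ.symm k then (1 : ℂ) else 0) = n.factorial := by
    rw [← Finset.sum_add_distrib, ← Finset.sum_add_distrib,
      Finset.sum_congr rfl (g := fun _ => (1 : ℂ))]
    · simp [Fintype.card_perm]
    · intro σ _
      have h1 : σ.symm k ≠ σ.symm i := σ.symm.injective.ne hki
      have h2 : σ.symm k ≠ σ.symm j := σ.symm.injective.ne hkj
      have h3 : σ.symm i ≠ σ.symm j := σ.symm.injective.ne hij
      split_ifs <;> first | omega | simp
  rw [← hswap_ki, ← hswap_kj] at htot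
  linear_combination htot / 3

theorem lowerTri_mul_conjTranspose_submatrix_symm_apply {n : ℕ} {B : Matrix (Fin n) (Fin n) ℂ}
    (hB : B.IsHermitian) (σ : Equiv.Perm (Fin n)) (i j : Fin n) :
    ((lowerTri (B.submatrix σ σ) * (lowerTri (B.submatrix σ σ))ᴴ).submatrix σ.symm σ.symm) i j
      = ∑ k, B i k * B k j *
          (if σ.symm k < σ.symm i ∧ σ.symm k < σ.symm j then (1 : ℂ) else 0) := by
  rw [submatrix_apply, mul_apply]
  refine Fintype.sum_equiv σ _ _ fun l => ?_
  simp only [lowerTri, of_apply, conjTranspose_apply, submatrix_apply, Equiv.apply_symm_apply,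
    Equiv.symm_apply_apply]
  by_cases h1 : l < σ.symm i <;> by_cases h2 : l < σ.symm j <;> simp [h1, h2]
  left
  exact hB.apply _ _

/-- Closed form of the average of `L L*` over all orderings. -/
theorem average_lowerTri_mul_conjTranspose {n : ℕ} {B : Matrix (Fin n) (Fin n) ℂ}
    (hB : B.IsHermitian) (hdiag : ∀ i, B i i = 1) :
    ((n.factorial : ℂ))⁻¹ • ∑ σ : Equiv.Perm (Fin n),
        ((lowerTri (B.submatrix σ σ)) * (lowerTri (B.submatrix σ σ))ᴴ).submatrix σ.symm σ.symm
      = (1 / 3 : ℂ) • (B * B) - (2 / 3 : ℂ) • B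
        + (1 / 6 : ℂ) • (diagonal (fun i => (B * B) i i) + 1) := by
  have hn : (n.factorial : ℂ) ≠ 0 := mod_cast n.factorial_ne_zero
  ext i j
  rw [Matrix.smul_apply, Matrix.sum_apply]
  simp_rw [lowerTri_mul_conjTranspose_submatrix_symm_apply hB]
  rw [Finset.sum_comm]
  simp_rw [← Finset.mul_sum]
  by_cases hij : i = j
  · subst hij
    have key : ∀ k, B i k * B k i * ∑ σ : Equiv.Perm (Fin n),
          (if σ.symm k < σ.symm i ∧ σ.symm k < σ.symm i then (1 : ℂ) else 0)
        = n.factorial / 2 * (B i k * B k i - if k = i then 1 else 0) := by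
      intro k
      by_cases hk : k = i
      · subst hk; simp [hdiag]
      · simp only [and_self, sum_perm_lt_symm i k hk, if_neg hk]; ring
    simp_rw [key]
    rw [← Finset.mul_sum, Finset.sum_sub_distrib, ← mul_apply]
    simp [hdiag]
    field_simp
    ring
  · have key : ∀ k, B i k * B k j * ∑ σ : Equiv.Perm (Fin n),
          (if σ.symm k < σ.symm i ∧ σ.symm k < σ.symm j then (1 : ℂ) else 0)
        = n.factorial / 3 * (B i k * B k j - (if k = i then B i j else 0)
          - if k = j then B i j else 0) := by
      intro k
      by_cases hki : k = i
      · subst hki; simp [hdiag, hij]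
      by_cases hkj : k = j
      · subst hkj; simp [hdiag, hki]
      rw [sum_perm_lt_symm_and_lt_symm i j k hij hki hkj, if_neg hki, if_neg hkj]; ring
    simp_rw [key]
    rw [← Finset.mul_sum, Finset.sum_sub_distrib, Finset.sum_sub_distrib, ← mul_apply]
    simp [hij]
    field_simp
    ring

open scoped Matrix.Norms.L2Operator in
theorem norm_apply_le_l2_opNorm {n : ℕ} (A : Matrix (Fin n) (Fin n) ℂ) (i j : Fin n) :
    ‖A i j‖ ≤ ‖A‖ := by
  have h := A.l2_opNorm_mulVec (EuclideanSpace.single j 1)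
  have hcol := PiLp.norm_apply_le (WithLp.toLp 2 (A *ᵥ (EuclideanSpace.single j (1 : ℂ)).ofLp)) i
  simp at h hcol
  exact hcol.trans h

/-- Theorem 2, second part: ‖E[LL*]‖ < ‖B‖² for positive semi-definite B with unit diagonal. -/
theorem average_LLstar_lt {n : ℕ} (hn : 0 < n) (B : Matrix (Fin n) (Fin n) ℂ)
    (hB : B.PosSemidef) (hdiag : ∀ i, B i i = 1) :
    specNorm (((n.factorial : ℂ))⁻¹ •
        ∑ σ : Equiv.Perm (Fin n),
          ((lowerTri (B.submatrix σ σ)) * (lowerTri (B.submatrix σ σ))ᴴ).submatrix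
            σ.symm σ.symm)
      < (specNorm B)^2 := by
  open scoped Matrix.Norms.L2Operator MatrixOrder in
  have hpos : 0 ≤ ((n.factorial : ℂ))⁻¹ • ∑ σ : Equiv.Perm (Fin n),
      ((lowerTri (B.submatrix σ σ)) * (lowerTri (B.submatrix σ σ))ᴴ).submatrix
        σ.symm σ.symm := by
    rw [nonneg_iff_posSemidef]
    refine (posSemidef_sum _ fun σ _ =>
      (posSemidef_self_mul_conjTranspose _).submatrix _).smul ?_
    positivity
  have hle : ((n.factorial : ℂ))⁻¹ • ∑ σ : Equiv.Perm (Fin n),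
      ((lowerTri (B.submatrix σ σ)) * (lowerTri (B.submatrix σ σ))ᴴ).submatrix
        σ.symm σ.symm
      ≤ (1 / 3 : ℂ) • (B * B) + (1 / 6 : ℂ) • (diagonal (fun i => (B * B) i i) + 1) := by
    rw [average_lowerTri_mul_conjTranspose hB.isHermitian hdiag, Matrix.le_iff]
    have h : ((2 / 3 : ℂ) • B).PosSemidef := hB.smul (by positivity)
    rwa [add_sub_add_right_eq_sub, sub_sub_cancel]
  have hnorm := CStarAlgebra.norm_le_norm_of_nonneg_of_le hpos hle
  change ‖_‖ < ‖B‖ ^ 2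
  have hone : 1 ≤ ‖B‖ := by
    simpa [hdiag] using norm_apply_le_l2_opNorm B ⟨0, hn⟩ ⟨0, hn⟩
  have hBB : ‖B * B‖ ≤ ‖B‖ ^ 2 := (norm_mul_le _ _).trans_eq (sq _).symm
  have hD : ‖diagonal (fun i => (B * B) i i)‖ ≤ ‖B‖ ^ 2 := by
    rw [l2_opNorm_diagonal, pi_norm_le_iff_of_nonneg (by positivity)]
    exact fun i => (norm_apply_le_l2_opNorm _ i i).trans hBB
  have hI : ‖(1 : Matrix (Fin n) (Fin n) ℂ)‖ ≤ 1 := by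
    rw [← diagonal_one, l2_opNorm_diagonal, pi_norm_le_iff_of_nonneg zero_le_one]
    simp
  have htri : ‖(1 / 3 : ℂ) • (B * B) + (1 / 6 : ℂ) • (diagonal (fun i => (B * B) i i) + 1)‖
      ≤ 1 / 3 * ‖B * B‖ + 1 / 6 * (‖diagonal (fun i => (B * B) i i)‖ +
        ‖(1 : Matrix (Fin n) (Fin n) ℂ)‖) := by
    refine (norm_add_le _ _).trans ?_
    rw [norm_smul, norm_smul, show ‖(1 / 3 : ℂ)‖ = 1 / 3 by norm_num,
      show ‖(1 / 6 : ℂ)‖ = 1 / 6 by norm_num]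
    gcongr
    exact norm_add_le _ _
  refine hnorm.trans_lt ?_
  nlinarith
end

section
/- There exists an absolute constant C₂ (one may take C₂ = 2907) such that for every n and every n×n complex Hermitian matrix B there exists a permutation σ of {1,…,n} for which the strictly lower triangular part L_σ of B_σ = P_σ B P_σ* satisfies ‖L_σ‖ ≤ C₂‖B‖. -/
open Matrix
open scoped ComplexOrder

open Polynomial in
theorem Polynomial.natDegree_le_and_coeff_of_iterate_derivative_eq_C {K : Type*} [Field K]
    [CharZero K] {s : K[X]} {d : ℕ} {c : K}
    (h : derivative^[d] s = C ((d.factorial : K) * c)) : s.natDegree ≤ d ∧ s.coeff d = c := by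
  have hc : ∀ m, (m + d).descFactorial d • s.coeff (m + d)
      = (C ((d.factorial : K) * c)).coeff m := by
    intro m
    rw [← h, coeff_iterate_derivative]
  constructor
  · rw [natDegree_le_iff_coeff_eq_zero]
    intro N hN
    have h1 := hc (N - d)
    rw [coeff_C_of_ne_zero (by omega), Nat.sub_add_cancel hN.le, smul_eq_zero] at h1
    rcases h1 with h1 | h1
    · rw [Nat.descFactorial_eq_zero_iff_lt] at h1
      omega
    · exact h1
  · have h1 := hc 0
    rw [coeff_C_zero, zero_add, Nat.descFactorial_self, nsmul_eq_mul] at h1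
    exact mul_left_cancel₀ (Nat.cast_ne_zero.mpr d.factorial_ne_zero) h1

theorem Multiset.exists_fin_map_eq {α : Type*} (m : Multiset α) {d : ℕ} (h : m.card = d) :
    ∃ f : Fin d → α, m = Finset.univ.val.map f := by
  subst h
  refine ⟨fun k => m.toList.get (k.cast (by simp)), ?_⟩
  have h2 : (Finset.univ : Finset (Fin m.card)).val.map
      (fun k => m.toList.get (k.cast (by simp))) = (m.toList : Multiset α) := by
    rw [Fin.univ_def]
    simp only [Multiset.map_coe, Multiset.coe_eq_coe]
    have : List.map (fun k : Fin m.card => m.toList.get (k.cast (by simp)))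
        (List.finRange m.card) = m.toList := by
      apply List.ext_get <;> simp
    rw [this]
  rw [h2, Multiset.coe_toList]

open Polynomial in
theorem Polynomial.exists_eq_C_mul_prod_X_sub_C {s : ℂ[X]} {d : ℕ} (hd : s.natDegree ≤ d)
    (ha : s.coeff d ≠ 0) : ∃ μ : Fin d → ℂ, s = C (s.coeff d) * ∏ k, (X - C (μ k)) := by
  have hd' : s.natDegree = d := le_antisymm hd (le_natDegree_of_ne_zero ha)
  have hs := IsAlgClosed.splits s
  obtain ⟨μ, hμ⟩ := s.roots.exists_fin_map_eq (d := d) (by rw [← hd', hs.natDegree_eq_card_roots])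
  refine ⟨μ, ?_⟩
  have h1 := hs.eq_prod_roots
  rw [hμ, Multiset.map_map] at h1
  have h2 : s.leadingCoeff = s.coeff d := by rw [leadingCoeff, hd']
  rw [h2] at h1
  exact h1

section Leibniz

variable {R A : Type*} [CommRing R] [CommRing A] [Algebra R A] (D : Derivation R A A)

theorem Derivation.iterate_succ_mul_of_apply_apply_eq_zero {f : A} (hf : D (D f) = 0) (g : A)
    (m : ℕ) : D^[m + 1] (f * g) = f * D^[m + 1] g + (m + 1 : ℕ) * (D f * D^[m] g) := by
  induction m with
  | zero => simp [mul_comm]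
  | succ m ih =>
    rw [Function.iterate_succ_apply', ih]
    simp only [map_add, Derivation.leibniz, smul_eq_mul, hf, Function.iterate_succ_apply',
      Derivation.map_natCast]
    push_cast
    ring

theorem Derivation.apply_prod_eq_zero {κ : Type*} (s : Finset κ) (f : κ → A)
    (hf : ∀ l ∈ s, D (f l) = 0) : D (∏ l ∈ s, f l) = 0 := by
  classical
  induction s using Finset.induction_on with
  | empty => simp
  | insert a s ha ih =>
    rw [Finset.prod_insert ha, Derivation.leibniz, hf a (Finset.mem_insert_self _ _),
      ih fun l hl => hf l (Finset.mem_insert_of_mem hl), smul_zero, smul_zero, add_zero]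

theorem Derivation.iterate_card_prod {κ : Type*} [DecidableEq κ] (s : Finset κ) (f : κ → A)
    (hf : ∀ l ∈ s, D (D (f l)) = 0) :
    D^[s.card] (∏ l ∈ s, f l) = (s.card.factorial : A) * ∏ l ∈ s, D (f l) := by
  induction s using Finset.induction_on with
  | empty => simp
  | insert a s ha ih =>
    have ih' := ih fun l hl => hf l (Finset.mem_insert_of_mem hl)
    rw [Finset.card_insert_of_notMem ha, Finset.prod_insert ha, Finset.prod_insert ha,
      D.iterate_succ_mul_of_apply_apply_eq_zero (hf a (Finset.mem_insert_self _ _)),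
      Function.iterate_succ_apply', ih', Nat.factorial_succ]
    have h0 : D (∏ l ∈ s, D (f l)) = 0 := by
      exact D.apply_prod_eq_zero s _ fun l hl => hf l (Finset.mem_insert_of_mem hl)
    simp only [Derivation.leibniz, h0, Derivation.map_natCast, smul_zero]
    push_cast
    ring

theorem Derivation.iterate_pred_card_prod {κ : Type*} [DecidableEq κ] (s : Finset κ) (f : κ → A)
    (hf : ∀ l ∈ s, D (D (f l)) = 0) {m : ℕ} (hm : s.card = m + 1) :
    D^[m] (∏ l ∈ s, f l) = (m.factorial : A) * ∑ j ∈ s, f j * ∏ l ∈ s.erase j, D (f l) := by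
  induction s using Finset.induction_on generalizing m with
  | empty => simp at hm
  | insert a s ha ih =>
    have hf' : ∀ l ∈ s, D (D (f l)) = 0 := fun l hl => hf l (Finset.mem_insert_of_mem hl)
    rw [Finset.card_insert_of_notMem ha] at hm
    have hm' : s.card = m := by omega
    rw [Finset.prod_insert ha, Finset.sum_insert ha, Finset.erase_insert ha]
    have hrest : ∑ j ∈ s, f j * ∏ l ∈ (insert a s).erase j, D (f l)
        = D (f a) * ∑ j ∈ s, f j * ∏ l ∈ s.erase j, D (f l) := by
      rw [Finset.mul_sum]
      refine Finset.sum_congr rfl fun j hj => ?_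
      have hja : a ≠ j := fun h => ha (h ▸ hj)
      rw [Finset.erase_insert_of_ne hja, Finset.prod_insert (by simp [ha])]
      ring
    rw [hrest]
    cases m with
    | zero =>
      have : s = ∅ := Finset.card_eq_zero.mp hm'
      subst this
      simp
    | succ m =>
      rw [D.iterate_succ_mul_of_apply_apply_eq_zero (hf a (Finset.mem_insert_self _ _)), ih hf' hm',
        ← hm', D.iterate_card_prod s f hf', hm', Nat.factorial_succ]
      push_cast
      ring

theorem Derivation.iterate_mul_of_apply_eq_zero {c : A} (hc : D c = 0) (g : A) (m : ℕ) :
    D^[m] (c * g) = c * D^[m] g := by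
  induction m with
  | zero => rfl
  | succ m ih =>
    rw [Function.iterate_succ_apply', ih, Function.iterate_succ_apply']
    simp [hc]

end Leibniz

open Polynomial in
theorem Polynomial.eval_iterate_derivative_C_mul_prod {K : Type*} [Field K] {m : ℕ} (a x : K)
    (μ : Fin (m + 1) → K) :
    (derivative^[m] (C a * ∏ k, (X - C (μ k)))).eval x
      = (m.factorial : K) * a * ∑ k, (x - μ k) := by
  have h := (Polynomial.derivative' (R := K)).iterate_pred_card_prod Finset.univ
    (fun k => X - C (μ k)) (by simp [Polynomial.derivative']) (m := m) (by simp)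
  have h1 := (Polynomial.derivative' (R := K)).iterate_mul_of_apply_eq_zero (c := C a)
    (by simp [Polynomial.derivative']) (∏ k, (X - C (μ k))) m
  rw [h] at h1
  have h2 : ((Polynomial.derivative' (R := K) : K[X] → K[X])^[m]) = derivative^[m] := rfl
  rw [h2] at h1
  rw [h1]
  simp [Polynomial.derivative', eval_finsetSum]
  ring

open Polynomial in
theorem Polynomial.eval_derivative_C_mul_prod {K κ : Type*} [Field K] [DecidableEq κ]
    (s : Finset κ) (a x : K) (μ : κ → K) (hx : ∀ k ∈ s, x ≠ μ k) :
    (derivative (C a * ∏ k ∈ s, (X - C (μ k)))).eval x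
      = (C a * ∏ k ∈ s, (X - C (μ k))).eval x * ∑ k ∈ s, (x - μ k)⁻¹ := by
  rw [derivative_C_mul, derivative_prod_finset]
  simp only [eval_mul, eval_C, eval_finsetSum, eval_prod, derivative_sub, derivative_X,
    derivative_C, sub_zero, mul_one, eval_sub, eval_X, mul_assoc, Finset.mul_sum]
  refine Finset.sum_congr rfl fun k hk => ?_
  rw [← Finset.mul_prod_erase s _ hk]
  have := sub_ne_zero.mpr (hx k hk)
  field_simp

section

variable {ι : Type*}

theorem aeval_ofReal (w : ι → ℝ) (P : MvPolynomial ι ℝ) :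
    MvPolynomial.aeval (fun k => (w k : ℂ)) P = ((MvPolynomial.aeval w P : ℝ) : ℂ) := by
  exact MvPolynomial.aeval_algebraMap_apply ℂ w P

theorem MvPolynomial.pderiv_pderiv_comm (i j : ι) (P : MvPolynomial ι ℝ) :
    pderiv i (pderiv j P) = pderiv j (pderiv i P) := by
  classical
  let D (k : ι) : Derivation ℝ (MvPolynomial ι ℝ) (MvPolynomial ι ℝ) := pderiv k
  have h : ⁅D i, D j⁆ = 0 := by
    apply MvPolynomial.derivation_ext
    intro k
    rw [Derivation.commutator_apply]
    simp [D, MvPolynomial.pderiv_X, Pi.single_apply, apply_ite]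
  have h1 := congrArg
    (fun D : Derivation ℝ (MvPolynomial ι ℝ) (MvPolynomial ι ℝ) => D P) h
  simp only [Derivation.commutator_apply, Derivation.zero_apply] at h1
  exact sub_eq_zero.mp h1

theorem MvPolynomial.iterate_pderiv_comm (i j : ι) (P : MvPolynomial ι ℝ) (m n : ℕ) :
    (pderiv i)^[m] ((pderiv j)^[n] P) = (pderiv j)^[n] ((pderiv i)^[m] P) := by
  have h : Function.Commute (pderiv i : MvPolynomial ι ℝ → MvPolynomial ι ℝ) (pderiv j) :=
    fun P => MvPolynomial.pderiv_pderiv_comm i j P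
  exact (h.iterate_iterate m n) P

theorem iterate_pderiv_natCast_mul (i : ι) (P : MvPolynomial ι ℝ) (c m : ℕ) :
    (MvPolynomial.pderiv i)^[m] ((c : MvPolynomial ι ℝ) * P)
      = (c : MvPolynomial ι ℝ) * (MvPolynomial.pderiv i)^[m] P :=
  (MvPolynomial.pderiv i).iterate_mul_of_apply_eq_zero (by simp) P m

end

section Slice

variable {ι : Type*} [DecidableEq ι]

/-- The univariate polynomial obtained from `P` by fixing all variables but the `i`-th one at the
values prescribed by `w`. -/
noncomputable def slice {K : Type*} [Field K] [Algebra ℝ K] (w : ι → K) (i : ι) :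
    MvPolynomial ι ℝ →ₐ[ℝ] Polynomial K :=
  MvPolynomial.aeval (Function.update (fun k => Polynomial.C (w k)) i Polynomial.X)

variable {K : Type*} [Field K] [Algebra ℝ K] (w : ι → K) (i : ι)

theorem eval_slice (P : MvPolynomial ι ℝ) (x : K) :
    (slice w i P).eval x = MvPolynomial.aeval (Function.update w i x) P := by
  have h : ((Polynomial.aeval x).restrictScalars ℝ).comp (slice w i)
      = (MvPolynomial.aeval (Function.update w i x) : MvPolynomial ι ℝ →ₐ[ℝ] K) := by
    apply MvPolynomial.algHom_ext
    intro k
    by_cases hk : k = i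
    · subst hk
      simp [slice]
    · simp [slice, hk]
  exact congrArg (fun φ : MvPolynomial ι ℝ →ₐ[ℝ] K => φ P) h

theorem eval_slice_self (P : MvPolynomial ι ℝ) :
    (slice w i P).eval (w i) = MvPolynomial.aeval w P := by
  rw [eval_slice, Function.update_eq_self]

theorem slice_update (P : MvPolynomial ι ℝ) (x : K) :
    slice (Function.update w i x) i P = slice w i P := by
  unfold slice
  congr 2
  funext k
  by_cases hk : k = i
  · subst hk
    simp
  · simp [hk]

theorem derivative_slice (P : MvPolynomial ι ℝ) :
    Polynomial.derivative (slice w i P) = slice w i (MvPolynomial.pderiv i P) := by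
  induction P using MvPolynomial.induction_on with
  | C a => simp [slice]
  | add p q hp hq => simp [hp, hq]
  | mul_X p k hp =>
    rw [map_mul, Polynomial.derivative_mul, hp, MvPolynomial.pderiv_mul, map_add, map_mul, map_mul]
    by_cases hk : k = i
    · subst hk
      simp [slice]
    · rw [MvPolynomial.pderiv_X_of_ne hk]
      simp [slice, hk]

theorem iterate_derivative_slice (P : MvPolynomial ι ℝ) (m : ℕ) :
    Polynomial.derivative^[m] (slice w i P) = slice w i ((MvPolynomial.pderiv i)^[m] P) := by
  induction m with
  | zero => rfl
  | succ m ih => rw [Function.iterate_succ_apply', ih, derivative_slice,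
      Function.iterate_succ_apply']

theorem map_slice (w : ι → ℝ) (P : MvPolynomial ι ℝ) :
    (slice w i P).map (algebraMap ℝ ℂ) = slice (fun k => (w k : ℂ)) i P := by
  have h : (Polynomial.mapAlgHom (Algebra.ofId ℝ ℂ)).comp (slice w i)
      = slice (fun k => (w k : ℂ)) i := by
    apply MvPolynomial.algHom_ext
    intro k
    by_cases hk : k = i
    · subst hk
      simp [slice]
    · simp [slice, hk]
  exact congrArg (fun φ : MvPolynomial ι ℝ →ₐ[ℝ] Polynomial ℂ => φ P) h

variable {i} in
theorem slice_eq_C [CharZero K] {P : MvPolynomial ι ℝ} (hP : MvPolynomial.pderiv i P = 0) :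
    slice w i P = Polynomial.C (MvPolynomial.aeval w P) := by
  have h : Polynomial.derivative (slice w i P) = 0 := by rw [derivative_slice, hP, map_zero]
  rw [← eval_slice_self w i P, Polynomial.eq_C_of_derivative_eq_zero h]
  simp

variable {i} in
theorem aeval_update_of_pderiv_eq_zero [CharZero K] {P : MvPolynomial ι ℝ}
    (hP : MvPolynomial.pderiv i P = 0) (x : K) :
    MvPolynomial.aeval (Function.update w i x) P = MvPolynomial.aeval w P := by
  rw [← eval_slice, slice_eq_C w hP, Polynomial.eval_C]

end Slice

/-- A family of real stable polynomials of degree `d i` in the `i`-th variable, indexed by the set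
of variables sent to infinity. -/
structure StableFamily {ι : Type*} [DecidableEq ι] (d : ι → ℕ)
    (Q : Finset ι → MvPolynomial ι ℝ) : Prop where
  ne_zero : ∀ U (z : ι → ℂ), (∀ k, 0 < (z k).im) → MvPolynomial.aeval z (Q U) ≠ 0
  top : ∀ U i, i ∉ U → (MvPolynomial.pderiv i)^[d i] (Q U)
    = ((d i).factorial : MvPolynomial ι ℝ) * Q (insert i U)
  const : ∀ U i, i ∈ U → MvPolynomial.pderiv i (Q U) = 0

namespace StableFamily

variable {ι : Type*} [DecidableEq ι] {d : ι → ℕ} {Q : Finset ι → MvPolynomial ι ℝ}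

theorem slice_natDegree_coeff {K : Type*} [Field K] [Algebra ℝ K] [CharZero K]
    (hQ : StableFamily d Q) {U : Finset ι} {i : ι} (hi : i ∉ U) (w : ι → K) :
    (slice w i (Q U)).natDegree ≤ d i ∧
      (slice w i (Q U)).coeff (d i) = MvPolynomial.aeval w (Q (insert i U)) := by
  apply Polynomial.natDegree_le_and_coeff_of_iterate_derivative_eq_C
  rw [iterate_derivative_slice, hQ.top U i hi, map_mul, map_natCast,
    slice_eq_C w (hQ.const _ _ (Finset.mem_insert_self i U))]
  simp

theorem aeval_insert_update {K : Type*} [Field K] [Algebra ℝ K] [CharZero K]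
    (hQ : StableFamily d Q) (U : Finset ι) (i : ι) (w : ι → K) (x : K) :
    MvPolynomial.aeval (Function.update w i x) (Q (insert i U))
      = MvPolynomial.aeval w (Q (insert i U)) :=
  aeval_update_of_pderiv_eq_zero w (hQ.const _ _ (Finset.mem_insert_self i U)) x

theorem exists_slice_eq (hQ : StableFamily d Q) {U : Finset ι} {i : ι} (hi : i ∉ U) (w : ι → ℂ)
    (hw : MvPolynomial.aeval w (Q (insert i U)) ≠ 0)
    (h : ∀ x : ℂ, 0 < x.im → MvPolynomial.aeval (Function.update w i x) (Q U) ≠ 0) :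
    ∃ μ : Fin (d i) → ℂ, (∀ k, (μ k).im ≤ 0) ∧
      slice w i (Q U) = Polynomial.C (MvPolynomial.aeval w (Q (insert i U)))
        * ∏ k, (Polynomial.X - Polynomial.C (μ k)) := by
  obtain ⟨h1, h2⟩ := hQ.slice_natDegree_coeff hi w
  obtain ⟨μ, hμ⟩ := Polynomial.exists_eq_C_mul_prod_X_sub_C h1 (by rwa [h2])
  rw [h2] at hμ
  refine ⟨μ, fun k => ?_, hμ⟩
  by_contra! hk
  apply h _ hk
  rw [← eval_slice, hμ, Polynomial.eval_mul, Polynomial.eval_prod,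
    Finset.prod_eq_zero (Finset.mem_univ k) (by simp), mul_zero]

theorem norm_insert_mul_le_of_pos (hQ : StableFamily d Q) {U : Finset ι} {i : ι} (hi : i ∉ U)
    (z : ι → ℂ) (hz : ∀ k, 0 < (z k).im) :
    ‖MvPolynomial.aeval z (Q (insert i U))‖ * (z i).im ^ d i ≤ ‖MvPolynomial.aeval z (Q U)‖ := by
  obtain ⟨μ, hμ, h⟩ := hQ.exists_slice_eq hi z (hQ.ne_zero _ z hz) fun x hx => by
    apply hQ.ne_zero
    intro k
    by_cases hk : k = i
    · subst hk
      simpa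
    · simpa [hk] using hz k
  rw [← eval_slice_self z i (Q U), h, Polynomial.eval_mul, Polynomial.eval_C, norm_mul,
    Polynomial.eval_prod, norm_prod]
  refine mul_le_mul_of_nonneg_left ?_ (norm_nonneg _)
  have h3 : (z i).im ^ d i = ∏ _k : Fin (d i), (z i).im := by simp
  rw [h3]
  refine Finset.prod_le_prod (fun k _ => (hz i).le) fun k _ => ?_
  have h4 := Complex.im_le_norm (z i - μ k)
  have h5 := hμ k
  simp only [Polynomial.eval_sub, Polynomial.eval_X, Polynomial.eval_C]
  rw [Complex.sub_im] at h4
  linarith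

theorem norm_insert_mul_le (hQ : StableFamily d Q) {U : Finset ι} {i : ι} (hi : i ∉ U)
    (z : ι → ℂ) (hz : ∀ k, 0 ≤ (z k).im) :
    ‖MvPolynomial.aeval z (Q (insert i U))‖ * (z i).im ^ d i ≤ ‖MvPolynomial.aeval z (Q U)‖ := by
  have hc : ∀ P : MvPolynomial ι ℝ, Continuous fun ε : ℝ =>
      MvPolynomial.aeval (fun k => z k + ε * Complex.I) P := by
    intro P
    induction P using MvPolynomial.induction_on with
    | C a => simpa using continuous_const
    | add p q hp hq =>
      simp only [map_add]
      exact hp.add hq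
    | mul_X p k hp =>
      simp only [map_mul, MvPolynomial.aeval_X]
      exact hp.mul (by fun_prop)
  have hl : Continuous fun ε : ℝ =>
      ‖MvPolynomial.aeval (fun k => z k + ε * Complex.I) (Q (insert i U))‖
        * (z i + ε * Complex.I).im ^ d i := by
    refine (hc _).norm.mul ?_
    fun_prop
  have hr : Continuous fun ε : ℝ => ‖MvPolynomial.aeval (fun k => z k + ε * Complex.I) (Q U)‖ :=
    (hc _).norm
  have key := le_of_tendsto_of_tendsto (b := nhdsWithin (0 : ℝ) (Set.Ioi 0))
    (hl.continuousWithinAt (s := Set.Ioi 0) (x := 0)).tendsto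
    (hr.continuousWithinAt (s := Set.Ioi 0) (x := 0)).tendsto (by
      filter_upwards [self_mem_nhdsWithin] with ε hε
      have hε' : (0 : ℝ) < ε := hε
      refine hQ.norm_insert_mul_le_of_pos hi (fun k => z k + ε * Complex.I) fun k => ?_
      have := hz k
      simp
      linarith)
  simpa using key

theorem ne_zero_of_im_pos (hQ : StableFamily d Q) {U : Finset ι} {i : ι} (hi : i ∉ U)
    (z : ι → ℂ) (hz : ∀ k, 0 ≤ (z k).im) (hzi : 0 < (z i).im)
    (h : MvPolynomial.aeval z (Q (insert i U)) ≠ 0) : MvPolynomial.aeval z (Q U) ≠ 0 := by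
  intro h0
  have := hQ.norm_insert_mul_le hi z hz
  rw [h0, norm_zero] at this
  have h2 : 0 < ‖MvPolynomial.aeval z (Q (insert i U))‖ * (z i).im ^ d i := by positivity
  linarith

theorem im_update_nonneg {z : ι → ℂ} (hz : ∀ k, 0 ≤ (z k).im) (i : ι) {x : ℂ} (hx : 0 ≤ x.im) :
    ∀ k, 0 ≤ (Function.update z i x k).im := by
  intro k
  by_cases hk : k = i
  · subst hk
    simpa
  · simpa [hk] using hz k

theorem exists_real_slice_eq (hQ : StableFamily d Q) {U : Finset ι} {i : ι} (hi : i ∉ U)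
    (w : ι → ℝ) (hw : MvPolynomial.aeval w (Q (insert i U)) ≠ 0) :
    ∃ μ : Fin (d i) → ℝ, slice w i (Q U) = Polynomial.C (MvPolynomial.aeval w (Q (insert i U)))
        * ∏ k, (Polynomial.X - Polynomial.C (μ k)) := by
  have hw' : MvPolynomial.aeval (fun k => (w k : ℂ)) (Q (insert i U)) ≠ 0 := by
    rw [aeval_ofReal]
    exact_mod_cast hw
  have hne : ∀ x : ℂ, 0 < x.im →
      MvPolynomial.aeval (Function.update (fun k => (w k : ℂ)) i x) (Q U) ≠ 0 := by
    intro x hx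
    apply hQ.ne_zero_of_im_pos hi
    · exact im_update_nonneg (by simp) i hx.le
    · simpa
    · rwa [hQ.aeval_insert_update]
  obtain ⟨μ, hμ, h⟩ := hQ.exists_slice_eq hi _ hw' hne
  have hreal : ∀ k, (μ k).im = 0 := by
    intro k
    refine le_antisymm (hμ k) ?_
    by_contra! hk
    refine hne (starRingEnd ℂ (μ k)) (by simpa using hk) ?_
    have h0 : (slice (fun k => (w k : ℂ)) i (Q U)).eval (μ k) = 0 := by
      rw [h, Polynomial.eval_mul, Polynomial.eval_prod,
        Finset.prod_eq_zero (Finset.mem_univ k) (by simp), mul_zero]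
    rw [← eval_slice, ← map_slice, Polynomial.eval_map, ← Polynomial.aeval_def,
      Polynomial.aeval_conj, Polynomial.aeval_def, ← Polynomial.eval_map, map_slice, h0, map_zero]
  refine ⟨fun k => (μ k).re, ?_⟩
  apply Polynomial.map_injective (algebraMap ℝ ℂ) (algebraMap ℝ ℂ).injective
  rw [map_slice, h, Polynomial.map_mul, Polynomial.map_prod, aeval_ofReal]
  simp only [Polynomial.map_C, Polynomial.map_sub, Polynomial.map_X, Complex.coe_algebraMap]
  congr 1
  refine Finset.prod_congr rfl fun k _ => ?_
  rw [← Complex.ext (by simp) (by simp [hreal k]) (z := μ k) (w := ((μ k).re : ℂ))]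

end StableFamily

section PartialFractions

open Polynomial

variable {κ : Type*}

theorem mul_sin_nonneg_of_im_div_prod_nonpos {T : Finset κ} {μ : κ → ℝ} {s : ℝ[X]}
    (him : ∀ x : ℂ, 0 < x.im → (aeval x s / ∏ k ∈ T, (x - μ k)).im ≤ 0) (k : κ)
    {θ : ℝ} (h0 : 0 < θ) (hπ : θ < Real.pi) :
    0 ≤ s.eval (μ k) / (∏ l ∈ T with ¬ μ l = μ k, (μ k - μ l))
      * Real.sin ((T.filter fun l => μ l = μ k).card * θ) := by
  set m := (T.filter fun l => μ l = μ k).card with hm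
  let u : ℂ := Complex.exp (θ * Complex.I)
  have hu : u ≠ 0 := Complex.exp_ne_zero _
  have huim : 0 < u.im := by
    rw [Complex.exp_ofReal_mul_I_im]
    exact Real.sin_pos_of_pos_of_lt_pi h0 hπ
  let x : ℝ → ℂ := fun ε => μ k + ε * u
  have hx : Continuous x := by fun_prop
  let F : ℝ → ℂ := fun ε =>
    aeval (x ε) s / (u ^ m * ∏ l ∈ T with ¬ μ l = μ k, (x ε - μ l))
  have hden : u ^ m * ∏ l ∈ T with ¬ μ l = μ k, (x 0 - μ l) ≠ 0 := by
    refine mul_ne_zero (pow_ne_zero _ hu) (Finset.prod_ne_zero_iff.mpr fun l hl => ?_)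
    have := (Finset.mem_filter.mp hl).2
    simp only [x, Complex.ofReal_zero, zero_mul, add_zero]
    rw [sub_ne_zero]
    exact fun h => this (by exact_mod_cast h.symm)
  have hF : ContinuousAt F 0 := by
    refine ContinuousAt.div ?_ ?_ hden
    · exact ((Polynomial.continuous_aeval s).comp hx).continuousAt
    · refine Continuous.continuousAt ?_
      refine continuous_const.mul (continuous_finsetProd _ fun l _ => ?_)
      exact hx.sub continuous_const
  have hle : ∀ ε : ℝ, 0 < ε → (F ε).im ≤ 0 := by
    intro ε hε
    have hεc : (ε : ℂ) ≠ 0 := by exact_mod_cast hε.ne'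
    have hxim : 0 < (x ε).im := by
      simp only [x, Complex.add_im, Complex.ofReal_im, Complex.im_ofReal_mul, zero_add]
      positivity
    have h1 : F ε = ((ε ^ m : ℝ) : ℂ) * (aeval (x ε) s / ∏ l ∈ T, (x ε - μ l)) := by
      rw [← Finset.prod_filter_mul_prod_filter_not T (fun l => μ l = μ k)]
      have h2 : ∏ l ∈ T with μ l = μ k, (x ε - μ l) = (ε * u) ^ m := by
        rw [hm, ← Finset.prod_const]
        refine Finset.prod_congr rfl fun l hl => ?_
        rw [(Finset.mem_filter.mp hl).2]
        simp [x]
      rw [h2, mul_pow]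
      simp only [F]
      push_cast
      rw [mul_assoc, ← mul_div_assoc, mul_div_mul_left _ _ (pow_ne_zero m hεc)]
    rw [h1, Complex.im_ofReal_mul]
    exact mul_nonpos_of_nonneg_of_nonpos (by positivity) (him _ hxim)
  have hlim : (F 0).im ≤ 0 := by
    have ht : Filter.Tendsto (fun ε => (F ε).im) (nhdsWithin 0 (Set.Ioi 0)) (nhds (F 0).im) :=
      (Complex.continuous_im.continuousAt.comp hF).tendsto.mono_left nhdsWithin_le_nhds
    refine le_of_tendsto ht ?_
    filter_upwards [self_mem_nhdsWithin] with ε hε using hle ε hε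
  have hval : F 0 = ((s.eval (μ k) / (∏ l ∈ T with ¬ μ l = μ k, (μ k - μ l)) : ℝ) : ℂ)
      * Complex.exp (((-(m * θ) : ℝ) : ℂ) * Complex.I) := by
    have h1 : (u ^ m)⁻¹ = Complex.exp (((-(m * θ) : ℝ) : ℂ) * Complex.I) := by
      rw [← Complex.exp_nat_mul, ← Complex.exp_neg]
      congr 1
      push_cast
      ring
    rw [← h1]
    simp only [F, x, Complex.ofReal_zero, zero_mul, add_zero]
    have h2 : aeval ((μ k : ℝ) : ℂ) s = ((s.eval (μ k) : ℝ) : ℂ) := by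
      have := Polynomial.aeval_algebraMap_apply ℂ (μ k) s
      simpa using this
    rw [h2]
    push_cast
    rw [div_mul_eq_div_div, div_right_comm, div_eq_mul_inv _ (u ^ m)]
  rw [hval, Complex.im_ofReal_mul, Complex.exp_ofReal_mul_I_im, Real.sin_neg] at hlim
  linarith

theorem card_filter_eq_one_and_div_nonneg {T : Finset κ} {μ : κ → ℝ} {s : ℝ[X]}
    (him : ∀ x : ℂ, 0 < x.im → (aeval x s / ∏ k ∈ T, (x - μ k)).im ≤ 0) {k : κ} (hk : k ∈ T)
    (hs : s.eval (μ k) ≠ 0) :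
    (T.filter fun l => μ l = μ k).card = 1 ∧
      0 ≤ s.eval (μ k) / (∏ l ∈ T with ¬ μ l = μ k, (μ k - μ l)) := by
  have hπ := Real.pi_pos
  have key := fun θ h0 hπ => mul_sin_nonneg_of_im_div_prod_nonpos (θ := θ) him k h0 hπ
  set m := (T.filter fun l => μ l = μ k).card with hm
  set R := s.eval (μ k) / (∏ l ∈ T with ¬ μ l = μ k, (μ k - μ l)) with hR
  have hm1 : 1 ≤ m := Finset.card_pos.mpr ⟨k, by simp [hk]⟩
  have hm1' : (1 : ℝ) ≤ m := by exact_mod_cast hm1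
  have hm0 : (m : ℝ) ≠ 0 := by positivity
  have hR0 : 0 ≤ R := by
    have h := key (Real.pi / (2 * m)) (by positivity) (by
      rw [div_lt_iff₀ (by positivity)]
      nlinarith)
    have h2 : (m : ℝ) * (Real.pi / (2 * m)) = Real.pi / 2 := by field_simp
    rwa [h2, Real.sin_pi_div_two, mul_one] at h
  refine ⟨?_, hR0⟩
  by_contra hne
  have hm2 : (2 : ℝ) ≤ m := by exact_mod_cast (by omega : 2 ≤ m)
  have h := key (3 * Real.pi / (2 * m)) (by positivity) (by
      rw [div_lt_iff₀ (by positivity)]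
      nlinarith)
  have h2 : (m : ℝ) * (3 * Real.pi / (2 * m)) = Real.pi / 2 + Real.pi := by
    field_simp
    norm_num
  rw [h2, Real.sin_add_pi, Real.sin_pi_div_two] at h
  have hR' : R = 0 := by linarith
  rw [hR, div_eq_zero_iff] at hR'
  rcases hR' with h | h
  · exact hs h
  · obtain ⟨l, hl, h⟩ := Finset.prod_eq_zero_iff.mp h
    exact (Finset.mem_filter.mp hl).2 (sub_eq_zero.mp h).symm

/-- A real rational function mapping the upper half-plane to the closed lower half-plane has only
simple poles, with nonnegative residues. -/
theorem exists_partial_fractions [DecidableEq κ] (T : Finset κ) (μ : κ → ℝ) (s : ℝ[X])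
    (hs : s.natDegree ≤ T.card)
    (him : ∀ x : ℂ, 0 < x.im → (aeval x s / ∏ k ∈ T, (x - μ k)).im ≤ 0) :
    ∃ (c : ℝ) (w : κ → ℝ), (∀ k, 0 ≤ w k) ∧
      s = C c * ∏ k ∈ T, (X - C (μ k)) + ∑ k ∈ T, C (w k) * ∏ l ∈ T.erase k, (X - C (μ l)) := by
  induction hn : T.card generalizing T s with
  | zero =>
    rw [hn] at hs
    obtain rfl : T = ∅ := Finset.card_eq_zero.mp hn
    exact ⟨s.coeff 0, 0, fun _ => le_rfl, by simpa using eq_C_of_natDegree_le_zero hs⟩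
  | succ n ih =>
    by_cases hroot : ∃ k ∈ T, s.eval (μ k) = 0
    · obtain ⟨k, hk, h0⟩ := hroot
      obtain ⟨s₁, rfl⟩ := dvd_iff_isRoot.mpr h0
      have hcard : (T.erase k).card = n := by rw [Finset.card_erase_of_mem hk, hn]; rfl
      have hs₁ : s₁.natDegree ≤ (T.erase k).card := by
        by_cases hz : s₁ = 0
        · simp [hz]
        · rw [natDegree_mul (X_sub_C_ne_zero _) hz, natDegree_X_sub_C] at hs
          omega
      obtain ⟨c, w, hw, h⟩ := ih (T.erase k) s₁ hs₁ (fun x hx => by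
        have hx0 : x - μ k ≠ 0 := by
          intro h
          have := congrArg Complex.im h
          simp at this
          exact hx.ne' this
        have := him x hx
        rw [← Finset.mul_prod_erase T _ hk, map_mul] at this
        simp only [map_sub, aeval_X, aeval_C, Complex.coe_algebraMap] at this
        rwa [mul_div_mul_left _ _ hx0] at this) hcard
      refine ⟨c, Function.update w k 0, fun l => ?_, ?_⟩
      · by_cases hl : l = k
        · subst hl
          simp
        · simpa [hl] using hw l
      · rw [← Finset.mul_prod_erase T _ hk, ← Finset.add_sum_erase T _ hk, h]
        simp only [Function.update_self, map_zero, zero_mul, zero_add, mul_add, Finset.mul_sum]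
        congr 1
        · ring
        · refine Finset.sum_congr rfl fun l hl => ?_
          have hlk : l ≠ k := Finset.ne_of_mem_erase hl
          rw [Function.update_of_ne hlk, Finset.erase_right_comm,
            ← Finset.mul_prod_erase (T.erase l) _ (Finset.mem_erase.mpr ⟨hlk.symm, hk⟩)]
          ring
    · push Not at hroot
      have key := fun k hk => card_filter_eq_one_and_div_nonneg him hk (hroot k hk)
      have hfilter : ∀ k ∈ T, (T.filter fun l => ¬ μ l = μ k) = T.erase k := by
        intro k hk
        obtain ⟨a, ha⟩ := Finset.card_eq_one.mp (key k hk).1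
        have hka : k = a := by
          have : k ∈ T.filter fun l => μ l = μ k := by simp [hk]
          rwa [ha, Finset.mem_singleton] at this
        ext l
        rw [Finset.mem_filter, Finset.mem_erase]
        refine ⟨fun h => ⟨fun h' => h.2 (by rw [h']), h.1⟩, fun h => ⟨h.2, fun h' => h.1 ?_⟩⟩
        have : l ∈ T.filter fun l => μ l = μ k := by simp [h.2, h']
        rw [ha, Finset.mem_singleton] at this
        rw [this, hka]
      have hinj : Set.InjOn μ T := by
        intro k hk l hl h
        by_contra hne
        have : l ∈ T.erase k := Finset.mem_erase.mpr ⟨fun h => hne h.symm, hl⟩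
        rw [← hfilter k hk, Finset.mem_filter] at this
        exact this.2 h.symm
      let w : κ → ℝ := fun k => if k ∈ T then
        s.eval (μ k) / (∏ l ∈ T with ¬ μ l = μ k, (μ k - μ l)) else 0
      refine ⟨s.coeff T.card, w, fun k => ?_, ?_⟩
      · by_cases hk : k ∈ T
        · simpa [w, hk] using (key k hk).2
        · simp [w, hk]
      have hmonic : (∏ k ∈ T, (X - C (μ k))).Monic := monic_prod_X_sub_C μ T
      have hdeg : (∏ k ∈ T, (X - C (μ k))).natDegree = T.card := by
        simp [natDegree_prod_of_monic _ _ fun k _ => monic_X_sub_C (μ k)]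
      have hlt : (s - C (s.coeff T.card) * ∏ k ∈ T, (X - C (μ k))).degree < T.card := by
        rw [degree_lt_iff_coeff_zero]
        intro j hj
        rcases hj.eq_or_lt with rfl | hj
        · have : (∏ k ∈ T, (X - C (μ k))).coeff T.card = 1 := by
            rw [← hdeg]
            exact hmonic
          simp [this]
        · rw [coeff_sub, coeff_C_mul, coeff_eq_zero_of_natDegree_lt (hs.trans_lt hj),
            coeff_eq_zero_of_natDegree_lt (hdeg.trans_lt hj), mul_zero, sub_zero]
      have hlt2 : (∑ k ∈ T, C (w k) * ∏ l ∈ T.erase k, (X - C (μ l))).degree < T.card := by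
        rw [degree_lt_iff_coeff_zero]
        intro j hj
        rw [finsetSum_coeff]
        refine Finset.sum_eq_zero fun k hk => ?_
        rw [coeff_C_mul, coeff_eq_zero_of_natDegree_lt, mul_zero]
        rw [natDegree_prod_of_monic _ _ fun k _ => monic_X_sub_C (μ k)]
        simp only [natDegree_X_sub_C, Finset.sum_const, smul_eq_mul, mul_one]
        exact (Finset.card_erase_lt_of_mem hk).trans_le hj
      rw [← sub_eq_iff_eq_add']
      refine eq_of_degrees_lt_of_eval_index_eq T hinj hlt hlt2 fun k hk => ?_
      rw [eval_sub, eval_mul, eval_prod, Finset.prod_eq_zero hk (by simp), mul_zero, sub_zero,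
        eval_finsetSum, Finset.sum_eq_single_of_mem k hk]
      · simp only [w, hk, if_true, eval_mul, eval_C, eval_prod, eval_sub, eval_X]
        rw [hfilter k hk, div_mul_cancel₀]
        refine Finset.prod_ne_zero_iff.mpr fun l hl => ?_
        rw [← hfilter k hk] at hl
        exact fun h => (Finset.mem_filter.mp hl).2 (sub_eq_zero.mp h).symm
      · intro l hl hlk
        rw [eval_mul, eval_prod, Finset.prod_eq_zero (Finset.mem_erase.mpr ⟨hlk.symm, hk⟩)
          (by simp), mul_zero]

end PartialFractions

section Barrier

open Polynomial in
theorem barrier_iterate_derivative {m : ℕ} {a z G : ℝ} {μ : Fin (m + 1) → ℝ} {s : ℝ[X]}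
    (ha : 0 < a) (hG : 0 < G) (hμ : ∀ k, μ k < z)
    (hs : s.natDegree ≤ m + 1)
    (him : ∀ x : ℂ, 0 < x.im → (aeval x s / ∏ k, (x - μ k)).im ≤ 0)
    (hq : G * (derivative (C a * ∏ k, (X - C (μ k)))).eval z
      ≤ (m + 1) * (C a * ∏ k, (X - C (μ k))).eval z)
    (hsz : G * s.eval z ≤ (m + 1) * (C a * ∏ k, (X - C (μ k))).eval z) :
    0 < (derivative^[m] (C a * ∏ k, (X - C (μ k)))).eval (z - (m / (m + 1)) ^ 2 * G) ∧
    G * (derivative^[m] s).eval (z - (m / (m + 1)) ^ 2 * G)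
      ≤ (m + 1) * (derivative^[m] (C a * ∏ k, (X - C (μ k)))).eval
        (z - (m / (m + 1)) ^ 2 * G) := by
  set δ := ((m : ℝ) / (m + 1)) ^ 2 * G with hδ
  have hg : ∀ k, 0 < z - μ k := fun k => sub_pos.2 (hμ k)
  have hP : 0 < ∏ k, (z - μ k) := Finset.prod_pos fun k _ => hg k
  have hr : (0 : ℝ) < m + 1 := by positivity
  have heval : (C a * ∏ k, (X - C (μ k))).eval z = a * ∏ k, (z - μ k) := by
    simp [eval_prod]
  rw [eval_derivative_C_mul_prod _ _ _ _ fun k _ => (hμ k).ne', heval] at hq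
  have hinv : G * ∑ k, (z - μ k)⁻¹ ≤ m + 1 := by
    have h1 : 0 < a * ∏ k, (z - μ k) := by positivity
    nlinarith
  have hsum : ∀ k, (m + 1) * δ ≤ ∑ l ∈ Finset.univ.erase k, (z - μ l) := by
    intro k
    have hcs := Finset.sum_mul_sq_le_sq_mul_sq (Finset.univ.erase k)
      (fun l => √(z - μ l)) (fun l => (√(z - μ l))⁻¹)
    have h1 : ∑ l ∈ Finset.univ.erase k, √(z - μ l) * (√(z - μ l))⁻¹ = m := by
      rw [Finset.sum_congr rfl fun l _ => mul_inv_cancel₀ (Real.sqrt_pos.2 (hg l)).ne']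
      simp
    have h2 : ∀ l, √(z - μ l) ^ 2 = z - μ l := fun l => Real.sq_sqrt (hg l).le
    rw [h1] at hcs
    simp only [inv_pow, h2] at hcs
    have h3 : ∑ l ∈ Finset.univ.erase k, (z - μ l)⁻¹ ≤ ∑ l, (z - μ l)⁻¹ :=
      Finset.sum_le_sum_of_subset_of_nonneg (Finset.erase_subset _ _)
        fun l _ _ => (inv_pos.2 (hg l)).le
    have h4 : 0 ≤ ∑ l ∈ Finset.univ.erase k, (z - μ l) :=
      Finset.sum_nonneg fun l _ => (hg l).le
    have h5 : (m + 1) * δ = (m : ℝ) ^ 2 * G / (m + 1) := by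
      rw [hδ]
      field_simp
    rw [h5, div_le_iff₀ hr]
    nlinarith [mul_le_mul_of_nonneg_left h3 h4, mul_le_mul_of_nonneg_left hinv h4]
  set S := ∑ k, (z - δ - μ k) with hS
  have hSk : ∀ k, z - μ k ≤ S := by
    intro k
    have h1 : S = ∑ k, (z - μ k) - (m + 1) * δ := by
      rw [hS, Finset.sum_congr rfl fun l _ => (by ring : z - δ - μ l = z - μ l - δ),
        Finset.sum_sub_distrib]
      simp
    rw [h1, ← Finset.add_sum_erase _ _ (Finset.mem_univ k)]
    linarith [hsum k]
  have hSpos : 0 < S := (hg 0).trans_le (hSk 0)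
  have hm : (0 : ℝ) < m.factorial := by positivity
  rw [eval_iterate_derivative_C_mul_prod]
  refine ⟨by positivity, ?_⟩
  obtain ⟨c, w, hw, rfl⟩ := exists_partial_fractions Finset.univ μ s (by simpa using hs) him
  have h1 : (derivative^[m] (C c * ∏ k, (X - C (μ k))
      + ∑ k, C (w k) * ∏ l ∈ Finset.univ.erase k, (X - C (μ l)))).eval (z - δ)
      = m.factorial * (c * S + ∑ k, w k) := by
    rw [iterate_map_add derivative, eval_add, eval_iterate_derivative_C_mul_prod,
      iterate_derivative_sum, eval_finsetSum, mul_add, mul_assoc,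
      Finset.mul_sum (a := (m.factorial : ℝ)) (f := w)]
    congr 1
    refine Finset.sum_congr rfl fun k _ => ?_
    rw [iterate_derivative_C_mul]
    have h2 := (derivative' (R := ℝ)).iterate_card_prod (Finset.univ.erase k)
      (fun l => X - C (μ l)) (by simp [derivative'])
    have hcard : (Finset.univ.erase k).card = m := by simp
    rw [hcard] at h2
    change derivative^[m] _ = _ at h2
    rw [h2]
    simp [derivative']
    ring
  rw [h1]
  have h2 : (C c * ∏ k, (X - C (μ k))
      + ∑ k, C (w k) * ∏ l ∈ Finset.univ.erase k, (X - C (μ l))).eval z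
      = (∏ k, (z - μ k)) * (c + ∑ k, w k * (z - μ k)⁻¹) := by
    rw [eval_add, eval_finsetSum, mul_add, Finset.mul_sum]
    congr 1
    · simp [eval_prod, mul_comm]
    · refine Finset.sum_congr rfl fun k _ => ?_
      rw [← Finset.mul_prod_erase _ _ (Finset.mem_univ k)]
      have := (hg k).ne'
      simp [eval_prod]
      field_simp
  rw [h2, heval] at hsz
  have h3 : G * (c + ∑ k, w k * (z - μ k)⁻¹) ≤ (m + 1) * a := by
    nlinarith
  have h4 : ∑ k, w k ≤ S * ∑ k, w k * (z - μ k)⁻¹ := by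
    rw [Finset.mul_sum]
    refine Finset.sum_le_sum fun k _ => ?_
    have h5 : 1 ≤ S * (z - μ k)⁻¹ := by
      rw [← div_eq_mul_inv, one_le_div (hg k)]
      exact hSk k
    nlinarith [hw k]
  have h6 : G * (c * S + ∑ k, w k) ≤ (m + 1) * a * S := by
    nlinarith [mul_le_mul_of_nonneg_right h3 hSpos.le, mul_le_mul_of_nonneg_left h4 hG.le]
  nlinarith [mul_le_mul_of_nonneg_left h6 hm.le]

variable {ι : Type*} [DecidableEq ι]

theorem StableFamily.im_pderiv_div_nonpos {d : ι → ℕ} {Q : Finset ι → MvPolynomial ι ℝ}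
    (hQ : StableFamily d Q) {U : Finset ι} {j : ι} (hj : j ∉ U) (z : ι → ℂ)
    (hz : (z j).im = 0) (h : MvPolynomial.aeval z (Q (insert j U)) ≠ 0)
    (hne : ∀ x : ℂ, 0 < x.im → MvPolynomial.aeval (Function.update z j x) (Q U) ≠ 0)
    (h0 : MvPolynomial.aeval z (Q U) ≠ 0) :
    (MvPolynomial.aeval z (MvPolynomial.pderiv j (Q U)) / MvPolynomial.aeval z (Q U)).im ≤ 0 := by
  obtain ⟨μ, hμ, hs⟩ := hQ.exists_slice_eq hj z h hne
  have hzμ : ∀ k ∈ Finset.univ, z j ≠ μ k := by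
    intro k _ hk
    apply h0
    rw [← eval_slice_self z j, hs, Polynomial.eval_mul, Polynomial.eval_prod,
      Finset.prod_eq_zero (Finset.mem_univ k) (by simp [hk]), mul_zero]
  rw [← eval_slice_self z j (MvPolynomial.pderiv j (Q U)), ← derivative_slice, hs,
    Polynomial.eval_derivative_C_mul_prod _ _ _ _ hzμ, ← hs, eval_slice_self,
    mul_div_cancel_left₀ _ h0, Complex.im_sum]
  refine Finset.sum_nonpos fun k _ => ?_
  rw [Complex.inv_im, Complex.sub_im, hz]
  refine div_nonpos_of_nonpos_of_nonneg ?_ (Complex.normSq_nonneg _)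
  linarith [hμ k]

/-- All members of the family `Q` are positive on the orthant above `z`. -/
def PosAbove (z : ι → ℝ) (Q : Finset ι → MvPolynomial ι ℝ) : Prop :=
  ∀ U w, (∀ k, z k ≤ w k) → 0 < MvPolynomial.aeval w (Q U)

/-- The logarithmic derivative in direction `j` of every member of `Q` is at most `r / G` on the
orthant above `z`. -/
def BarrierAbove (z : ι → ℝ) (Q : Finset ι → MvPolynomial ι ℝ) (r : ℕ) (G : ℝ) (j : ι) : Prop :=
  ∀ U, j ∉ U → ∀ w, (∀ k, z k ≤ w k) →
    G * MvPolynomial.aeval w (MvPolynomial.pderiv j (Q U)) ≤ r * MvPolynomial.aeval w (Q U)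

/-- Differentiate `m` times in the `i`-th variable every member of a family of degree `m + 1` in
that variable. -/
noncomputable def famStep (m : ℕ) (i : ι) (Q : Finset ι → MvPolynomial ι ℝ) (U : Finset ι) :
    MvPolynomial ι ℝ :=
  if i ∈ U then ((m + 1).factorial : MvPolynomial ι ℝ) * Q U
  else (MvPolynomial.pderiv i)^[m] (Q U)

theorem aeval_iterate_pderiv {K : Type*} [Field K] [Algebra ℝ K] (w : ι → K) (i : ι)
    (P : MvPolynomial ι ℝ) (m : ℕ) :
    MvPolynomial.aeval w ((MvPolynomial.pderiv i)^[m] P)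
      = (Polynomial.derivative^[m] (slice w i P)).eval (w i) := by
  rw [iterate_derivative_slice, eval_slice_self]

namespace StableFamily

variable {d : ι → ℕ} {Q : Finset ι → MvPolynomial ι ℝ}

theorem exists_real_slice_eq_of_posAbove (hQ : StableFamily d Q) {z : ι → ℝ} (hz : PosAbove z Q)
    {m : ℕ} {i : ι} (hd : d i = m + 1) {U : Finset ι} (hi : i ∉ U) {w : ι → ℝ}
    (hw : ∀ k, z k ≤ w k) :
    ∃ μ : Fin (m + 1) → ℝ, (∀ k, μ k < w i) ∧
      slice w i (Q U) = Polynomial.C (MvPolynomial.aeval w (Q (insert i U)))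
        * ∏ k, (Polynomial.X - Polynomial.C (μ k)) := by
  have h := hQ.exists_real_slice_eq hi w (hz _ w hw).ne'
  rw [hd] at h
  obtain ⟨μ, hμ⟩ := h
  refine ⟨μ, fun k => ?_, hμ⟩
  by_contra! hk
  have h1 : 0 < (slice w i (Q U)).eval (μ k) := by
    rw [eval_slice]
    refine hz _ _ fun l => ?_
    by_cases hl : l = i
    · subst hl
      simpa using (hw l).trans hk
    · simpa [hl] using hw l
  rw [hμ, Polynomial.eval_mul, Polynomial.eval_prod,
    Finset.prod_eq_zero (Finset.mem_univ k) (by simp), mul_zero] at h1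
  exact h1.false

theorem famStep (hQ : StableFamily d Q) {m : ℕ} {i : ι} (hd : d i = m + 1) :
    StableFamily (Function.update d i 1) (famStep m i Q) where
  ne_zero U z hz := by
    unfold _root_.famStep
    split_ifs with hi
    · rw [map_mul, map_natCast]
      exact mul_ne_zero (by exact_mod_cast Nat.factorial_ne_zero _) (hQ.ne_zero U z hz)
    · have h := hQ.exists_slice_eq hi z (hQ.ne_zero _ z hz) fun x hx => by
        apply hQ.ne_zero
        intro k
        by_cases hk : k = i
        · subst hk
          simpa
        · simpa [hk] using hz k
      rw [hd] at h
      obtain ⟨μ, hμ, h⟩ := h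
      rw [aeval_iterate_pderiv, h, Polynomial.eval_iterate_derivative_C_mul_prod]
      refine mul_ne_zero (mul_ne_zero (by exact_mod_cast Nat.factorial_ne_zero _)
        (hQ.ne_zero _ z hz)) fun h0 => ?_
      have h1 : 0 < (∑ k, (z i - μ k)).im := by
        rw [Complex.im_sum]
        refine Finset.sum_pos (fun k _ => ?_) ⟨0, Finset.mem_univ _⟩
        rw [Complex.sub_im]
        linarith [hμ k, hz i]
      rw [h0] at h1
      exact h1.false
  top U j hj := by
    unfold _root_.famStep
    by_cases hji : j = i
    · subst hji
      rw [Function.update_self, if_neg hj, if_pos (Finset.mem_insert_self j U),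
        ← Function.iterate_add_apply, add_comm, ← hd, hQ.top U j hj]
      simp
    · have hij : i ≠ j := fun h => hji h.symm
      simp only [Function.update_of_ne hji, Finset.mem_insert, hij, false_or]
      split_ifs with hi
      · rw [iterate_pderiv_natCast_mul, hQ.top U j hj]
        ring
      · rw [MvPolynomial.iterate_pderiv_comm, hQ.top U j hj, iterate_pderiv_natCast_mul]
  const U j hj := by
    unfold _root_.famStep
    split_ifs with hi
    · simp [hQ.const U j hj]
    · have h := MvPolynomial.iterate_pderiv_comm j i (Q U) 1 m
      simp only [Function.iterate_one, hQ.const U j hj] at h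
      rw [h, Function.iterate_fixed (map_zero _)]

theorem posAbove_famStep (hQ : StableFamily d Q) {z : ι → ℝ} (hz : PosAbove z Q)
    {m : ℕ} {i : ι} (hd : d i = m + 1) : PosAbove z (_root_.famStep m i Q) := by
  intro U w hw
  unfold _root_.famStep
  split_ifs with hi
  · rw [map_mul, map_natCast]
    have := hz U w hw
    positivity
  · obtain ⟨μ, hμ, h⟩ := hQ.exists_real_slice_eq_of_posAbove hz hd hi hw
    rw [aeval_iterate_pderiv, h, Polynomial.eval_iterate_derivative_C_mul_prod]
    have h1 : 0 < ∑ k, (w i - μ k) :=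
      Finset.sum_pos (fun k _ => sub_pos.2 (hμ k)) ⟨0, Finset.mem_univ _⟩
    have := hz (insert i U) w hw
    positivity

theorem pderiv_natDegree_im (hQ : StableFamily d Q) {z : ι → ℝ} (hz : PosAbove z Q)
    {m : ℕ} {i j : ι} (hd : d i = m + 1) (hij : j ≠ i) {U : Finset ι} (hi : i ∉ U) (hj : j ∉ U)
    {w : ι → ℝ} (hw : ∀ k, z k ≤ w k) {μ : Fin (m + 1) → ℝ}
    (hμ : slice w i (Q U) = Polynomial.C (MvPolynomial.aeval w (Q (insert i U)))
        * ∏ k, (Polynomial.X - Polynomial.C (μ k))) :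
    (slice w i (MvPolynomial.pderiv j (Q U))).natDegree ≤ m + 1 ∧
    ∀ x : ℂ, 0 < x.im → (Polynomial.aeval x (slice w i (MvPolynomial.pderiv j (Q U)))
      / ∏ k, (x - μ k)).im ≤ 0 := by
  constructor
  · refine (Polynomial.natDegree_le_and_coeff_of_iterate_derivative_eq_C
      (c := MvPolynomial.aeval w (MvPolynomial.pderiv j (Q (insert i U)))) ?_).1
    have h1 := MvPolynomial.iterate_pderiv_comm i j (Q U) (m + 1) 1
    have h2 := iterate_pderiv_natCast_mul j (Q (insert i U)) (m + 1).factorial 1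
    have h3 := MvPolynomial.iterate_pderiv_comm i j (Q (insert i U)) 1 1
    simp only [Function.iterate_one, ← hd, hQ.top U i hi] at h1 h2 h3
    rw [hQ.const _ _ (Finset.mem_insert_self i U), map_zero] at h3
    rw [iterate_derivative_slice, ← hd, h1, h2, map_mul, map_natCast, slice_eq_C w h3]
    simp
  · intro x hx
    set u := Function.update (fun k => (w k : ℂ)) i x with hu
    have hu0 : ∀ k, 0 ≤ (u k).im := im_update_nonneg (by simp) i hx.le
    have hui : 0 < (u i).im := by simpa [hu]
    have hreal : ∀ P : MvPolynomial ι ℝ, MvPolynomial.aeval u P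
        = Polynomial.aeval x (slice w i P) := by
      intro P
      rw [hu, ← eval_slice, ← map_slice, Polynomial.eval_map, ← Polynomial.aeval_def]
    have hne : ∀ V, i ∉ V → MvPolynomial.aeval u (Q V) ≠ 0 := by
      intro V hV
      refine hQ.ne_zero_of_im_pos hV u hu0 hui ?_
      rw [hu, hQ.aeval_insert_update, aeval_ofReal]
      exact_mod_cast (hz _ w hw).ne'
    have hij' : i ∉ insert j U := by simp [hi, hij.symm]
    have h := hQ.im_pderiv_div_nonpos hj u (by simp [hu, hij]) (hne _ hij') (fun y hy => by
      refine hQ.ne_zero_of_im_pos hj _ (im_update_nonneg hu0 j hy.le) (by simpa) ?_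
      rw [hQ.aeval_insert_update]
      exact hne _ hij') (hne U hi)
    rw [hreal, hreal, hμ] at h
    have ha := hz (insert i U) w hw
    simp only [map_mul, map_prod, map_sub, Polynomial.aeval_X, Polynomial.aeval_C,
      Complex.coe_algebraMap] at h
    rw [mul_comm, ← div_div, Complex.div_ofReal_im] at h
    by_contra! h'
    exact absurd h (not_le.2 (div_pos h' ha))

theorem aeval_update_iterate_pderiv (w : ι → ℝ) (i : ι) (y : ℝ) (P : MvPolynomial ι ℝ) (m : ℕ) :
    MvPolynomial.aeval (Function.update w i y) ((MvPolynomial.pderiv i)^[m] P)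
      = (Polynomial.derivative^[m] (slice w i P)).eval y := by
  rw [aeval_iterate_pderiv, slice_update, Function.update_self]

/-- How far the barrier argument moves the point in one step. -/
noncomputable def _root_.barrierShift (m : ℕ) (G : ℝ) : ℝ := ((m : ℝ) / (m + 1)) ^ 2 * G

theorem le_update_add_of_update_sub_le {z w : ι → ℝ} {i : ι} {δ : ℝ}
    (hw : ∀ k, Function.update z i (z i - δ) k ≤ w k) :
    ∀ k, z k ≤ Function.update w i (w i + δ) k := by
  intro k
  have := hw k
  by_cases hk : k = i
  · subst hk
    simp only [Function.update_self] at this ⊢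
    linarith
  · simpa [hk] using this

theorem posAbove_famStep_update (hQ : StableFamily d Q) {z : ι → ℝ} (hz : PosAbove z Q)
    {m : ℕ} {i : ι} (hd : d i = m + 1) {G : ℝ} (hG : 0 < G)
    (hi : BarrierAbove z Q (m + 1) G i) :
    PosAbove (Function.update z i (z i - barrierShift m G)) (_root_.famStep m i Q) := by
  intro U w hw
  set w₁ := Function.update w i (w i + barrierShift m G) with hw₁
  have hzw := le_update_add_of_update_sub_le hw
  have hww : w = Function.update w₁ i (w₁ i - barrierShift m G) := by simp [hw₁]
  unfold _root_.famStep
  split_ifs with hiU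
  · rw [map_mul, map_natCast, ← aeval_update_of_pderiv_eq_zero w (hQ.const U i hiU)]
    have := hz U _ hzw
    positivity
  · obtain ⟨μ, hμ, h⟩ := hQ.exists_real_slice_eq_of_posAbove hz hd hiU hzw
    have hb := hi U hiU _ hzw
    rw [← eval_slice_self w₁ i, ← eval_slice_self w₁ i (Q U), ← derivative_slice, h] at hb
    rw [hww, aeval_update_iterate_pderiv, h]
    refine (barrier_iterate_derivative (s := 0) (hz _ _ hzw) hG hμ (by simp) (by simp)
      (by exact_mod_cast hb) ?_).1
    rw [← h, eval_slice_self, Polynomial.eval_zero, mul_zero]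
    have := hz U _ hzw
    positivity

theorem barrierAbove_famStep_update (hQ : StableFamily d Q) {z : ι → ℝ} (hz : PosAbove z Q)
    {m : ℕ} {i j : ι} (hd : d i = m + 1) {G : ℝ} (hG : 0 < G)
    (hi : BarrierAbove z Q (m + 1) G i) (hj : BarrierAbove z Q (m + 1) G j) (hij : j ≠ i) :
    BarrierAbove (Function.update z i (z i - barrierShift m G)) (_root_.famStep m i Q)
      (m + 1) G j := by
  intro U hjU w hw
  set w₁ := Function.update w i (w i + barrierShift m G) with hw₁
  have hzw := le_update_add_of_update_sub_le hw
  have hww : w = Function.update w₁ i (w₁ i - barrierShift m G) := by simp [hw₁]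
  unfold _root_.famStep
  split_ifs with hiU
  · have h1 := iterate_pderiv_natCast_mul j (Q U) (m + 1).factorial 1
    have h3 := MvPolynomial.iterate_pderiv_comm i j (Q U) 1 1
    simp only [Function.iterate_one] at h1 h3
    rw [hQ.const U i hiU, map_zero] at h3
    rw [h1, map_mul, map_mul, map_natCast, ← aeval_update_of_pderiv_eq_zero w (hQ.const U i hiU)
      (w i + barrierShift m G), ← aeval_update_of_pderiv_eq_zero w h3 (w i + barrierShift m G)]
    have h4 := hj U hjU _ hzw
    have h5 : (0 : ℝ) < (m + 1).factorial := by positivity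
    nlinarith
  · obtain ⟨μ, hμ, h⟩ := hQ.exists_real_slice_eq_of_posAbove hz hd hiU hzw
    have hb := hi U hiU _ hzw
    have hb' := hj U hjU _ hzw
    rw [← eval_slice_self w₁ i, ← eval_slice_self w₁ i (Q U), ← derivative_slice, h] at hb
    rw [← eval_slice_self w₁ i, ← eval_slice_self w₁ i (Q U), h] at hb'
    have h6 := MvPolynomial.iterate_pderiv_comm j i (Q U) 1 m
    simp only [Function.iterate_one] at h6
    obtain ⟨h7, h8⟩ := hQ.pderiv_natDegree_im hz hd hij hiU hjU hzw h
    rw [hww, h6, aeval_update_iterate_pderiv, aeval_update_iterate_pderiv, h]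
    have h9 := (barrier_iterate_derivative (hz _ _ hzw) hG hμ h7 h8
      (by exact_mod_cast hb) (by exact_mod_cast hb')).2
    push_cast
    exact h9

end StableFamily

/-- Apply `famStep` successively for the variables of a list, the first one first. -/
noncomputable def famIter (m : ℕ) : List ι → (Finset ι → MvPolynomial ι ℝ) →
    Finset ι → MvPolynomial ι ℝ
  | [], Q => Q
  | i :: L, Q => famIter m L (famStep m i Q)

namespace StableFamily

variable {d : ι → ℕ} {Q : Finset ι → MvPolynomial ι ℝ}

theorem famIter {m : ℕ} {L : List ι} (hQ : StableFamily d Q) (hL : L.Nodup)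
    (hd : ∀ i ∈ L, d i = m + 1) :
    StableFamily (fun i => if i ∈ L then 1 else d i) (famIter m L Q) := by
  induction L generalizing d Q with
  | nil => simpa [_root_.famIter]
  | cons i L ih =>
    obtain ⟨hi, hL⟩ := List.nodup_cons.1 hL
    have h := ih (hQ.famStep (hd i (by simp))) hL fun j hj => by
      have hji : j ≠ i := fun h => hi (h ▸ hj)
      rw [Function.update_of_ne hji]
      exact hd j (by simp [hj])
    unfold _root_.famIter
    convert h using 1
    funext j
    by_cases hji : j = i
    · subst hji
      simp
    · simp [hji]

theorem posAbove_famIter {m : ℕ} {L : List ι} (hQ : StableFamily d Q) (hL : L.Nodup)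
    (hd : ∀ i ∈ L, d i = m + 1) {z : ι → ℝ} (hz : PosAbove z Q) :
    PosAbove z (_root_.famIter m L Q) := by
  induction L generalizing d Q with
  | nil => simpa [_root_.famIter]
  | cons i L ih =>
    obtain ⟨hi, hL⟩ := List.nodup_cons.1 hL
    refine ih (hQ.famStep (hd i (by simp))) hL (fun j hj => ?_)
      (hQ.posAbove_famStep hz (hd i (by simp)))
    have hji : j ≠ i := fun h => hi (h ▸ hj)
    rw [Function.update_of_ne hji]
    exact hd j (by simp [hj])

theorem posAbove_famIter_sub {m : ℕ} {L : List ι} (hQ : StableFamily d Q) (hL : L.Nodup)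
    (hd : ∀ i ∈ L, d i = m + 1) {z : ι → ℝ} (hz : PosAbove z Q) {G : ℝ} (hG : 0 < G)
    (hb : ∀ i ∈ L, BarrierAbove z Q (m + 1) G i) :
    PosAbove (fun i => if i ∈ L then z i - barrierShift m G else z i)
      (_root_.famIter m L Q) := by
  induction L generalizing d Q z with
  | nil => simpa [_root_.famIter]
  | cons i L ih =>
    obtain ⟨hi, hL⟩ := List.nodup_cons.1 hL
    have hne : ∀ j ∈ L, j ≠ i := fun j hj h => hi (h ▸ hj)
    have hdi := hd i (by simp)
    have hbi := hb i (by simp)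
    have h := ih (hQ.famStep hdi) hL (fun j hj => by
        rw [Function.update_of_ne (hne j hj)]
        exact hd j (by simp [hj]))
      (hQ.posAbove_famStep_update hz hdi hG hbi)
      (fun j hj => hQ.barrierAbove_famStep_update hz hdi hG hbi (hb j (by simp [hj])) (hne j hj))
    unfold _root_.famIter
    convert h using 1
    funext j
    by_cases hji : j = i
    · subst hji
      simp [hi]
    · simp [hji]

end StableFamily

end Barrier

section Interlacing

open Polynomial in
theorem Polynomial.wronskian_nonneg_of_im_mul_conj_nonneg {f g : ℝ[X]}
    (h : ∀ x : ℂ, 0 < x.im → 0 ≤ (aeval x f * starRingEnd ℂ (aeval x g)).im) (x : ℝ) :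
    0 ≤ (derivative f).eval x * g.eval x - f.eval x * (derivative g).eval x := by
  let u : ℝ → ℂ := fun ε => x + ε * Complex.I
  have hu : HasDerivAt u Complex.I 0 := by
    have h1 := ((Complex.ofRealCLM.hasDerivAt (x := 0)).mul_const Complex.I).const_add (x : ℂ)
    rw [Complex.ofRealCLM_apply, Complex.ofReal_one, one_mul] at h1
    exact h1
  have hp : ∀ p : ℝ[X], HasDerivAt (fun ε => aeval (u ε) p)
      (((derivative p).eval x : ℝ) * Complex.I) 0 := by
    intro p
    have h1 := p.hasDerivAt_aeval (u 0)
    have h2 := h1.comp (0 : ℝ) hu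
    have h3 : aeval (u 0) (derivative p) = (((derivative p).eval x : ℝ) : ℂ) := by
      simp only [u, Complex.ofReal_zero, zero_mul, add_zero]
      exact Polynomial.aeval_algebraMap_apply_eq_algebraMap_eval x _
    rw [h3] at h2
    exact h2
  have hprod := (hp f).mul (hp g).star
  have him := (Complex.imCLM.hasFDerivAt (x := _)).comp_hasDerivAt (0 : ℝ) hprod
  have h0 : ∀ p : ℝ[X], aeval (u 0) p = ((p.eval x : ℝ) : ℂ) := by
    intro p
    simp only [u, Complex.ofReal_zero, zero_mul, add_zero]
    exact Polynomial.aeval_algebraMap_apply_eq_algebraMap_eval x _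
  have hs := (hasDerivAt_iff_tendsto_slope.1 him).mono_left (nhdsGT_le_nhdsNE 0)
  have hge := ge_of_tendsto hs (b := 0) (by
    filter_upwards [self_mem_nhdsWithin] with ε hε
    have hε' : (0 : ℝ) < ε := hε
    have h1 := h (u ε) (by simpa [u] using hε')
    simp only [slope_def_field, Function.comp, h0, Pi.mul_apply]
    refine div_nonneg ?_ (by simpa using hε'.le)
    simpa [Complex.mul_im] using h1)
  simp [h0] at hge
  linarith

open Polynomial in
theorem Polynomial.monotoneOn_div_of_wronskian_nonneg {f g : ℝ[X]} {s : Set ℝ} (hs : Convex ℝ s)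
    (hg : ∀ x ∈ s, 0 < g.eval x)
    (h : ∀ x, 0 ≤ (derivative f).eval x * g.eval x - f.eval x * (derivative g).eval x) :
    MonotoneOn (fun x => f.eval x / g.eval x) s := by
  refine monotoneOn_of_deriv_nonneg hs ?_ ?_ ?_
  · exact f.continuousOn.div g.continuousOn fun x hx => (hg x hx).ne'
  · exact f.differentiableOn.div g.differentiableOn fun x hx => (hg x (interior_subset hx)).ne'
  · intro x hx
    have hne := (hg x (interior_subset hx)).ne'
    have hderiv : HasDerivAt (fun x => f.eval x / g.eval x) _ x :=
      (f.hasDerivAt x).div (g.hasDerivAt x) hne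
    rw [hderiv.deriv]
    exact div_nonneg (h x) (sq_nonneg _)

open Polynomial in
theorem Polynomial.exists_pos_of_sum_pos_of_interlacing {κ : Type*} [Fintype κ] {f : κ → ℝ[X]}
    {g : ℝ[X]} {e t : ℝ} (hgt : ∀ x, t ≤ x → 0 < g.eval x)
    (h : ∀ j x, 0 ≤ (derivative (f j)).eval x * g.eval x - (f j).eval x * (derivative g).eval x)
    (hsum : ∀ x, e ≤ x → 0 < ∑ j, (f j).eval x) :
    ∃ j, ∀ x, e ≤ x → 0 < (f j).eval x := by
  by_cases hroot : ∃ y, e ≤ y ∧ g.eval y = 0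
  · exfalso
    let K : Set ℝ := {x ∈ Set.Icc e t | g.eval x = 0}
    have hK : IsCompact K := by
      refine isCompact_Icc.inter_right ?_
      exact isClosed_eq g.continuous continuous_const
    obtain ⟨y₀, hy₀, hgy₀⟩ := hroot
    have hlt : ∀ y, g.eval y = 0 → y < t := by
      intro y hy
      by_contra! hty
      exact (hgt y hty).ne' hy
    obtain ⟨y, ⟨⟨hey, hyt⟩, hgy⟩, hmax⟩ := hK.exists_isGreatest
      ⟨y₀, ⟨hy₀, (hlt y₀ hgy₀).le⟩, hgy₀⟩
    have hyt' := hlt y hgy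
    have hpos : ∀ x ∈ Set.Ioi y, 0 < g.eval x := by
      intro x hx
      by_contra! hneg
      have hxt : x ≤ t := by
        by_contra! hxt
        exact hneg.not_gt (hgt x hxt.le)
      obtain ⟨c, hc, hgc⟩ := intermediate_value_Icc hxt g.continuous.continuousOn
        ⟨hneg, (hgt t le_rfl).le⟩
      have hcy := hmax ⟨⟨hey.trans (hx.le.trans hc.1), hc.2⟩, hgc⟩
      exact absurd (hx.trans_le hc.1) (not_lt.2 hcy)
    have hle : ∀ j, (f j).eval y ≤ 0 := by
      intro j
      have hmono := monotoneOn_div_of_wronskian_nonneg (convex_Ioi y) hpos (h j)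
      have hlim : Filter.Tendsto (fun x => (f j).eval x) (nhdsWithin y (Set.Ioi y))
          (nhds ((f j).eval y)) := (f j).continuous.continuousWithinAt
      have hlim' : Filter.Tendsto (fun x => (f j).eval t / g.eval t * g.eval x)
          (nhdsWithin y (Set.Ioi y)) (nhds ((f j).eval t / g.eval t * g.eval y)) :=
        (continuous_const.mul g.continuous).continuousWithinAt
      rw [hgy, mul_zero] at hlim'
      refine le_of_tendsto_of_tendsto hlim hlim' ?_
      filter_upwards [Ioo_mem_nhdsGT hyt'] with x hx
      have h1 := hmono hx.1 hyt' hx.2.le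
      exact (div_le_iff₀ (hpos x hx.1)).1 h1
    exact absurd (hsum y hey) (not_lt.2 (Finset.sum_nonpos fun j _ => hle j))
  · push Not at hroot
    have hpos : ∀ x ∈ Set.Ici e, 0 < g.eval x := by
      intro x hx
      by_contra! hneg
      obtain ⟨c, hc, hgc⟩ := intermediate_value_Icc (le_max_left x t) g.continuous.continuousOn
        ⟨hneg, (hgt _ (le_max_right x t)).le⟩
      exact hroot c (le_trans hx hc.1) hgc
    obtain ⟨j, _, hj⟩ := Finset.exists_lt_of_sum_lt
      (by simpa using hsum e le_rfl : ∑ _j : κ, (0 : ℝ) < ∑ j, (f j).eval e)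
    refine ⟨j, fun x hx => ?_⟩
    have hmono := monotoneOn_div_of_wronskian_nonneg (convex_Ici e) hpos (h j)
      (Set.mem_Ici.2 le_rfl) hx hx
    have h1 : 0 < (f j).eval e / g.eval e := div_pos hj (hpos e (Set.mem_Ici.2 le_rfl))
    exact (div_pos_iff_of_pos_right (hpos x hx)).1 (h1.trans_le hmono)

variable {ι : Type*}

/-- The restriction of a multivariate polynomial to the diagonal. -/
noncomputable def diagonalPoly : MvPolynomial ι ℝ →ₐ[ℝ] Polynomial ℝ :=
  MvPolynomial.aeval fun _ => Polynomial.X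

theorem aeval_diagonalPoly {K : Type*} [Field K] [Algebra ℝ K] (P : MvPolynomial ι ℝ) (x : K) :
    Polynomial.aeval x (diagonalPoly P) = MvPolynomial.aeval (fun _ => x) P := by
  have h : (Polynomial.aeval x).comp diagonalPoly
      = (MvPolynomial.aeval (fun _ => x) : MvPolynomial ι ℝ →ₐ[ℝ] K) := by
    apply MvPolynomial.algHom_ext
    intro k
    simp [diagonalPoly]
  exact congrArg (fun φ : MvPolynomial ι ℝ →ₐ[ℝ] K => φ P) h

theorem eval_diagonalPoly (P : MvPolynomial ι ℝ) (x : ℝ) :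
    (diagonalPoly P).eval x = MvPolynomial.aeval (fun _ => x) P := by
  rw [← aeval_diagonalPoly, Polynomial.coe_aeval_eq_eval]

variable [DecidableEq ι]

theorem famStep_mul_sum (m : ℕ) (i : ι) {κ : Type*} (s : Finset κ)
    (Q : κ → Finset ι → MvPolynomial ι ℝ) (c : ℕ) (U : Finset ι) :
    famStep m i (fun U => (c : MvPolynomial ι ℝ) * ∑ j ∈ s, Q j U) U
      = (c : MvPolynomial ι ℝ) * ∑ j ∈ s, famStep m i (Q j) U := by
  unfold famStep
  split_ifs with h
  · rw [← Finset.mul_sum]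
    ring
  · rw [iterate_pderiv_natCast_mul]
    congr 1
    induction m with
    | zero => simp
    | succ m ih => simp only [Function.iterate_succ_apply', ih, map_sum]

theorem famIter_mul_sum (m : ℕ) (L : List ι) {κ : Type*} (s : Finset κ)
    (Q : κ → Finset ι → MvPolynomial ι ℝ) (c : ℕ) (U : Finset ι) :
    famIter m L (fun U => (c : MvPolynomial ι ℝ) * ∑ j ∈ s, Q j U) U
      = (c : MvPolynomial ι ℝ) * ∑ j ∈ s, famIter m L (Q j) U := by
  induction L generalizing Q with
  | nil => rfl
  | cons i L ih =>
    simp only [famIter]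
    rw [← ih]
    congr 1
    funext U
    exact famStep_mul_sum m i s Q c U

theorem famIter_congr {m : ℕ} {L : List ι} {Q Q' : Finset ι → MvPolynomial ι ℝ} {U : Finset ι}
    (h : Q U = Q' U) : famIter m L Q U = famIter m L Q' U := by
  induction L generalizing Q Q' with
  | nil => exact h
  | cons i L ih =>
    simp only [famIter]
    apply ih
    simp only [famStep, h]

/-- The product of several copies of a family, each with its own set of variables sent to
infinity. -/
noncomputable def prodFamily {κ : Type*} [Fintype κ] (p : Finset ι → MvPolynomial ι ℝ)
    (V : κ → Finset ι) (U : Finset ι) : MvPolynomial ι ℝ :=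
  ∏ l, p (V l ∪ U)

theorem prodFamily_congr {κ : Type*} [Fintype κ] {p : Finset ι → MvPolynomial ι ℝ}
    {V V' : κ → Finset ι} {U : Finset ι} (h : ∀ l, V l ∪ U = V' l ∪ U) :
    prodFamily p V U = prodFamily p V' U := by
  simp only [prodFamily, h]

namespace StableFamily

variable {p : Finset ι → MvPolynomial ι ℝ}

theorem pderiv_eq (hp : StableFamily (fun _ => 1) p) {U : Finset ι} {i : ι} (hi : i ∉ U) :
    MvPolynomial.pderiv i (p U) = p (insert i U) := by
  simpa using hp.top U i hi

theorem pderiv_pderiv (hp : StableFamily (fun _ => 1) p) (U : Finset ι) (i : ι) :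
    MvPolynomial.pderiv i (MvPolynomial.pderiv i (p U)) = 0 := by
  by_cases hi : i ∈ U
  · rw [hp.const U i hi, map_zero]
  · rw [hp.pderiv_eq hi, hp.const _ _ (Finset.mem_insert_self i U)]

theorem prodFamily {κ : Type*} [Fintype κ] (hp : StableFamily (fun _ => 1) p)
    (V : κ → Finset ι) :
    StableFamily (fun i => (Finset.univ.filter fun l => i ∉ V l).card) (prodFamily p V) where
  ne_zero U z hz := by
    unfold _root_.prodFamily
    rw [map_prod]
    exact Finset.prod_ne_zero_iff.2 fun l _ => hp.ne_zero _ z hz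
  const U i hi := by
    classical
    exact Derivation.apply_prod_eq_zero _ _ _ fun l _ => hp.const _ _ (by simp [hi])
  top U i hi := by
    classical
    unfold _root_.prodFamily
    have hc : MvPolynomial.pderiv i (∏ l with ¬ i ∉ V l, p (V l ∪ U)) = 0 := by
      refine Derivation.apply_prod_eq_zero _ _ _ fun l hl => hp.const _ _ ?_
      simp only [not_not, Finset.mem_filter, Finset.mem_univ, true_and] at hl
      simp [hl]
    rw [← Finset.prod_filter_mul_prod_filter_not Finset.univ (fun l => i ∉ V l), mul_comm,
      Derivation.iterate_mul_of_apply_eq_zero _ hc,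
      Derivation.iterate_card_prod _ _ _ fun l _ => hp.pderiv_pderiv _ _,
      ← Finset.prod_filter_mul_prod_filter_not Finset.univ (fun l => i ∉ V l)
        (fun l => p (V l ∪ insert i U)), mul_comm, mul_assoc]
    congr 2
    · refine Finset.prod_congr rfl fun l hl => ?_
      simp only [Finset.mem_filter, Finset.mem_univ, true_and] at hl
      rw [hp.pderiv_eq (by simp [hl, hi]), Finset.union_insert]
    · refine Finset.prod_congr rfl fun l hl => ?_
      simp only [not_not, Finset.mem_filter, Finset.mem_univ, true_and] at hl
      rw [Finset.union_insert, Finset.insert_eq_of_mem (by simp [hl])]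

theorem posAbove_prodFamily {κ : Type*} [Fintype κ] {z : ι → ℝ} (h : PosAbove z p)
    (V : κ → Finset ι) : PosAbove z (_root_.prodFamily p V) := by
  intro U w hw
  unfold _root_.prodFamily
  rw [map_prod]
  exact Finset.prod_pos fun l _ => h _ w hw

theorem famStep_prodFamily {m : ℕ} (hp : StableFamily (fun _ => 1) p)
    {V : Fin (m + 1) → Finset ι} {i : ι} (hi : ∀ l, i ∉ V l) :
    _root_.famStep m i (_root_.prodFamily p V) = fun U => (m.factorial : MvPolynomial ι ℝ) *
      ∑ j, _root_.prodFamily p (fun l => if l = j then V l else insert i (V l)) U := by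
  funext U
  unfold _root_.famStep
  split_ifs with hU
  · have h : ∀ j : Fin (m + 1), _root_.prodFamily p
        (fun l => if l = j then V l else insert i (V l)) U = _root_.prodFamily p V U := by
      intro j
      apply prodFamily_congr
      intro l
      split_ifs
      · rfl
      · rw [Finset.insert_union, Finset.insert_eq_of_mem (by simp [hU])]
    simp only [h, Finset.sum_const, Finset.card_univ, Fintype.card_fin, nsmul_eq_mul,
      Nat.factorial_succ]
    push_cast
    ring
  · unfold _root_.prodFamily
    rw [Derivation.iterate_pred_card_prod _ _ _ (fun l _ => hp.pderiv_pderiv _ _)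
      (by simp : (Finset.univ : Finset (Fin (m + 1))).card = m + 1)]
    congr 1
    refine Finset.sum_congr rfl fun j _ => ?_
    rw [← Finset.mul_prod_erase _ _ (Finset.mem_univ j)]
    simp only [if_true]
    congr 1
    refine Finset.prod_congr rfl fun l hl => ?_
    rw [if_neg (Finset.ne_of_mem_erase hl), hp.pderiv_eq (by simp [hi l, hU]),
      Finset.insert_union]

theorem im_mul_conj_nonneg {d : ι → ℕ} {Q : Finset ι → MvPolynomial ι ℝ} (hQ : StableFamily d Q)
    {i : ι} (hd : d i = 1) {U : Finset ι} (hi : i ∉ U) (z : ι → ℂ) (hz : ∀ k, 0 < (z k).im) :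
    0 ≤ (MvPolynomial.aeval z (Q U)
      * starRingEnd ℂ (MvPolynomial.aeval z (Q (insert i U)))).im := by
  have h := hQ.exists_slice_eq hi z (hQ.ne_zero _ z hz) fun x hx => by
    apply hQ.ne_zero
    intro k
    by_cases hk : k = i
    · subst hk
      simpa
    · simpa [hk] using hz k
  rw [hd] at h
  obtain ⟨μ, hμ, h⟩ := h
  rw [← eval_slice_self z i (Q U), h]
  simp only [Finset.univ_unique, Finset.prod_singleton, Polynomial.eval_mul, Polynomial.eval_C,
    Polynomial.eval_sub, Polynomial.eval_X]
  rw [mul_right_comm, Complex.mul_conj, Complex.im_ofReal_mul, Complex.sub_im]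
  have := hμ default
  have := hz i
  exact mul_nonneg (Complex.normSq_nonneg _) (by linarith)

theorem exists_prodFamily_pos {m : ℕ} (hp : StableFamily (fun _ => 1) p) {e t : ℝ}
    (ht : PosAbove (fun _ => t) p) {L : List ι} (hL : L.Nodup) (V : Fin (m + 1) → Finset ι)
    (hV : ∀ i ∈ L, ∀ l, i ∉ V l) (hV' : ∀ i, ∃ l, i ∉ V l)
    (hpos : ∀ x, e ≤ x → 0 < MvPolynomial.aeval (fun _ => x)
      (_root_.famIter m L (_root_.prodFamily p V) ∅)) :
    ∃ V' : Fin (m + 1) → Finset ι, (∀ i, ∃ l, i ∉ V' l) ∧ ∀ x : ℝ, e ≤ x →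
      0 < MvPolynomial.aeval (fun _ => x) (_root_.prodFamily p V' ∅) := by
  induction L generalizing V with
  | nil => exact ⟨V, hV', hpos⟩
  | cons i L ih =>
    obtain ⟨hiL, hL⟩ := List.nodup_cons.1 hL
    have hiV := hV i (by simp)
    set W : Fin (m + 1) → Fin (m + 1) → Finset ι :=
      fun j l => if l = j then V l else insert i (V l) with hW
    set F : Fin (m + 1) → Finset ι → MvPolynomial ι ℝ :=
      fun j => _root_.famIter m L (_root_.prodFamily p (W j)) with hF
    have hWL : ∀ j, ∀ k ∈ L, ∀ l, k ∉ W j l := by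
      intro j k hk l
      have hki : k ≠ i := fun h => hiL (h ▸ hk)
      simp only [hW]
      split_ifs
      · exact hV k (by simp [hk]) l
      · simp [hki, hV k (by simp [hk]) l]
    have hFs : ∀ j, StableFamily (fun k => if k ∈ L then 1
        else (Finset.univ.filter fun l => k ∉ W j l).card) (F j) := by
      intro j
      refine (hp.prodFamily (W j)).famIter hL fun k hk => ?_
      simp [hWL j k hk]
    have hdi : ∀ j, (if i ∈ L then 1
        else (Finset.univ.filter fun l => i ∉ W j l).card) = 1 := by
      intro j
      rw [if_neg hiL, Finset.card_eq_one]
      refine ⟨j, ?_⟩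
      ext l
      simp only [hW, Finset.mem_filter, Finset.mem_univ, true_and, Finset.mem_singleton]
      split_ifs with h
      · simp [h, hiV]
      · simp [h]
    have hg : ∀ j, F j (insert i ∅) = F 0 (insert i ∅) := by
      intro j
      apply famIter_congr
      apply prodFamily_congr
      intro l
      simp only [hW]
      split_ifs <;> simp
    obtain ⟨j, hj⟩ := Polynomial.exists_pos_of_sum_pos_of_interlacing (e := e) (t := t)
      (f := fun j => diagonalPoly (F j ∅)) (g := diagonalPoly (F 0 (insert i ∅))) (fun x hx => by
        rw [eval_diagonalPoly]
        refine (hp.prodFamily (W 0)).posAbove_famIter hL (fun k hk => ?_)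
          (posAbove_prodFamily ht _) _ _ fun _ => hx
        simp [hWL 0 k hk])
      (fun j x => by
        apply Polynomial.wronskian_nonneg_of_im_mul_conj_nonneg
        intro y hy
        rw [aeval_diagonalPoly, aeval_diagonalPoly, ← hg j]
        exact (hFs j).im_mul_conj_nonneg (hdi j) (by simp) _ fun _ => hy)
      (fun x hx => by
        have h := hpos x hx
        simp only [_root_.famIter] at h
        rw [hp.famStep_prodFamily hiV, famIter_mul_sum, map_mul, map_natCast, map_sum] at h
        simp only [eval_diagonalPoly]
        exact pos_of_mul_pos_right h (by positivity))
    refine ih hL (W j) (hWL j) (fun k => ?_) fun x hx => by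
      simpa only [eval_diagonalPoly] using hj x hx
    by_cases hk : k = i
    · subst hk
      exact ⟨j, by simp [hW, hiV]⟩
    · obtain ⟨l, hl⟩ := hV' k
      refine ⟨l, ?_⟩
      simp only [hW]
      split_ifs <;> simp [hk, hl]

theorem exists_coloring [Fintype ι] (m : ℕ) (hp : StableFamily (fun _ => 1) p) {t G : ℝ}
    (hG : 0 < G) (ht : PosAbove (fun _ => t) p) (hb : ∀ j, BarrierAbove (fun _ => t) p 1 G j) :
    ∃ V : Fin (m + 1) → Finset ι, (∀ i, ∃ l, i ∉ V l) ∧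
      ∀ l, ∀ x : ℝ, t - barrierShift m G ≤ x →
        MvPolynomial.aeval (fun _ => x) (p (V l)) ≠ 0 := by
  have hd : ∀ i ∈ (Finset.univ : Finset ι).toList,
      (Finset.univ.filter fun _l : Fin (m + 1) => i ∉ (∅ : Finset ι)).card = m + 1 := by
    simp
  have hb' : ∀ i, BarrierAbove (fun _ => t)
      (_root_.prodFamily p (fun _ : Fin (m + 1) => ∅)) (m + 1) G i := by
    intro i U hi w hw
    have h := hb i U hi w hw
    have h0 := ht U w hw
    simp only [_root_.prodFamily, Finset.empty_union, Finset.prod_const, Finset.card_univ,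
      Fintype.card_fin, Derivation.leibniz_pow, Nat.add_sub_cancel, map_pow,
      smul_eq_mul, nsmul_eq_mul, map_mul, map_natCast]
    have h1 : 0 < ((m + 1 : ℕ) : ℝ) * MvPolynomial.aeval w (p U) ^ m := by positivity
    have h2 := mul_le_mul_of_nonneg_left h h1.le
    push_cast at h2 ⊢
    rw [pow_succ]
    linarith
  have hpos := (hp.prodFamily fun _ : Fin (m + 1) => ∅).posAbove_famIter_sub
    (Finset.nodup_toList Finset.univ) hd (posAbove_prodFamily ht _) hG fun i _ => hb' i
  obtain ⟨V, hV, h⟩ := hp.exists_prodFamily_pos (e := t - barrierShift m G) ht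
    (Finset.nodup_toList Finset.univ) (fun _ => ∅) (by simp) (fun i => ⟨0, by simp⟩)
    fun x hx => hpos ∅ _ (fun _ => by simpa using hx)
  refine ⟨V, hV, fun l x hx h0 => (h x hx).ne' ?_⟩
  unfold _root_.prodFamily
  rw [map_prod, Finset.prod_eq_zero (Finset.mem_univ l)]
  simpa using h0

end StableFamily

end Interlacing

section Pencil

variable {ι : Type*} [DecidableEq ι]

/-- The matrix `diagonal z - A` with the rows indexed by `U` replaced by those of the identity. -/
def pencil {R : Type*} [CommRing R] (A : Matrix ι ι R) (U : Finset ι) (z : ι → R) :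
    Matrix ι ι R :=
  Matrix.of fun i k => if i ∈ U then (1 : Matrix ι ι R) i k else Matrix.diagonal z i k - A i k

theorem pencil_map {R S : Type*} [CommRing R] [CommRing S] (f : R →+* S) (A : Matrix ι ι R)
    (U : Finset ι) (z : ι → R) :
    (pencil A U z).map f = pencil (A.map f) U (fun i => f (z i)) := by
  ext i k
  simp only [pencil, Matrix.map_apply, Matrix.of_apply, Matrix.diagonal_apply, Matrix.one_apply]
  split_ifs <;> simp

variable [Fintype ι]

theorem map_det_pencil {R S : Type*} [CommRing R] [CommRing S] (f : R →+* S) (A : Matrix ι ι R)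
    (U : Finset ι) (z : ι → R) :
    f (pencil A U z).det = (pencil (A.map f) U (fun i => f (z i))).det := by
  rw [RingHom.map_det, RingHom.mapMatrix_apply, pencil_map]

theorem Derivation.apply_det_eq_zero {R A : Type*} [CommRing R] [CommRing A] [Algebra R A]
    (D : Derivation R A A) (M : Matrix ι ι A) (h : ∀ i k, D (M i k) = 0) : D M.det = 0 := by
  rw [Matrix.det_apply, map_sum]
  refine Finset.sum_eq_zero fun σ _ => ?_
  rw [Units.smul_def, map_zsmul, D.apply_prod_eq_zero _ _ fun i _ => h _ _, smul_zero]

theorem pderiv_det_pencil (A : Matrix ι ι ℂ) {U : Finset ι} {i : ι} (hi : i ∉ U) :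
    MvPolynomial.pderiv i (pencil (A.map MvPolynomial.C) U MvPolynomial.X).det
      = (pencil (A.map MvPolynomial.C) (insert i U) MvPolynomial.X).det := by
  set M := pencil (A.map (MvPolynomial.C (σ := ι))) U MvPolynomial.X with hM
  have h1 : M = M.updateRow i ((MvPolynomial.X i : MvPolynomial ι ℂ) • Pi.single i 1
      + fun k => -MvPolynomial.C (A i k)) := by
    ext1 j k
    by_cases hj : j = i
    · subst hj
      by_cases hk : k = j
      · subst hk
        simp [hM, pencil, hi, sub_eq_add_neg]
      · simp [hM, pencil, hi, hk, Ne.symm hk]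
    · rw [Matrix.updateRow_ne hj]
  have h2 : M.updateRow i (Pi.single i 1)
      = pencil (A.map MvPolynomial.C) (insert i U) MvPolynomial.X := by
    ext1 j k
    by_cases hj : j = i
    · subst hj
      simp [pencil, Matrix.one_apply, Pi.single_apply, eq_comm]
    · simp [hM, pencil, hj]
  have hX : ∀ j k, j ≠ i → MvPolynomial.pderiv i (M j k) = 0 := by
    intro j k hj
    simp only [hM, pencil, Matrix.of_apply, Matrix.diagonal_apply, Matrix.one_apply,
      Matrix.map_apply]
    split_ifs <;> simp [MvPolynomial.pderiv_X_of_ne hj]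
  rw [h1, Matrix.det_updateRow_add, Matrix.det_updateRow_smul, map_add, h2,
    Derivation.apply_det_eq_zero _ (M.updateRow i _), add_zero, MvPolynomial.pderiv_mul,
    MvPolynomial.pderiv_X_self, one_mul, ← h2, Derivation.apply_det_eq_zero, mul_zero, add_zero]
  · intro j k
    by_cases hj : j = i
    · subst hj
      by_cases hk : k = j
      · subst hk
        simp
      · simp [hk]
    · rw [Matrix.updateRow_ne hj, hX j k hj]
  · intro j k
    by_cases hj : j = i
    · subst hj
      simp
    · rw [Matrix.updateRow_ne hj, hX j k hj]

theorem map_conj_det_pencil {A : Matrix ι ι ℂ} (hA : A.IsHermitian) (U : Finset ι) :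
    MvPolynomial.map (starRingEnd ℂ) (pencil (A.map MvPolynomial.C) U MvPolynomial.X).det
      = (pencil (A.map MvPolynomial.C) U MvPolynomial.X).det := by
  induction U using Finset.induction_on with
  | empty =>
    rw [map_det_pencil, ← Matrix.det_transpose]
    congr 1
    ext1 i k
    simp only [pencil, Finset.notMem_empty, if_false, Matrix.transpose_apply, Matrix.of_apply,
      MvPolynomial.map_X, Matrix.map_apply, MvPolynomial.map_C, Matrix.diagonal_apply]
    rw [starRingEnd_apply, hA.apply]
    by_cases h : i = k
    · subst h
      rfl
    · simp [h, Ne.symm h]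
  | insert i U hi ih => rw [← pderiv_det_pencil A hi, ← MvPolynomial.pderiv_map, ih]

theorem exists_real_det_pencil {A : Matrix ι ι ℂ} (hA : A.IsHermitian) :
    ∃ p : Finset ι → MvPolynomial ι ℝ, ∀ U, MvPolynomial.map (algebraMap ℝ ℂ) (p U)
      = (pencil (A.map MvPolynomial.C) U MvPolynomial.X).det := by
  have h : ∀ U, (pencil (A.map (MvPolynomial.C (σ := ι))) U MvPolynomial.X).det
      ∈ Set.range (MvPolynomial.map (algebraMap ℝ ℂ)) := by
    intro U
    rw [MvPolynomial.mem_range_map_iff_coeffs_subset]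
    intro c hc
    obtain ⟨n, _, rfl⟩ := MvPolynomial.mem_coeffs_iff.1 hc
    have h1 := congrArg (MvPolynomial.coeff n) (map_conj_det_pencil hA U)
    rw [MvPolynomial.coeff_map] at h1
    exact ⟨_, Complex.conj_eq_iff_re.1 h1⟩
  choose p hp using h
  exact ⟨p, hp⟩

/-- The value of the quadratic form of a matrix. -/
noncomputable def quadForm (A : Matrix ι ι ℂ) (v : ι → ℂ) : ℝ := (star v ⬝ᵥ A *ᵥ v).re

theorem exists_of_det_pencil_eq_zero {A : Matrix ι ι ℂ} {U : Finset ι} {z : ι → ℂ}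
    (h : (pencil A U z).det = 0) :
    ∃ v : ι → ℂ, v ≠ 0 ∧ ∑ i, z i * (Complex.normSq (v i) : ℂ) = star v ⬝ᵥ A *ᵥ v := by
  obtain ⟨v, hv, h⟩ := Matrix.exists_mulVec_eq_zero_iff.2 h
  refine ⟨v, hv, ?_⟩
  rw [dotProduct]
  refine Finset.sum_congr rfl fun i _ => ?_
  have hi := congrFun h i
  by_cases hU : i ∈ U
  · have h1 : v i = 0 := by
      simpa [pencil, hU, Matrix.mulVec, dotProduct, Matrix.one_apply] using hi
    simp [h1]
  · have h1 : z i * v i - (A *ᵥ v) i = 0 := by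
      simpa [pencil, hU, Matrix.mulVec, dotProduct, sub_mul, Finset.sum_sub_distrib,
        Matrix.diagonal_apply] using hi
    rw [← sub_eq_zero.1 h1, Complex.normSq_eq_conj_mul_self]
    simp only [Pi.star_apply, starRingEnd_apply]
    ring

theorem sum_normSq_pos {κ : Type*} [Fintype κ] {v : κ → ℂ} (hv : v ≠ 0) :
    0 < ∑ i, Complex.normSq (v i) := by
  obtain ⟨i, hi⟩ := Function.ne_iff.1 hv
  exact Finset.sum_pos' (fun i _ => Complex.normSq_nonneg _)
    ⟨i, Finset.mem_univ i, Complex.normSq_pos.2 hi⟩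

theorem det_pencil_ne_zero_of_im_pos {A : Matrix ι ι ℂ} (hA : A.IsHermitian) (U : Finset ι)
    {z : ι → ℂ} (hz : ∀ i, 0 < (z i).im) : (pencil A U z).det ≠ 0 := by
  intro h
  obtain ⟨v, hv, h⟩ := exists_of_det_pencil_eq_zero h
  obtain ⟨i, hi⟩ := Function.ne_iff.1 hv
  have h1 := congrArg Complex.im h
  have h2 : (star v ⬝ᵥ A *ᵥ v).im = 0 := hA.im_star_dotProduct_mulVec_self v
  rw [h2, Complex.im_sum] at h1
  have h3 : 0 < ∑ i, (z i * (Complex.normSq (v i) : ℂ)).im := by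
    simp only [Complex.im_mul_ofReal]
    exact Finset.sum_pos' (fun i _ => mul_nonneg (hz i).le (Complex.normSq_nonneg _))
      ⟨i, Finset.mem_univ i, mul_pos (hz i) (Complex.normSq_pos.2 hi)⟩
  exact h3.ne' h1

theorem det_pencil_ne_zero_of_quadForm_lt {A : Matrix ι ι ℂ} (U : Finset ι) {w : ι → ℝ}
    (h : ∀ v, v ≠ 0 → quadForm A v < ∑ i, w i * Complex.normSq (v i)) :
    (pencil A U (fun i => (w i : ℂ))).det ≠ 0 := by
  intro h0
  obtain ⟨v, hv, h1⟩ := exists_of_det_pencil_eq_zero h0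
  have h2 := congrArg Complex.re h1
  rw [Complex.re_sum] at h2
  simp only [Complex.re_ofReal_mul, Complex.ofReal_re] at h2
  exact (h v hv).ne' h2

theorem quadForm_add_single {A : Matrix ι ι ℂ} (hA : A.IsHermitian) {j : ι} (hj : A j j = 0)
    (v : ι → ℂ) (c : ℂ) : quadForm A (v + Pi.single j c)
      = quadForm A v + 2 * (star c * (A *ᵥ v) j).re := by
  have h1 : star v ⬝ᵥ A *ᵥ Pi.single j c = star (star c * (A *ᵥ v) j) := by
    rw [Matrix.mulVec_single, dotProduct, Matrix.mulVec, dotProduct, Finset.mul_sum, star_sum]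
    refine Finset.sum_congr rfl fun i _ => ?_
    have h2 := hA.apply i j
    simp only [Pi.star_apply, Pi.smul_apply, Matrix.col_apply, MulOpposite.smul_eq_mul_unop,
      MulOpposite.unop_op, star_mul, star_star, ← h2]
    ring
  have h2 : star (Pi.single j c : ι → ℂ) = Pi.single j (star c) := by
    ext i
    by_cases hi : i = j
    · subst hi
      simp
    · simp [hi]
  unfold quadForm
  rw [star_add, Matrix.mulVec_add, add_dotProduct, dotProduct_add, dotProduct_add, h1, h2,
    single_dotProduct, single_dotProduct]
  have h3 : (A *ᵥ Pi.single j c) j = 0 := by simp [Matrix.mulVec_single, hj]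
  rw [h3]
  simp
  ring

theorem sum_normSq_add_single (v : ι → ℂ) (j : ι) (c : ℂ) :
    ∑ i, Complex.normSq ((v + Pi.single j c : ι → ℂ) i)
      = ∑ i, Complex.normSq (v i) + Complex.normSq (v j + c) - Complex.normSq (v j) := by
  rw [← Finset.add_sum_erase _ _ (Finset.mem_univ j),
    ← Finset.add_sum_erase Finset.univ (fun i => Complex.normSq (v i)) (Finset.mem_univ j)]
  have : ∀ i ∈ Finset.univ.erase j, Complex.normSq ((v + Pi.single j c : ι → ℂ) i)
      = Complex.normSq (v i) := by
    intro i hi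
    simp [Finset.ne_of_mem_erase hi]
  rw [Finset.sum_congr rfl this]
  simp
  ring

theorem quadForm_le_sub {A : Matrix ι ι ℂ} (hA : A.IsHermitian) (h0 : ∀ i, A i i = 0)
    (hb : ∀ v, |quadForm A v| ≤ ∑ i, Complex.normSq (v i)) (v : ι → ℂ) (j : ι) :
    quadForm A v ≤ 2 * ∑ i, Complex.normSq (v i) - 3 / 2 * Complex.normSq (v j) := by
  have h1 := (abs_le.1 (hb (v + Pi.single j (-(1 / 2 : ℝ) * v j)))).2
  have h2 := (abs_le.1 (hb (v + Pi.single j (-(3 / 2 : ℝ) * v j)))).1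
  rw [sum_normSq_add_single, quadForm_add_single hA (h0 j)] at h1 h2
  have h3 : ∀ c : ℝ, Complex.normSq (v j + -(c : ℂ) * v j)
      = (1 - c) ^ 2 * Complex.normSq (v j) := by
    intro c
    rw [show v j + -(c : ℂ) * v j = ((1 - c : ℝ) : ℂ) * v j by push_cast; ring,
      Complex.normSq_mul, Complex.normSq_ofReal]
    ring
  have h4 : ∀ c : ℝ, (star (-(c : ℂ) * v j) * (A *ᵥ v) j).re
      = -c * (star (v j) * (A *ᵥ v) j).re := by
    intro c
    rw [← Complex.re_ofReal_mul]
    simp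
    ring
  rw [h3, h4] at h1 h2
  nlinarith

theorem posAbove_of_ne_zero {p : Finset ι → MvPolynomial ι ℝ}
    (hp : StableFamily (fun _ => 1) p) {z : ι → ℝ}
    (h1 : p Finset.univ = 1)
    (hne : ∀ U w, (∀ k, z k ≤ w k) → MvPolynomial.aeval w (p U) ≠ 0) : PosAbove z p := by
  intro U
  induction hn : Uᶜ.card generalizing U with
  | zero =>
    have hU : U = Finset.univ := by simpa using hn
    intro w _
    rw [hU, h1]
    simp
  | succ n ih =>
    obtain ⟨i, hi⟩ : ∃ i, i ∉ U := by
      have : Uᶜ.Nonempty := by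
        rw [← Finset.card_pos]
        omega
      obtain ⟨i, hi⟩ := this
      exact ⟨i, Finset.mem_compl.1 hi⟩
    intro w hw
    have hpos := ih (insert i U) (by
      rw [Finset.compl_insert, Finset.card_erase_of_mem (by simpa using hi), hn]
      rfl) w hw
    by_contra! hle
    obtain ⟨μ, hμ⟩ := hp.exists_real_slice_eq hi w hpos.ne'
    rw [← eval_slice_self w i, hμ] at hle
    simp only [Finset.univ_unique, Finset.prod_singleton, Polynomial.eval_mul,
      Polynomial.eval_C, Polynomial.eval_sub, Polynomial.eval_X] at hle
    have hμw : w i ≤ μ default := by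
      by_contra! hlt
      exact absurd hle (not_le.2 (mul_pos hpos (sub_pos.2 hlt)))
    refine hne U (Function.update w i (μ default)) (fun k => ?_) ?_
    · by_cases hk : k = i
      · subst hk
        simpa using (hw k).trans hμw
      · simpa [hk] using hw k
    · rw [← eval_slice, hμ]
      simp

/-- The family of determinants of the matrix pencils of a Hermitian matrix. -/
theorem exists_stableFamily_det_pencil {A : Matrix ι ι ℂ} (hA : A.IsHermitian) :
    ∃ p : Finset ι → MvPolynomial ι ℝ, StableFamily (fun _ => 1) p ∧ p Finset.univ = 1 ∧
      ∀ U z, MvPolynomial.aeval z (p U) = (pencil A U z).det := by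
  obtain ⟨p, hp⟩ := exists_real_det_pencil hA
  have hev : ∀ U (z : ι → ℂ), MvPolynomial.aeval z (p U) = (pencil A U z).det := by
    intro U z
    rw [← MvPolynomial.aeval_map_algebraMap ℂ, hp]
    have h := map_det_pencil (MvPolynomial.aeval z : MvPolynomial ι ℂ →ₐ[ℂ] ℂ).toRingHom
      (A.map MvPolynomial.C) U MvPolynomial.X
    refine h.trans ?_
    congr 2
    · ext i k
      simp
    · ext i
      simp
  have hinj := MvPolynomial.map_injective (σ := ι) (algebraMap ℝ ℂ) (algebraMap ℝ ℂ).injective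
  have hd : ∀ U i, i ∉ U → MvPolynomial.pderiv i (p U) = p (insert i U) := by
    intro U i hi
    apply hinj
    rw [← MvPolynomial.pderiv_map, hp, hp, pderiv_det_pencil A hi]
  refine ⟨p, ⟨fun U z hz => ?_, fun U i hi => ?_, fun U i hi => ?_⟩, ?_, hev⟩
  · rw [hev]
    exact det_pencil_ne_zero_of_im_pos hA U hz
  · simp [hd U i hi]
  · apply hinj
    rw [← MvPolynomial.pderiv_map, hp, map_zero]
    apply Derivation.apply_det_eq_zero
    intro j k
    simp only [pencil, Matrix.of_apply, Matrix.diagonal_apply, Matrix.one_apply,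
      Matrix.map_apply]
    split_ifs with hj _ hjk
    · simp
    · simp
    · have hji : j ≠ i := fun h => hj (h ▸ hi)
      rw [map_sub, MvPolynomial.pderiv_X_of_ne hji, MvPolynomial.pderiv_C, sub_zero]
    · simp
  · apply hinj
    rw [hp, map_one]
    convert Matrix.det_one (n := ι) (R := MvPolynomial ι ℂ)
    ext1 i k
    simp [pencil]

theorem exists_quadForm_le_of_forall_det_ne_zero {A : Matrix ι ι ℂ} (hA : A.IsHermitian)
    {V : Finset ι} {e : ℝ} (he : 0 ≤ e)
    (h : ∀ x : ℝ, e ≤ x → (pencil A V (fun _ => (x : ℂ))).det ≠ 0) {v : ι → ℂ}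
    (hv : ∀ i ∈ V, v i = 0) : quadForm A v ≤ e * ∑ i, Complex.normSq (v i) := by
  set N : Matrix ι ι ℂ := Matrix.of fun i k => if i ∈ V ∨ k ∈ V then 0 else A i k with hN
  set H : Matrix ι ι ℂ := (e : ℂ) • (1 : Matrix ι ι ℂ) - N with hH
  have hNh : N.IsHermitian := by
    ext i k
    simp only [hN, Matrix.conjTranspose_apply, Matrix.of_apply, or_comm]
    split_ifs
    · simp
    · exact hA.apply i k
  have hHh : H.IsHermitian := by
    refine Matrix.IsHermitian.sub ?_ hNh
    ext i k
    by_cases hik : i = k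
    · subst hik
      simp
    · simp [hik, Ne.symm hik]
  have hpsd : H.PosSemidef := by
    rw [hHh.posSemidef_iff_eigenvalues_nonneg]
    intro j
    by_contra! hj
    simp only [Pi.zero_apply] at hj
    set μ := hHh.eigenvalues j with hμ
    set u : ι → ℂ := ⇑(hHh.eigenvectorBasis j) with hu
    have hu0 : u ≠ 0 := by
      intro h0
      have h1 := (hHh.eigenvectorBasis).orthonormal.ne_zero j
      exact h1 (by ext i; exact congrFun h0 i)
    have h1 : H *ᵥ u = μ • u := hHh.mulVec_eigenvectorBasis j
    have h2 : ∀ i, (N *ᵥ u) i = ((e - μ : ℝ) : ℂ) * u i := by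
      intro i
      have h3 := congrFun h1 i
      rw [hH, Matrix.sub_mulVec, Matrix.smul_mulVec, Matrix.one_mulVec] at h3
      simp only [Pi.sub_apply, Pi.smul_apply, smul_eq_mul, Complex.real_smul] at h3
      push_cast
      linear_combination -h3
    have h4 : ∀ i ∈ V, u i = 0 := by
      intro i hi
      have h5 := h2 i
      have h6 : (N *ᵥ u) i = 0 := by
        simp [hN, Matrix.mulVec, dotProduct, hi]
      rw [h6] at h5
      have h7 : ((e - μ : ℝ) : ℂ) ≠ 0 := by
        have : 0 < e - μ := by linarith
        exact_mod_cast this.ne'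
      exact (mul_eq_zero.1 h5.symm).resolve_left h7
    refine h (e - μ) (by linarith) (Matrix.exists_mulVec_eq_zero_iff.1 ⟨u, hu0, ?_⟩)
    ext i
    by_cases hi : i ∈ V
    · simp [pencil, Matrix.mulVec, dotProduct, hi, Matrix.one_apply, h4 i hi]
    · have h5 := h2 i
      have h6 : (N *ᵥ u) i = (A *ᵥ u) i := by
        simp only [hN, Matrix.mulVec, dotProduct, Matrix.of_apply, hi, false_or]
        refine Finset.sum_congr rfl fun k _ => ?_
        split_ifs with hk
        · simp [h4 k hk]
        · rfl
      rw [h6] at h5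
      have h7 : (pencil A V (fun _ => ((e - μ : ℝ) : ℂ)) *ᵥ u) i
          = ((e - μ : ℝ) : ℂ) * u i - (A *ᵥ u) i := by
        simp [pencil, hi, Matrix.mulVec, dotProduct, sub_mul, Finset.sum_sub_distrib,
          Matrix.diagonal_apply]
      rw [h7, h5, sub_self, Pi.zero_apply]
  have h1 : 0 ≤ (star v ⬝ᵥ H *ᵥ v).re := hpsd.re_dotProduct_nonneg v
  have h2 : star v ⬝ᵥ N *ᵥ v = star v ⬝ᵥ A *ᵥ v := by
    simp only [dotProduct, Matrix.mulVec, hN, Matrix.of_apply]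
    refine Finset.sum_congr rfl fun i _ => ?_
    by_cases hi : i ∈ V
    · simp [hv i hi]
    · congr 1
      refine Finset.sum_congr rfl fun k _ => ?_
      by_cases hk : k ∈ V
      · simp [hv k hk]
      · simp [hi, hk]
  have h3 : star v ⬝ᵥ v = ((∑ i, Complex.normSq (v i) : ℝ) : ℂ) := by
    rw [dotProduct, Complex.ofReal_sum]
    refine Finset.sum_congr rfl fun i _ => ?_
    rw [Complex.normSq_eq_conj_mul_self]
    rfl
  rw [hH, Matrix.sub_mulVec, Matrix.smul_mulVec, Matrix.one_mulVec, dotProduct_sub, h2,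
    dotProduct_smul, h3, smul_eq_mul, ← Complex.ofReal_mul, Complex.sub_re,
    Complex.ofReal_re] at h1
  unfold quadForm
  linarith

theorem exists_coloring_quadForm_le {A : Matrix ι ι ℂ} (hA : A.IsHermitian)
    (h0 : ∀ i, A i i = 0) (hb : ∀ v, |quadForm A v| ≤ ∑ i, Complex.normSq (v i)) :
    ∃ c : ι → Fin 8, ∀ l v, (∀ i, c i ≠ l → v i = 0) →
      quadForm A v ≤ 6 / 7 * ∑ i, Complex.normSq (v i) := by
  obtain ⟨p, hp, hp1, hev⟩ := exists_stableFamily_det_pencil hA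
  have hne : ∀ U (w : ι → ℝ), (∀ v, v ≠ 0 → quadForm A v < ∑ i, w i * Complex.normSq (v i)) →
      MvPolynomial.aeval w (p U) ≠ 0 := by
    intro U w hw h
    refine det_pencil_ne_zero_of_quadForm_lt U hw ?_
    rw [← hev, aeval_ofReal, h, Complex.ofReal_zero]
  have hpos : PosAbove (fun _ => 2) p := by
    refine posAbove_of_ne_zero hp hp1 fun U w hw => hne U w fun v hv => ?_
    have h1 := sum_normSq_pos hv
    have h2 := (abs_le.1 (hb v)).2
    have h3 : ∑ i, 2 * Complex.normSq (v i) ≤ ∑ i, w i * Complex.normSq (v i) :=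
      Finset.sum_le_sum fun i _ => mul_le_mul_of_nonneg_right (hw i) (Complex.normSq_nonneg _)
    rw [← Finset.mul_sum] at h3
    linarith
  have hbar : ∀ j, BarrierAbove (fun _ => 2) p 1 (512 / 343) j := by
    intro j
    have hpos' : PosAbove (fun i => if i = j then 2 - 512 / 343 else 2) p := by
      refine posAbove_of_ne_zero hp hp1 fun U w hw => hne U w fun v hv => ?_
      have h1 := sum_normSq_pos hv
      have h2 := (abs_le.1 (hb v)).2
      have h3 := quadForm_le_sub hA h0 hb v j
      have h4 : ∑ i, (if i = j then 2 - 512 / 343 else 2 : ℝ) * Complex.normSq (v i)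
          ≤ ∑ i, w i * Complex.normSq (v i) :=
        Finset.sum_le_sum fun i _ => mul_le_mul_of_nonneg_right (hw i) (Complex.normSq_nonneg _)
      have h5 : ∑ i, (if i = j then 2 - 512 / 343 else 2 : ℝ) * Complex.normSq (v i)
          = 2 * ∑ i, Complex.normSq (v i) - 512 / 343 * Complex.normSq (v j) := by
        have h6 : ∀ i, (if i = j then 2 - 512 / 343 else 2 : ℝ) * Complex.normSq (v i)
            = 2 * Complex.normSq (v i)
              - if i = j then 512 / 343 * Complex.normSq (v i) else 0 := by
          intro i
          split_ifs <;> ring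
        simp only [h6, Finset.sum_sub_distrib, ← Finset.mul_sum, Finset.sum_ite_eq',
          Finset.mem_univ, if_true]
      have h7 := Complex.normSq_nonneg (v j)
      rcases h7.eq_or_lt with h8 | h8
      · rw [← h8] at h5
        linarith
      · linarith
    intro U hj w hw
    obtain ⟨μ, hμ⟩ := hp.exists_real_slice_eq hj w (hpos _ w hw).ne'
    have h1 := hpos' U (Function.update w j (w j - 512 / 343)) fun k => by
      by_cases hk : k = j
      · subst hk
        have := hw k
        simp
        linarith
      · simpa [hk] using hw k
    rw [← eval_slice, hμ] at h1
    rw [hp.pderiv_eq hj, ← eval_slice_self w j (p U), hμ]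
    simp only [Finset.univ_unique, Finset.prod_singleton, Polynomial.eval_mul,
      Polynomial.eval_C, Polynomial.eval_sub, Polynomial.eval_X] at h1 ⊢
    push_cast
    linarith
  obtain ⟨V, hV, h⟩ := hp.exists_coloring 7 (by norm_num) hpos hbar
  choose c hc using hV
  refine ⟨c, fun l v hv => ?_⟩
  refine exists_quadForm_le_of_forall_det_ne_zero hA (V := V l) (by norm_num) (fun x hx => ?_)
    fun i hi => hv i fun hil => hc i (hil ▸ hi)
  rw [← hev, aeval_ofReal]
  exact_mod_cast h l x (by norm_num [barrierShift] at hx ⊢; linarith)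

end Pencil

section

variable {ι : Type*} [Fintype ι]

theorem quadForm_neg (A : Matrix ι ι ℂ) (v : ι → ℂ) : quadForm (-A) v = -quadForm A v := by
  simp [quadForm, Matrix.neg_mulVec]

theorem quadForm_smul (r : ℝ) (A : Matrix ι ι ℂ) (v : ι → ℂ) :
    quadForm ((r : ℂ) • A) v = r * quadForm A v := by
  simp [quadForm, Matrix.smul_mulVec]

/-- Deleting the rows and columns outside a set amounts to truncating the vector. -/
theorem quadForm_restrict [DecidableEq ι] (A : Matrix ι ι ℂ) (X : Finset ι) (v : ι → ℂ) :
    quadForm (Matrix.of fun i j => if i ∈ X ∧ j ∈ X then A i j else 0) v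
      = quadForm A (fun i => if i ∈ X then v i else 0) := by
  simp only [quadForm, dotProduct, mulVec, Matrix.of_apply, Pi.star_apply, Finset.mul_sum]
  congr 1
  refine Finset.sum_congr rfl fun i _ => Finset.sum_congr rfl fun j _ => ?_
  by_cases hi : i ∈ X <;> by_cases hj : j ∈ X <;> simp [hi, hj]

theorem sum_normSq_restrict_le [DecidableEq ι] (X : Finset ι) (v : ι → ℂ) :
    ∑ i, Complex.normSq (if i ∈ X then v i else 0) ≤ ∑ i, Complex.normSq (v i) := by
  refine Finset.sum_le_sum fun i _ => ?_
  split_ifs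
  · exact le_rfl
  · simpa using Complex.normSq_nonneg (v i)

/-- A two-sided paving of a Hermitian form with zero diagonal, on a subset of the indices. -/
theorem exists_coloring_abs_quadForm_le [DecidableEq ι] {A : Matrix ι ι ℂ} (hA : A.IsHermitian)
    (h0 : ∀ i, A i i = 0) {X : Finset ι} {M : ℝ} (hM : 0 ≤ M)
    (hb : ∀ v, (∀ i ∉ X, v i = 0) → |quadForm A v| ≤ M * ∑ i, Complex.normSq (v i)) :
    ∃ c : ι → Fin 64, ∀ l v, (∀ i, ¬ (i ∈ X ∧ c i = l) → v i = 0) →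
      |quadForm A v| ≤ 6 / 7 * M * ∑ i, Complex.normSq (v i) := by
  rcases hM.eq_or_lt with rfl | hM
  · exact ⟨fun _ => 0, fun l v hv => by simpa using hb v fun i hi => hv i fun h => hi h.1⟩
  set D : Matrix ι ι ℂ := Matrix.of fun i j => if i ∈ X ∧ j ∈ X then A i j else 0 with hD
  set G : Matrix ι ι ℂ := ((M⁻¹ : ℝ) : ℂ) • D with hG
  have hDh : D.IsHermitian := by
    ext i k
    simp only [hD, Matrix.conjTranspose_apply, Matrix.of_apply, and_comm]
    split_ifs
    · exact hA.apply i k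
    · simp
  have hGh : G.IsHermitian := by
    ext i k
    simp only [hG, Matrix.conjTranspose_apply, Matrix.smul_apply, smul_eq_mul, star_mul',
      hDh.apply i k]
    simp
  have hG0 : ∀ i, G i i = 0 := fun i => by simp [hG, hD, h0]
  have hGb : ∀ v, |quadForm G v| ≤ ∑ i, Complex.normSq (v i) := by
    intro v
    rw [hG, quadForm_smul, hD, quadForm_restrict, abs_mul, abs_of_pos (inv_pos.2 hM),
      inv_mul_le_iff₀ hM]
    exact (hb _ fun i hi => by simp [hi]).trans
      (mul_le_mul_of_nonneg_left (sum_normSq_restrict_le X v) hM.le)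
  obtain ⟨c, hc⟩ := exists_coloring_quadForm_le hGh hG0 hGb
  obtain ⟨d, hd⟩ := exists_coloring_quadForm_le hGh.neg (fun i => by simp [hG0])
    (fun v => by rw [quadForm_neg, abs_neg]; exact hGb v)
  let e : Fin 8 × Fin 8 ≃ Fin 64 := finProdFinEquiv
  refine ⟨fun i => e (c i, d i), fun l v hv => ?_⟩
  obtain ⟨⟨a, b⟩, rfl⟩ := e.surjective l
  have h1 := hc a v fun i hi => hv i fun h => hi (congrArg Prod.fst (e.injective h.2))
  have h2 := hd b v fun i hi => hv i fun h => hi (congrArg Prod.snd (e.injective h.2))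
  have hvX : (fun i => if i ∈ X then v i else 0) = v := by
    funext i
    split_ifs with hi
    · rfl
    · exact (hv i fun h => hi h.1).symm
  have hq : quadForm A v = M * quadForm G v := by
    rw [hG, quadForm_smul, hD, quadForm_restrict, hvX, mul_inv_cancel_left₀ hM.ne']
  rw [quadForm_neg] at h2
  rw [hq, abs_mul, abs_of_pos hM, mul_comm (6 / 7) M, mul_assoc]
  exact mul_le_mul_of_nonneg_left (abs_le.2 ⟨by linarith, h1⟩) hM.le

/-- The paving can be taken so that every class is a proper subset. -/
theorem exists_proper_coloring_abs_quadForm_le [DecidableEq ι] {A : Matrix ι ι ℂ}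
    (hA : A.IsHermitian) (h0 : ∀ i, A i i = 0) {X : Finset ι} (hX : 1 < X.card) {M : ℝ}
    (hM : 0 ≤ M)
    (hb : ∀ v, (∀ i ∉ X, v i = 0) → |quadForm A v| ≤ M * ∑ i, Complex.normSq (v i)) :
    ∃ c : ι → Fin 64, ∀ l, (X.filter (c · = l)).card < X.card ∧
      ∀ v, (∀ i ∉ X.filter (c · = l), v i = 0) →
        |quadForm A v| ≤ 6 / 7 * M * ∑ i, Complex.normSq (v i) := by
  obtain ⟨c, hc⟩ := exists_coloring_abs_quadForm_le hA h0 hM hb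
  by_cases h : ∃ l, ∀ i ∈ X, c i = l
  · obtain ⟨l₀, hl₀⟩ := h
    obtain ⟨x, hx, y, hy, hxy⟩ := Finset.one_lt_card.1 hX
    refine ⟨fun i => if i = x then 0 else 1, fun l => ⟨?_, fun v hv => hc l₀ v fun i hi => ?_⟩⟩
    · refine Finset.card_lt_card (Finset.filter_ssubset.2 ?_)
      by_cases hl : l = 0
      · exact ⟨y, hy, by simp [hl, hxy.symm]⟩
      · exact ⟨x, hx, by simpa using Ne.symm hl⟩
    · exact hv i fun h => hi ⟨(Finset.mem_filter.1 h).1, hl₀ i (Finset.mem_filter.1 h).1⟩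
  · push Not at h
    refine ⟨c, fun l => ⟨Finset.card_lt_card (Finset.filter_ssubset.2 (h l)), fun v hv =>
      hc l v fun i hi => hv i fun h => hi (Finset.mem_filter.1 h)⟩⟩

/-- The entries of a matrix below the diagonal for the order of the indices induced by `f`. -/
def lowerPart (f : ι → ℕ) (A : Matrix ι ι ℂ) : Matrix ι ι ℂ :=
  Matrix.of fun i j => if f j < f i then A i j else 0

theorem abs_re_dotProduct_mulVec_le {A : Matrix ι ι ℂ} (hA : A.IsHermitian) {X : Finset ι}
    {M : ℝ}
    (hb : ∀ v, (∀ i ∉ X, v i = 0) → |quadForm A v| ≤ M * ∑ i, Complex.normSq (v i))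
    {u v : ι → ℂ} (hu : ∀ i ∉ X, u i = 0) (hv : ∀ i ∉ X, v i = 0) :
    |(star u ⬝ᵥ A *ᵥ v).re|
      ≤ M / 2 * (∑ i, Complex.normSq (u i) + ∑ i, Complex.normSq (v i)) := by
  have h1 := abs_le.1 (hb (u + v) fun i hi => by simp [hu i hi, hv i hi])
  have h2 := abs_le.1 (hb (u - v) fun i hi => by simp [hu i hi, hv i hi])
  have h3 : (star v ⬝ᵥ A *ᵥ u).re = (star u ⬝ᵥ A *ᵥ v).re := by
    have h4 : star (star u ⬝ᵥ A *ᵥ v) = star v ⬝ᵥ A *ᵥ u := by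
      rw [Matrix.star_dotProduct, star_star, Matrix.star_mulVec, hA.eq,
        ← Matrix.dotProduct_mulVec]
    rw [← h4]
    rfl
  have hp : quadForm A (u + v) = quadForm A u + quadForm A v + 2 * (star u ⬝ᵥ A *ᵥ v).re := by
    simp only [quadForm, star_add, Matrix.mulVec_add, add_dotProduct, dotProduct_add,
      Complex.add_re, h3]
    ring
  have hm : quadForm A (u - v) = quadForm A u + quadForm A v - 2 * (star u ⬝ᵥ A *ᵥ v).re := by
    simp only [quadForm, star_sub, Matrix.mulVec_sub, sub_dotProduct, dotProduct_sub,
      Complex.sub_re, h3]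
    ring
  have hE : ∑ i, Complex.normSq ((u + v) i) + ∑ i, Complex.normSq ((u - v) i)
      = 2 * (∑ i, Complex.normSq (u i) + ∑ i, Complex.normSq (v i)) := by
    rw [← Finset.sum_add_distrib, ← Finset.sum_add_distrib, Finset.mul_sum]
    refine Finset.sum_congr rfl fun i _ => ?_
    simp only [Pi.add_apply, Pi.sub_apply, Complex.normSq_add, Complex.normSq_sub]
    ring
  have hE' : M * ∑ i, Complex.normSq ((u + v) i) + M * ∑ i, Complex.normSq ((u - v) i)
      = M * (2 * (∑ i, Complex.normSq (u i) + ∑ i, Complex.normSq (v i))) := by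
    rw [← hE]
    ring
  rw [hp] at h1
  rw [hm] at h2
  rw [abs_le]
  constructor <;> linarith

theorem sum_sum_normSq_ite {κ : Type*} [Fintype κ] [DecidableEq κ] (c : ι → κ) (u : ι → ℂ) :
    ∑ l, ∑ i, Complex.normSq (if c i = l then u i else 0) = ∑ i, Complex.normSq (u i) := by
  rw [Finset.sum_comm]
  refine Finset.sum_congr rfl fun i _ => ?_
  simp [apply_ite Complex.normSq]

/-- Decomposition of the lower part for a lexicographic order. -/
theorem re_dotProduct_lowerPart_mulVec {k : ℕ} (A : Matrix ι ι ℂ) (f : ι → ℕ) (c : ι → Fin k)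
    (g : Fin k → ι → ℕ)
    (hf : ∀ i j, f j < f i ↔ c j < c i ∨ c j = c i ∧ g (c i) j < g (c i) i) (u v : ι → ℂ) :
    (star u ⬝ᵥ lowerPart f A *ᵥ v).re =
      ∑ l, (star (fun i => if c i = l then u i else 0) ⬝ᵥ lowerPart (g l) A *ᵥ
        (fun i => if c i = l then v i else 0)).re
      + ∑ a, ∑ b, if b < a then (star (fun i => if c i = a then u i else 0) ⬝ᵥ A *ᵥ
        (fun i => if c i = b then v i else 0)).re else 0 := by
  have h1 : ∀ (D : Matrix ι ι ℂ) (x y : ι → ℂ), (star x ⬝ᵥ D *ᵥ y).re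
      = ∑ i, ∑ j, (star (x i) * D i j * y j).re := by
    intro D x y
    simp only [dotProduct, mulVec, Finset.mul_sum, Complex.re_sum, Pi.star_apply, mul_assoc]
  have h2 : ∀ a b : Fin k, (if b < a then (star (fun i => if c i = a then u i else 0) ⬝ᵥ A *ᵥ
        (fun i => if c i = b then v i else 0)).re else 0)
      = ∑ i, ∑ j, if c i = a then if c j = b then if b < a then
          (star (u i) * A i j * v j).re else 0 else 0 else 0 := by
    intro a b
    rw [h1]
    split_ifs with hab
    · refine Finset.sum_congr rfl fun i _ => Finset.sum_congr rfl fun j _ => ?_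
      split_ifs <;> simp
    · simp
  have h3 : ∀ l : Fin k, (star (fun i => if c i = l then u i else 0) ⬝ᵥ lowerPart (g l) A *ᵥ
        (fun i => if c i = l then v i else 0)).re
      = ∑ i, ∑ j, if c i = l then if c j = l then if g l j < g l i then
          (star (u i) * A i j * v j).re else 0 else 0 else 0 := by
    intro l
    rw [h1]
    refine Finset.sum_congr rfl fun i _ => Finset.sum_congr rfl fun j _ => ?_
    simp only [lowerPart, Matrix.of_apply]
    split_ifs <;> simp
  simp only [h2, h3]
  rw [h1]
  have h4 : ∀ F : Fin k → Fin k → ι → ι → ℝ, ∑ a, ∑ b, ∑ i, ∑ j, F a b i j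
      = ∑ i, ∑ j, ∑ a, ∑ b, F a b i j := by
    intro F
    calc _ = ∑ a, ∑ i, ∑ b, ∑ j, F a b i j :=
          Finset.sum_congr rfl fun a _ => Finset.sum_comm
      _ = ∑ i, ∑ a, ∑ b, ∑ j, F a b i j := Finset.sum_comm
      _ = ∑ i, ∑ a, ∑ j, ∑ b, F a b i j :=
          Finset.sum_congr rfl fun i _ => Finset.sum_congr rfl fun a _ => Finset.sum_comm
      _ = _ := Finset.sum_congr rfl fun i _ => Finset.sum_comm
  have h5 : ∀ F : Fin k → ι → ι → ℝ, ∑ l, ∑ i, ∑ j, F l i j = ∑ i, ∑ j, ∑ l, F l i j := by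
    intro F
    rw [Finset.sum_comm]
    exact Finset.sum_congr rfl fun i _ => Finset.sum_comm
  rw [h4, h5, ← Finset.sum_add_distrib]
  refine Finset.sum_congr rfl fun i _ => ?_
  rw [← Finset.sum_add_distrib]
  refine Finset.sum_congr rfl fun j _ => ?_
  simp only [lowerPart, Matrix.of_apply, hf, Finset.sum_ite_eq, Finset.sum_ite_irrel,
    Finset.sum_const_zero, Finset.mem_univ, if_true]
  rcases lt_trichotomy (c j) (c i) with h | h | h
  · simp [h, h.ne]
  · simp [h]
    split_ifs <;> simp
  · simp [h.not_gt, h.ne']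

theorem exists_rank_lowerPart_le [DecidableEq ι] {A : Matrix ι ι ℂ} (hA : A.IsHermitian)
    (h0 : ∀ i, A i i = 0) (X : Finset ι) {M : ℝ} (hM : 0 ≤ M)
    (hb : ∀ v, (∀ i ∉ X, v i = 0) → |quadForm A v| ≤ M * ∑ i, Complex.normSq (v i)) :
    ∃ f : ι → ℕ, Set.InjOn f X ∧ ∀ u v, (∀ i ∉ X, u i = 0) → (∀ i ∉ X, v i = 0) →
      |(star u ⬝ᵥ lowerPart f A *ᵥ v).re|
        ≤ 224 * M * (∑ i, Complex.normSq (u i) + ∑ i, Complex.normSq (v i)) := by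
  induction hn : X.card using Nat.strong_induction_on generalizing X M with
  | _ n ih =>
  subst hn
  rcases le_or_gt X.card 1 with hX | hX
  · refine ⟨fun _ => 0, fun a ha b hb _ => Finset.card_le_one.1 hX a ha b hb, fun u v _ _ => ?_⟩
    have : lowerPart (fun _ : ι => 0) A = 0 := by
      ext i j
      simp [lowerPart]
    rw [this]
    simp only [Matrix.zero_mulVec, dotProduct_zero, Complex.zero_re, abs_zero]
    have := Finset.sum_nonneg fun i (_ : i ∈ Finset.univ) => Complex.normSq_nonneg (u i)
    have := Finset.sum_nonneg fun i (_ : i ∈ Finset.univ) => Complex.normSq_nonneg (v i)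
    positivity
  obtain ⟨c, hc⟩ := exists_proper_coloring_abs_quadForm_le hA h0 hX hM hb
  have hg : ∀ l, _ := fun l => ih _ (hc l).1 (X.filter (c · = l)) (M := 6 / 7 * M)
    (by positivity) (hc l).2 rfl
  choose g hginj hg using hg
  set N := ∑ l, ∑ i, g l i + 1 with hN
  have hgN : ∀ l i, g l i < N := by
    intro l i
    have h1 := Finset.single_le_sum (f := fun i => g l i) (fun _ _ => Nat.zero_le _)
      (Finset.mem_univ i)
    have h2 := Finset.single_le_sum (f := fun l => ∑ i, g l i) (fun _ _ => Nat.zero_le _)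
      (Finset.mem_univ l)
    exact Nat.lt_succ_of_le (h1.trans h2)
  have hlex : ∀ {p q x y : ℕ}, y < N → p < q → p * N + y < q * N + x := by
    intro p q x y hy hpq
    nlinarith [Nat.mul_le_mul_right N (Nat.succ_le_of_lt hpq)]
  set f : ι → ℕ := fun i => (c i : ℕ) * N + g (c i) i with hfdef
  have hf : ∀ i j, f j < f i ↔ c j < c i ∨ c j = c i ∧ g (c i) j < g (c i) i := by
    intro i j
    rcases lt_trichotomy (c j) (c i) with h | h | h
    · simp [h, hfdef, hlex (hgN _ _) (Fin.lt_def.1 h)]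
    · simp [h, hfdef]
    · simp only [h.not_gt, h.ne', false_and, or_self, iff_false, not_lt]
      exact (hlex (hgN _ _) (Fin.lt_def.1 h)).le
  refine ⟨f, fun i hi j hj hij => ?_, fun u v hu hv => ?_⟩
  · have h1 := (hf i j).not.1 hij.symm.not_lt
    have h2 := (hf j i).not.1 hij.not_lt
    push Not at h1 h2
    have hcc : c i = c j := le_antisymm h1.1 h2.1
    refine hginj (c i) (by simpa using hi) (by simpa [hcc] using hj) ?_
    have h3 := h1.2 hcc.symm
    have h4 := h2.2 hcc
    rw [← hcc] at h4
    exact le_antisymm h3 h4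
  · rw [re_dotProduct_lowerPart_mulVec A f c g hf]
    have hEu := sum_sum_normSq_ite c u
    have hEv := sum_sum_normSq_ite c v
    have hpos : ∀ x : ι → ℂ, 0 ≤ ∑ i, Complex.normSq (x i) := fun x =>
      Finset.sum_nonneg fun i _ => Complex.normSq_nonneg _
    set U : Fin 64 → ℝ := fun l => ∑ i, Complex.normSq (if c i = l then u i else 0) with hU
    set V : Fin 64 → ℝ := fun l => ∑ i, Complex.normSq (if c i = l then v i else 0) with hV
    have hU0 : ∀ l, 0 ≤ U l := fun l => hpos _
    have hV0 : ∀ l, 0 ≤ V l := fun l => hpos _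
    have hsupp : ∀ (x : ι → ℂ), (∀ i ∉ X, x i = 0) → ∀ l, ∀ i ∉ X.filter (c · = l),
        (if c i = l then x i else 0) = 0 := by
      intro x hx l i hi
      split_ifs with h
      · exact hx i fun h' => hi (Finset.mem_filter.2 ⟨h', h⟩)
      · rfl
    have hsupp' : ∀ (x : ι → ℂ), (∀ i ∉ X, x i = 0) → ∀ l : Fin 64, ∀ i ∉ X,
        (if c i = l then x i else 0) = 0 := by
      intro x hx l i hi
      simp [hx i hi]
    have h1 : |∑ l, (star (fun i => if c i = l then u i else 0) ⬝ᵥ lowerPart (g l) A *ᵥ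
        (fun i => if c i = l then v i else 0)).re| ≤ ∑ l, 192 * M * (U l + V l) := by
      refine (Finset.abs_sum_le_sum_abs _ _).trans (Finset.sum_le_sum fun l _ => ?_)
      refine (hg l _ _ (hsupp u hu l) (hsupp v hv l)).trans_eq ?_
      ring
    have h2 : |∑ a, ∑ b, if b < a then (star (fun i => if c i = a then u i else 0) ⬝ᵥ A *ᵥ
        (fun i => if c i = b then v i else 0)).re else 0|
        ≤ ∑ a : Fin 64, ∑ b : Fin 64, M / 2 * (U a + V b) := by
      refine (Finset.abs_sum_le_sum_abs _ _).trans (Finset.sum_le_sum fun a _ => ?_)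
      refine (Finset.abs_sum_le_sum_abs _ _).trans (Finset.sum_le_sum fun b _ => ?_)
      split_ifs
      · exact abs_re_dotProduct_mulVec_le hA hb (hsupp' u hu a) (hsupp' v hv b)
      · have := hU0 a
        have := hV0 b
        rw [abs_zero]
        positivity
    refine (abs_add_le _ _).trans ((add_le_add h1 h2).trans_eq ?_)
    simp only [← Finset.mul_sum, Finset.sum_add_distrib, Finset.sum_const, Finset.card_univ,
      Fintype.card_fin, nsmul_eq_mul]
    rw [hEu, hEv]
    push_cast
    ring

end

section

variable {n : ℕ}

theorem norm_toLp_sq (v : Fin n → ℂ) :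
    ‖WithLp.toLp 2 v‖ ^ 2 = ∑ i, Complex.normSq (v i) := by
  simp [EuclideanSpace.norm_sq_eq, Complex.normSq_eq_norm_sq]

theorem abs_quadForm_le_specNorm (B : Matrix (Fin n) (Fin n) ℂ) (v : Fin n → ℂ) :
    |quadForm B v| ≤ specNorm B * ∑ i, Complex.normSq (v i) := by
  have h1 : star v ⬝ᵥ B *ᵥ v
      = inner ℂ (WithLp.toLp 2 v) (Matrix.toEuclideanCLM (𝕜 := ℂ) B (WithLp.toLp 2 v)) := by
    rw [Matrix.toEuclideanCLM_toLp, EuclideanSpace.inner_toLp_toLp, dotProduct_comm]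
  calc |quadForm B v| ≤ ‖star v ⬝ᵥ B *ᵥ v‖ := Complex.abs_re_le_norm _
    _ ≤ ‖WithLp.toLp 2 v‖ * ‖Matrix.toEuclideanCLM (𝕜 := ℂ) B (WithLp.toLp 2 v)‖ := by
      rw [h1]
      exact norm_inner_le_norm _ _
    _ ≤ ‖WithLp.toLp 2 v‖ * (specNorm B * ‖WithLp.toLp 2 v‖) :=
      mul_le_mul_of_nonneg_left (ContinuousLinearMap.le_opNorm _ _) (norm_nonneg _)
    _ = specNorm B * ∑ i, Complex.normSq (v i) := by
      rw [← norm_toLp_sq]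
      ring

theorem specNorm_le_of_re_dotProduct_le {L : Matrix (Fin n) (Fin n) ℂ} {K : ℝ} (hK : 0 < K)
    (h : ∀ u v : Fin n → ℂ, |(star u ⬝ᵥ L *ᵥ v).re|
      ≤ K / 2 * (∑ i, Complex.normSq (u i) + ∑ i, Complex.normSq (v i))) : specNorm L ≤ K := by
  refine ContinuousLinearMap.opNorm_le_bound _ hK.le fun x => ?_
  obtain ⟨v, rfl⟩ : ∃ v, WithLp.toLp 2 v = x := ⟨x.ofLp, rfl⟩
  rw [Matrix.toEuclideanCLM_toLp]
  refine le_of_sq_le_sq ?_ (by positivity)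
  rw [mul_pow, norm_toLp_sq, norm_toLp_sq]
  have h1 := (abs_le.1 (h (((K⁻¹ : ℝ) : ℂ) • (L *ᵥ v)) v)).2
  have h2 : star (((K⁻¹ : ℝ) : ℂ) • (L *ᵥ v)) ⬝ᵥ L *ᵥ v
      = ((K⁻¹ * ∑ i, Complex.normSq ((L *ᵥ v) i) : ℝ) : ℂ) := by
    simp only [dotProduct, Pi.star_apply, Complex.ofReal_mul, Complex.ofReal_sum,
      Complex.normSq_eq_conj_mul_self, Finset.mul_sum]
    simp [mul_assoc]
  have h3 : ∑ i, Complex.normSq ((((K⁻¹ : ℝ) : ℂ) • (L *ᵥ v)) i)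
      = K⁻¹ ^ 2 * ∑ i, Complex.normSq ((L *ᵥ v) i) := by
    rw [Finset.mul_sum]
    refine Finset.sum_congr rfl fun i _ => ?_
    rw [Pi.smul_apply, smul_eq_mul, Complex.normSq_mul, Complex.normSq_ofReal]
    ring
  rw [h2, h3, Complex.ofReal_re] at h1
  set S := ∑ i, Complex.normSq ((L *ᵥ v) i)
  set T := ∑ i, Complex.normSq (v i)
  have h4 : K / 2 * (K⁻¹ ^ 2 * S + T) = K⁻¹ * S / 2 + K * T / 2 := by
    field_simp
  have h5 : K⁻¹ * S ≤ K * T := by linarith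
  rw [inv_mul_le_iff₀ hK] at h5
  linarith

end

theorem re_dotProduct_lowerTri_submatrix {n : ℕ} {A B : Matrix (Fin n) (Fin n) ℂ}
    (hAB : ∀ i j, i ≠ j → A i j = B i j) {f : Fin n → ℕ} {σ : Equiv.Perm (Fin n)}
    (hσ : StrictMono (f ∘ σ)) (u v : Fin n → ℂ) :
    star u ⬝ᵥ lowerTri (B.submatrix σ σ) *ᵥ v
      = star (u ∘ σ.symm) ⬝ᵥ lowerPart f A *ᵥ (v ∘ σ.symm) := by
  simp only [dotProduct, mulVec]
  rw [← Equiv.sum_comp σ fun i => star (u ∘ σ.symm) i * _]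
  refine Finset.sum_congr rfl fun i _ => ?_
  rw [← Equiv.sum_comp σ fun j => lowerPart f A (σ i) j * _]
  simp only [Pi.star_apply, Function.comp_apply, Equiv.symm_apply_apply]
  congr 1
  refine Finset.sum_congr rfl fun j _ => ?_
  have h1 : f (σ j) < f (σ i) ↔ j < i := hσ.lt_iff_lt
  simp only [lowerTri, lowerPart, Matrix.of_apply, h1, Matrix.submatrix_apply]
  split_ifs with hij
  · rw [hAB _ _ (σ.injective.ne hij.ne')]
  · rfl

/-- Theorem 3 (Kashin): for every Hermitian B some reordering σ gives ‖L_σ‖ ≤ C₂‖B‖,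
with an absolute constant C₂ (one may take C₂ = 2907). -/
theorem exists_perm_lowerTri_bound_hermitian :
    ∃ C₂ : ℝ, C₂ ≤ 2907 ∧
      ∀ (n : ℕ) (B : Matrix (Fin n) (Fin n) ℂ), B.IsHermitian →
        ∃ σ : Equiv.Perm (Fin n),
          specNorm (lowerTri (B.submatrix σ σ)) ≤ C₂ * specNorm B := by
  refine ⟨896, by norm_num, fun n B hB => ?_⟩
  have hB0 : 0 ≤ specNorm B := norm_nonneg _
  have hq := abs_quadForm_le_specNorm B
  have hdiag : ∀ i, |(B i i).re| ≤ specNorm B := fun i => by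
    have h := hq (Pi.single i 1)
    have h1 : ∑ j, Complex.normSq ((Pi.single i 1 : Fin n → ℂ) j) = 1 := by
      rw [Finset.sum_eq_single i (fun j _ hj => by simp [hj]) (by simp)]
      simp
    rw [h1, mul_one] at h
    simpa [quadForm, ← Pi.single_star] using h
  set A : Matrix (Fin n) (Fin n) ℂ := B - Matrix.diagonal fun i => B i i with hA
  have hAh : A.IsHermitian := hB.sub (by
    ext i j
    by_cases hij : i = j
    · subst hij
      simpa using hB.apply i i
    · simp [hij, Ne.symm hij])
  have hAB : ∀ i j, i ≠ j → A i j = B i j := fun i j hij => by simp [hA, hij]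
  have hAq : ∀ v, (∀ i ∉ Finset.univ, v i = 0) →
      |quadForm A v| ≤ 2 * specNorm B * ∑ i, Complex.normSq (v i) := by
    intro v _
    have h1 : quadForm A v = quadForm B v - ∑ i, (B i i).re * Complex.normSq (v i) := by
      simp only [quadForm, hA, Matrix.sub_mulVec, dotProduct_sub, Complex.sub_re]
      congr 1
      simp only [dotProduct, Matrix.mulVec_diagonal, Complex.re_sum, Pi.star_apply]
      refine Finset.sum_congr rfl fun i _ => ?_
      rw [← Complex.re_mul_ofReal, Complex.normSq_eq_conj_mul_self, starRingEnd_apply]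
      congr 1
      ring
    have h2 : |∑ i, (B i i).re * Complex.normSq (v i)|
        ≤ specNorm B * ∑ i, Complex.normSq (v i) := by
      rw [Finset.mul_sum]
      refine (Finset.abs_sum_le_sum_abs _ _).trans (Finset.sum_le_sum fun i _ => ?_)
      rw [abs_mul, abs_of_nonneg (Complex.normSq_nonneg _)]
      exact mul_le_mul_of_nonneg_right (hdiag i) (Complex.normSq_nonneg _)
    rw [h1]
    linarith [abs_sub (quadForm B v) (∑ i, (B i i).re * Complex.normSq (v i)), hq v]
  obtain ⟨f, hf, hfb⟩ := exists_rank_lowerPart_le hAh (fun i => by simp [hA]) Finset.univ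
    (by positivity) hAq
  rw [Finset.coe_univ, Set.injOn_univ] at hf
  have hσ : StrictMono (f ∘ Tuple.sort f) :=
    (Tuple.monotone_sort f).strictMono_of_injective (hf.comp (Tuple.sort f).injective)
  have hform : ∀ u v : Fin n → ℂ,
      |(star u ⬝ᵥ lowerTri (B.submatrix (Tuple.sort f) (Tuple.sort f)) *ᵥ v).re|
        ≤ 896 * specNorm B / 2 * (∑ i, Complex.normSq (u i) + ∑ i, Complex.normSq (v i)) := by
    intro u v
    rw [re_dotProduct_lowerTri_submatrix hAB hσ]
    refine (hfb _ _ (by simp) (by simp)).trans_eq ?_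
    simp only [Function.comp_apply]
    rw [Equiv.sum_comp (Tuple.sort f).symm fun i => Complex.normSq (u i),
      Equiv.sum_comp (Tuple.sort f).symm fun i => Complex.normSq (v i)]
    ring
  refine ⟨Tuple.sort f, le_of_forall_pos_le_add fun ε hε => ?_⟩
  refine specNorm_le_of_re_dotProduct_le (by positivity) fun u v => (hform u v).trans ?_
  have h1 : 0 ≤ ∑ i, Complex.normSq (u i) + ∑ i, Complex.normSq (v i) :=
    add_nonneg (Finset.sum_nonneg fun i _ => Complex.normSq_nonneg _)
      (Finset.sum_nonneg fun i _ => Complex.normSq_nonneg _)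
  exact mul_le_mul_of_nonneg_right (by linarith) h1
end
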